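/- Let 1/2 < η < 3/5 and set c(η) = (3 − 5η)/(2(1 − η)). Then for every ε > 0 there is an x₀ such that for all x ≥ x₀, the number of primes p ≤ x with p ∤ D_A for which there exists a prime q > x^η dividing p − χ(p) is at least (c(η) − ε)·π(x). -/

import Mathlib

open Matrix

open Classical in
/-- `χ(p) = 1` if `tr(A)² - 4` is a nonzero square mod `p`, `-1` otherwise. -/
noncomputable def chi (A : Matrix (Fin 2) (Fin 2) ℤ) (p : ℕ) : ℤ :=
  if ((A.trace ^ 2 - 4 : ℤ) : ZMod p) ≠ 0 ∧ IsSquare ((A.trace ^ 2 - 4 : ℤ) : ZMod p)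
  then 1 else -1

namespace PNTL
open MeasureTheory Filter Topology Complex

noncomputable def tri (l t : ℝ) : ℝ := max 0 (1 - |t| / l)

noncomputable def ker (l v : ℝ) : ℝ := 2 * (1 - Real.cos (l * v)) / (l * v ^ 2)

lemma tri_nonneg (l t : ℝ) : 0 ≤ tri l t := le_max_left _ _

lemma tri_continuous (l : ℝ) : Continuous (tri l) := by unfold tri; fun_prop

lemma tri_le_one {l : ℝ} (hl : 0 < l) (t : ℝ) : tri l t ≤ 1 := by
  unfold tri
  apply max_le zero_le_one
  have : 0 ≤ |t| / l := by positivity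
  linarith

lemma tri_zero {l : ℝ} (hl : 0 < l) {t : ℝ} (ht : l ≤ |t|) : tri l t = 0 := by
  unfold tri
  apply max_eq_left
  have : 1 ≤ |t| / l := (one_le_div hl).2 ht
  linarith

lemma tri_support {l : ℝ} (hl : 0 < l) : HasCompactSupport (tri l) := by
  apply HasCompactSupport.intro (isCompact_Icc (a := -l) (b := l))
  intro t ht
  apply tri_zero hl
  by_contra h
  push Not at h
  exact ht (abs_le.1 h.le)

lemma int_half {l : ℝ} (hl : 0 < l) (c : ℂ) (hc : c ≠ 0) :
    ∫ t in (0:ℝ)..l, ((1 - t / l : ℝ) : ℂ) * Complex.exp (c * t) =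
      (Complex.exp (c * l) - 1) / (l * c ^ 2) - 1 / c := by
  have hl' : (l : ℂ) ≠ 0 := by exact_mod_cast hl.ne'
  have hd : ∀ t : ℝ, HasDerivAt (fun t : ℝ => (1 - (t:ℂ) / l) * Complex.exp (c * t) / c +
      Complex.exp (c * t) / (l * c ^ 2)) (((1 - t / l : ℝ) : ℂ) * Complex.exp (c * t)) t := by
    intro t
    have h1 : HasDerivAt (fun t : ℝ => (t : ℂ)) 1 t := Complex.ofRealCLM.hasDerivAt
    have h2 : HasDerivAt (fun t : ℝ => Complex.exp (c * t)) (Complex.exp (c * t) * (c * 1)) t :=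
      (h1.const_mul c).cexp
    have h3 : HasDerivAt (fun t : ℝ => (1 - (t:ℂ) / l)) (-(1 / l)) t := by
      simpa using (h1.div_const (l:ℂ)).const_sub 1
    convert! ((h3.mul h2).div_const c).add (h2.div_const (l * c ^ 2)) using 1
    push_cast
    field_simp
    ring
  rw [intervalIntegral.integral_eq_sub_of_hasDerivAt (fun t _ => hd t)]
  · simp
    field_simp
    ring
  · apply Continuous.intervalIntegrable
    fun_prop

lemma int_tri {l : ℝ} (hl : 0 < l) {v : ℝ} (hv : v ≠ 0) :
    ∫ t : ℝ, (tri l t : ℂ) * Complex.exp (v * t * I) = (ker l v : ℂ) := by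
  have hvI : (v * I : ℂ) ≠ 0 := by simp [hv]
  have h0 : ∫ t : ℝ, (tri l t : ℂ) * Complex.exp (v * t * I) =
      ∫ t in (-l)..l, (tri l t : ℂ) * Complex.exp (v * t * I) := by
    rw [intervalIntegral.integral_of_le (by linarith)]
    rw [setIntegral_eq_integral_of_forall_compl_eq_zero]
    intro t ht
    rw [tri_zero hl]; · simp
    by_contra h
    push Not at h
    have := abs_lt.1 h
    exact ht ⟨this.1, this.2.le⟩
  have hcont : Continuous (fun t : ℝ => (tri l t : ℂ) * Complex.exp (v * t * I)) := by
    have := tri_continuous l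
    fun_prop
  rw [h0, ← intervalIntegral.integral_add_adjacent_intervals (b := 0)
    (hcont.intervalIntegrable _ _) (hcont.intervalIntegrable _ _)]
  have e1 : ∫ t in (-l)..0, (tri l t : ℂ) * Complex.exp (v * t * I) =
      ∫ t in (0:ℝ)..l, ((1 - t / l : ℝ) : ℂ) * Complex.exp (-(v * I) * t) := by
    have := intervalIntegral.integral_comp_neg (a := 0) (b := l)
      (fun t : ℝ => (tri l t : ℂ) * Complex.exp (v * t * I))
    rw [neg_zero] at this
    rw [← this]
    apply intervalIntegral.integral_congr
    intro t ht
    rw [Set.uIcc_of_le hl.le] at ht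
    have : tri l (-t) = 1 - t / l := by
      unfold tri
      rw [abs_neg, abs_of_nonneg ht.1]
      apply max_eq_right
      have := (div_le_one hl).2 ht.2
      linarith
    simp only [this]
    congr 2
    push_cast; ring
  have e2 : ∫ t in (0:ℝ)..l, (tri l t : ℂ) * Complex.exp (v * t * I) =
      ∫ t in (0:ℝ)..l, ((1 - t / l : ℝ) : ℂ) * Complex.exp ((v * I) * t) := by
    apply intervalIntegral.integral_congr
    intro t ht
    rw [Set.uIcc_of_le hl.le] at ht
    have : tri l t = 1 - t / l := by
      unfold tri
      rw [abs_of_nonneg ht.1]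
      apply max_eq_right
      have := (div_le_one hl).2 ht.2
      linarith
    simp only [this]
    congr 2
    ring
  rw [e1, e2, int_half hl _ hvI, int_half hl _ (neg_ne_zero.2 hvI)]
  have hcos : Complex.exp (v * I * l) + Complex.exp (-(v * I) * l) = 2 * (Real.cos (l * v) : ℂ) := by
    rw [Complex.ofReal_cos, Complex.cos]
    push_cast
    rw [show (v * I * l : ℂ) = l * v * I by ring, show (-(v * I) * l : ℂ) = -(l * v) * I by ring]
    ring
  have hvc : (v : ℂ) ≠ 0 := by exact_mod_cast hv
  have hlc : (l : ℂ) ≠ 0 := by exact_mod_cast hl.ne'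
  unfold ker
  have hI : (v * I : ℂ) ^ 2 = - v ^ 2 := by rw [mul_pow, I_sq]; ring
  rw [show (-(v * I) : ℂ)^2 = (v * I)^2 by ring, hI]
  have : (Complex.exp (-(v * I) * l) - 1) / (l * -(v:ℂ) ^ 2) - 1 / -(v * I) +
    ((Complex.exp (v * I * l) - 1) / (l * -(v:ℂ) ^ 2) - 1 / (v * I)) =
    ((Complex.exp (v * I * l) + Complex.exp (-(v * I) * l)) - 2) / (l * -(v:ℂ) ^ 2) := by
    rw [div_neg]; ring
  rw [this, hcos]
  push_cast
  field_simp
  ring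

lemma ker_nonneg {l : ℝ} (hl : 0 < l) (v : ℝ) : 0 ≤ ker l v := by
  unfold ker
  have := Real.cos_le_one (l * v)
  apply div_nonneg
  · linarith
  · positivity

lemma ker_le {l : ℝ} (hl : 0 < l) (v : ℝ) : ker l v ≤ 4 / (l * v ^ 2) := by
  unfold ker
  have := Real.neg_one_le_cos (l * v)
  gcongr
  linarith

lemma ker_le' {l : ℝ} (hl : 0 < l) (v : ℝ) : ker l v ≤ l := by
  unfold ker
  have := Real.one_sub_sq_div_two_le_cos (x := l * v)
  apply div_le_of_le_mul₀ (by positivity) hl.le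
  nlinarith

lemma ker_measurable (l : ℝ) : Measurable (ker l) := by
  unfold ker; fun_prop

lemma ker_integrable {l : ℝ} (hl : 0 < l) : Integrable (ker l) := by
  have h := (integrable_inv_one_add_sq).const_mul (l + 4 / l)
  refine h.mono' (ker_measurable l).aestronglyMeasurable ?_
  filter_upwards with v
  rw [Real.norm_of_nonneg (ker_nonneg hl v), ← div_eq_mul_inv, le_div_iff₀ (by positivity), mul_add, mul_one]
  refine add_le_add (ker_le' hl v) ?_
  have := ker_le hl v
  by_cases hv : v = 0
  · simp [hv]; positivity
  calc ker l v * v ^ 2 ≤ 4 / (l * v ^ 2) * v ^ 2 := by gcongr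
    _ = 4 / l := by field_simp

lemma ker_scale {l : ℝ} (hl : 0 < l) (v : ℝ) : ker l v = l * ker 1 (l * v) := by
  unfold ker
  by_cases hv : v = 0
  · simp [hv]
  field_simp

end PNTL

namespace PNTL
open MeasureTheory Filter Topology Complex

section
variable {b : ℝ → ℝ} {C : ℝ} {H : ℂ → ℂ}

lemma fub (hb : Measurable b) (hC : ∀ u > 0, |b u| ≤ C)
    (heq : ∀ s : ℂ, 1 < s.re → ∫ u in Set.Ioi (0:ℝ), (b u : ℂ) * Complex.exp (-(s - 1) * u) = H s)
    {l : ℝ} (hl : 0 < l) (y : ℝ) {ε : ℝ} (hε : 0 < ε) :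
    ∫ t : ℝ, (tri l t : ℂ) * Complex.exp (y * t * I) * H (1 + ε + t * I) =
      ∫ u in Set.Ioi (0:ℝ), ((b u * Real.exp (-ε * u) * ker l (y - u) : ℝ) : ℂ) := by
  have hint : Integrable (fun p : ℝ × ℝ => (tri l p.1 : ℂ) * Complex.exp (y * p.1 * I) *
      ((b p.2 : ℂ) * Complex.exp (-((1 + ε + p.1 * I : ℂ) - 1) * p.2)))
      ((volume : Measure ℝ).prod (volume.restrict (Set.Ioi (0:ℝ)))) := by
    have h1 : Integrable (tri l) := (tri_continuous l).integrable_of_hasCompactSupport (tri_support hl)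
    have h2 : Integrable (fun u : ℝ => C * Real.exp (-ε * u)) (volume.restrict (Set.Ioi (0:ℝ))) :=
      (exp_neg_integrableOn_Ioi 0 hε).const_mul C
    have h3 := h1.mul_prod h2
    refine h3.mono' ?_ ?_
    · have := tri_continuous l
      apply Measurable.aestronglyMeasurable
      fun_prop
    · have hae : ∀ᵐ p : ℝ × ℝ ∂((volume : Measure ℝ).prod (volume.restrict (Set.Ioi (0:ℝ)))),
          p.2 ∈ Set.Ioi (0:ℝ) := by
        have := ae_restrict_mem (μ := (volume : Measure ℝ)) (measurableSet_Ioi (a := (0:ℝ)))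
        exact Measure.quasiMeasurePreserving_snd.ae this
      filter_upwards [hae] with p hp
      simp only [norm_mul, Complex.norm_exp]
      have e1 : ((y:ℂ) * p.1 * I).re = 0 := by simp
      have e2 : (-((1 + ε + p.1 * I : ℂ) - 1) * p.2).re = -ε * p.2 := by simp
      rw [e1, e2, Real.exp_zero, mul_one, Complex.norm_of_nonneg (tri_nonneg l _), Complex.norm_real]
      gcongr
      · exact tri_nonneg _ _
      · exact hC _ hp
  have h1 : ∀ t : ℝ, (tri l t : ℂ) * Complex.exp (y * t * I) * H (1 + ε + t * I) =
      ∫ u in Set.Ioi (0:ℝ), (tri l t : ℂ) * Complex.exp (y * t * I) *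
      ((b u : ℂ) * Complex.exp (-((1 + ε + t * I : ℂ) - 1) * u)) := by
    intro t
    rw [← heq (1 + ε + t * I) (by simp [hε]), ← MeasureTheory.integral_const_mul]
  simp_rw [h1]
  rw [integral_integral_swap hint]
  apply integral_congr_ae
  have : ∀ᵐ u : ℝ ∂(volume.restrict (Set.Ioi (0:ℝ))), u ≠ y := by
    apply ae_restrict_of_ae
    exact Measure.ae_ne volume y
  filter_upwards [this] with u hu
  have e : ∀ t : ℝ, (tri l t : ℂ) * Complex.exp (y * t * I) *
      ((b u : ℂ) * Complex.exp (-((1 + ε + t * I : ℂ) - 1) * u)) =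
      ((b u * Real.exp (-ε * u) : ℝ) : ℂ) * ((tri l t : ℂ) * Complex.exp ((y - u : ℝ) * t * I)) := by
    intro t
    push_cast
    rw [show -((1 + ε + t * I : ℂ) - 1) * u = -ε * u + -(t * I * u) by ring, Complex.exp_add,
      show ((y:ℂ) - u) * t * I = y * t * I + -(t * I * u) by ring, Complex.exp_add]
    ring
  simp_rw [e]
  rw [MeasureTheory.integral_const_mul, int_tri hl (sub_ne_zero.2 hu.symm)]
  push_cast
  ring

lemma limit_eq (hb : Measurable b) (hC : ∀ u > 0, |b u| ≤ C) (hH : ContinuousOn H {s | 1 ≤ s.re})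
    (heq : ∀ s : ℂ, 1 < s.re → ∫ u in Set.Ioi (0:ℝ), (b u : ℂ) * Complex.exp (-(s - 1) * u) = H s)
    {l : ℝ} (hl : 0 < l) (y : ℝ) :
    ∫ t : ℝ, (tri l t : ℂ) * Complex.exp (y * t * I) * H (1 + t * I) =
      ((∫ u in Set.Ioi (0:ℝ), b u * ker l (y - u) : ℝ) : ℂ) := by
  let e : ℕ → ℝ := fun n => 1 / ((n:ℝ) + 1)
  have he : Tendsto e atTop (𝓝 0) := tendsto_one_div_add_atTop_nhds_zero_nat
  have hepos : ∀ n, 0 < e n := fun n => by positivity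
  have hele : ∀ n, e n ≤ 1 := fun n => by
    have : (0:ℝ) ≤ n := Nat.cast_nonneg n
    exact (div_le_one (by positivity)).2 (by linarith)
  -- bound of H on compact set
  let K : Set (ℝ × ℝ) := Set.Icc 0 1 ×ˢ Set.Icc (-l) l
  have hK : IsCompact K := isCompact_Icc.prod isCompact_Icc
  have hcont : ContinuousOn (fun p : ℝ × ℝ => H (1 + p.1 + p.2 * I)) K := by
    apply hH.comp
    · fun_prop
    · intro p hp
      simp only [Set.mem_ofPred_eq, add_re, one_re, ofReal_re, mul_re, I_re, mul_zero, ofReal_im, I_im, mul_one, sub_self, add_zero]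
      have := hp.1.1
      simpa using this
  obtain ⟨B, hB⟩ := hK.exists_bound_of_continuousOn hcont
  have hL : Tendsto (fun n => ∫ t : ℝ, (tri l t : ℂ) * Complex.exp (y * t * I) * H (1 + e n + t * I)) atTop
      (𝓝 (∫ t : ℝ, (tri l t : ℂ) * Complex.exp (y * t * I) * H (1 + t * I))) := by
    apply tendsto_integral_of_dominated_convergence (fun t => tri l t * B)
    · intro n
      have hc : Continuous (fun t : ℝ => H (1 + e n + t * I)) := by
        apply hH.comp_continuous (by fun_prop)
        intro t; simp [(hepos n).le]
      have := tri_continuous l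
      have hc2 : Continuous (fun t : ℝ => (tri l t : ℂ) * Complex.exp (y * t * I)) := by fun_prop
      exact (hc2.mul hc).aestronglyMeasurable
    · exact ((tri_continuous l).integrable_of_hasCompactSupport (tri_support hl)).mul_const B
    · intro n
      filter_upwards with t
      rw [norm_mul, norm_mul, Complex.norm_of_nonneg (tri_nonneg l _), Complex.norm_exp]
      have e1 : ((y:ℂ) * t * I).re = 0 := by simp
      rw [e1, Real.exp_zero, mul_one]
      by_cases ht : l ≤ |t|
      · rw [tri_zero hl ht]; simp
      · push Not at ht
        gcongr
        · exact tri_nonneg _ _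
        · exact hB (e n, t) ⟨⟨(hepos n).le, hele n⟩, (abs_le.1 ht.le)⟩
    · filter_upwards with t
      apply Tendsto.const_mul
      have hc : ContinuousWithinAt H {s | 1 ≤ s.re} (1 + t * I) := hH _ (by simp)
      apply hc.tendsto.comp
      apply tendsto_nhdsWithin_iff.2
      refine ⟨?_, ?_⟩
      · have : Tendsto (fun n => (1 : ℂ) + (e n : ℂ) + t * I) atTop (𝓝 (1 + ((0:ℝ) : ℂ) + t * I)) := by
          apply Tendsto.add_const
          apply Tendsto.const_add
          exact (Complex.continuous_ofReal.tendsto 0).comp he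
        simpa using this
      · filter_upwards with n
        simp [(hepos n).le]
  have hR : Tendsto (fun n => ∫ u in Set.Ioi (0:ℝ), ((b u * Real.exp (-e n * u) * ker l (y - u) : ℝ) : ℂ)) atTop
      (𝓝 (∫ u in Set.Ioi (0:ℝ), ((b u * ker l (y - u) : ℝ) : ℂ))) := by
    have hkm : Measurable (ker l) := ker_measurable l
    apply tendsto_integral_of_dominated_convergence (fun u => C * ker l (y - u))
    · intro n
      exact Measurable.aestronglyMeasurable (by fun_prop)
    · exact (((ker_integrable hl).comp_sub_left y).const_mul C).restrict
    · intro n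
      filter_upwards [ae_restrict_mem measurableSet_Ioi] with u hu
      rw [Complex.norm_real, norm_mul, norm_mul, Real.norm_of_nonneg (ker_nonneg hl _),
        Real.norm_of_nonneg (Real.exp_pos _).le]
      have hu' : (0:ℝ) < u := hu
      have h1 : Real.exp (-e n * u) ≤ 1 := by
        apply Real.exp_le_one_iff.2
        have := hepos n
        nlinarith
      have := ker_nonneg hl (y - u)
      gcongr
      calc ‖b u‖ * Real.exp (-e n * u) ≤ ‖b u‖ * 1 := by gcongr
        _ ≤ C := by rw [mul_one]; exact hC u hu
    · filter_upwards with u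
      apply (Complex.continuous_ofReal.tendsto _).comp
      apply Tendsto.mul_const
      have : Tendsto (fun n => b u * Real.exp (-e n * u)) atTop (𝓝 (b u * Real.exp (-0 * u))) := by
        apply Tendsto.const_mul
        apply (Real.continuous_exp.tendsto _).comp
        exact (he.neg).mul_const u
      simpa using this
  have := tendsto_nhds_unique (hL.congr (fun n => fub hb hC heq hl y (hepos n))) hR
  rw [this, ← integral_complex_ofReal]

lemma tauber_limit (hb : Measurable b) (hC : ∀ u > 0, |b u| ≤ C) (hH : ContinuousOn H {s | 1 ≤ s.re})
    (heq : ∀ s : ℂ, 1 < s.re → ∫ u in Set.Ioi (0:ℝ), (b u : ℂ) * Complex.exp (-(s - 1) * u) = H s)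
    {l : ℝ} (hl : 0 < l) :
    Tendsto (fun y : ℝ => ∫ u in Set.Ioi (0:ℝ), b u * ker l (y - u)) atTop (𝓝 0) := by
  have h1 := Real.tendsto_integral_exp_smul_cocompact (fun t : ℝ => (tri l t : ℂ) * H (1 + t * I))
  have h2 : Tendsto (fun y : ℝ => -(y / (2 * Real.pi))) atTop (cocompact ℝ) := by
    have : Tendsto (fun y : ℝ => -(y / (2 * Real.pi))) atTop atBot :=
      tendsto_neg_atTop_atBot.comp (tendsto_id.atTop_div_const (by positivity))
    exact this.mono_right atBot_le_cocompact
  have h3 := h1.comp h2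
  have h4 : Tendsto (fun y : ℝ => ((∫ u in Set.Ioi (0:ℝ), b u * ker l (y - u) : ℝ) : ℂ)) atTop (𝓝 0) := by
    refine h3.congr (fun y => ?_)
    rw [← limit_eq hb hC hH heq hl y]
    apply integral_congr_ae
    filter_upwards with t
    simp only [Circle.smul_def, Real.fourierChar_apply, smul_eq_mul]
    have hp : (Real.pi : ℂ) ≠ 0 := by exact_mod_cast Real.pi_ne_zero
    have e1 : ((2 * Real.pi * -(t * -(y / (2 * Real.pi))) : ℝ) : ℂ) * I = y * t * I := by
      push_cast
      field_simp
    rw [e1]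
    ring
  have h5 := (Complex.continuous_re.tendsto 0).comp h4
  simpa [Function.comp_def] using h5

end
end PNTL

namespace PNTL
open MeasureTheory Filter Topology Complex

lemma ker_int_eq {l : ℝ} (hl : 0 < l) : ∫ v, ker l v = ∫ v, ker 1 v := by
  simp_rw [ker_scale hl]
  rw [MeasureTheory.integral_const_mul, Measure.integral_comp_mul_left (ker 1) l]
  rw [abs_of_pos (by positivity), smul_eq_mul]
  field_simp

lemma ker_int_pos : 0 < ∫ v, ker 1 v := by
  rw [integral_pos_iff_support_of_nonneg (fun v => ker_nonneg one_pos v) (ker_integrable one_pos)]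
  refine lt_of_lt_of_le (b := volume (Set.Ioo (0:ℝ) 1)) (by simp) (measure_mono ?_)
  intro v hv
  have h1 : Real.cos v < 1 := by
    rw [← Real.cos_zero]
    apply Real.cos_lt_cos_of_nonneg_of_le_pi le_rfl _ hv.1
    linarith [hv.2, Real.pi_gt_three]
  have : 0 < ker 1 v := by
    unfold ker
    rw [one_mul]
    apply div_pos
    · linarith
    · have := hv.1
      positivity
  exact this.ne'

lemma tauber {B : ℝ → ℝ} {C : ℝ} (hB : Measurable B) (hC : ∀ u > 0, |B u - 1| ≤ C)
    (hmono : ∀ u v, 0 < u → u ≤ v → B u ≤ Real.exp (v - u) * B v)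
    (hB0 : ∀ u, 0 ≤ B u)
    (hlim : ∀ l : ℝ, 0 < l → Tendsto (fun y : ℝ => ∫ u in Set.Ioi (0:ℝ), (B u - 1) * ker l (y - u)) atTop (𝓝 0))
    {δ : ℝ} (hδ : 0 < δ) (hδ1 : δ < 1) : ∀ᶠ y in atTop, 1 - δ ≤ B y := by
  have hC0 : 0 ≤ C := (abs_nonneg _).trans (hC 1 one_pos)
  set c := ∫ v, ker 1 v with hc
  have hcpos : 0 < c := ker_int_pos
  obtain ⟨h, hh, hhe⟩ : ∃ h : ℝ, 0 < h ∧ Real.exp h * (1 - δ) ≤ 1 - δ / 2 := by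
    refine ⟨Real.log ((1 - δ / 2) / (1 - δ)), ?_, ?_⟩
    · apply Real.log_pos
      rw [one_lt_div (by linarith)]
      linarith
    · rw [Real.exp_log (div_pos (by linarith) (by linarith))]
      have : 1 - δ ≠ 0 := by linarith
      field_simp
      exact le_refl _
  set A : ℝ := (C + 1) * (4 * (1 + 4 / h ^ 2)) * Real.pi with hA
  have hApos : 0 < A := by have := Real.pi_pos; positivity
  set l : ℝ := 4 * A / (δ * c) with hl
  have hlpos : 0 < l := by positivity
  have hev := (hlim l hlpos).eventually (lt_mem_nhds (show -(δ * c / 4) < 0 by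
    have : 0 < δ * c := by positivity
    linarith))
  have hev2 : ∀ᶠ y in atTop, -(δ * c / 4) < ∫ u in Set.Ioi (0:ℝ), (B u - 1) * ker l ((y - h / 2) - u) :=
    (tendsto_atTop_add_const_right atTop (-(h/2)) tendsto_id).eventually hev
  filter_upwards [hev2, eventually_gt_atTop h] with y0 hy hy0
  by_contra hcon
  push Not at hcon
  set y := y0 - h / 2 with hydef
  -- comparison function
  let g : ℝ → ℝ := fun v => -(δ / 2) * ker l v + (C + 1) * (4 * (1 + 4 / h ^ 2) / l) * (1 + v ^ 2)⁻¹
  have hgi : Integrable g := ((ker_integrable hlpos).const_mul _).add (integrable_inv_one_add_sq.const_mul _)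
  have htail : ∀ v : ℝ, h / 2 < |v| → ker l v ≤ (4 * (1 + 4 / h ^ 2) / l) * (1 + v ^ 2)⁻¹ := by
    intro v hv
    have hv2 : (h / 2) ^ 2 ≤ v ^ 2 := by
      rw [← sq_abs v]; gcongr
    have hvpos : 0 < v ^ 2 := lt_of_lt_of_le (by positivity) hv2
    refine (ker_le hlpos v).trans ?_
    rw [← div_eq_mul_inv, div_div, div_le_div_iff₀ (by positivity) (by positivity)]
    have : 1 ≤ v ^ 2 * (4 / h ^ 2) := by
      rw [mul_div_assoc', le_div_iff₀ (by positivity)]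
      nlinarith
    have : 1 + v ^ 2 ≤ (1 + 4 / h ^ 2) * v ^ 2 := by linarith
    nlinarith
  have hnn : ∀ v : ℝ, 0 ≤ (4 * (1 + 4 / h ^ 2) / l) * (1 + v ^ 2)⁻¹ := fun v => by positivity
  have hpt : ∀ u ∈ Set.Ioi (0:ℝ), (B u - 1) * ker l (y - u) ≤ g (y - u) := by
    intro u hu
    have hk := ker_nonneg hlpos (y - u)
    by_cases hv : h / 2 < |y - u|
    · have h1 := htail _ hv
      have h2 : B u - 1 ≤ C := (abs_le.1 (hC u hu)).2
      have h3 : (C + 1) * ker l (y - u) ≤ (C + 1) * ((4 * (1 + 4 / h ^ 2) / l) * (1 + (y - u) ^ 2)⁻¹) := by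
        gcongr
      simp only [g]
      nlinarith
    · push Not at hv
      have hv' := abs_le.1 hv
      have hu1 : u ≤ y0 := by linarith [hv'.1]
      have hu2 : y0 - u ≤ h := by linarith [hv'.2]
      have h1 := hmono u y0 hu hu1
      have h2 : Real.exp (y0 - u) * B y0 ≤ Real.exp h * (1 - δ) := by
        have := hB0 y0
        gcongr
      have h4 := hnn (y - u)
      simp only [g]
      have h5 : B u - 1 ≤ -(δ / 2) := by linarith
      nlinarith
  have hneg : ∀ u, u ∉ Set.Ioi (0:ℝ) → 0 ≤ g (y - u) := by
    intro u hu
    simp only [Set.mem_Ioi, not_lt] at hu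
    have hv : h / 2 < |y - u| := by
      rw [abs_of_pos (by linarith)]; linarith
    have h1 := htail _ hv
    have hk := ker_nonneg hlpos (y - u)
    have := hnn (y - u)
    simp only [g]
    nlinarith
  have hgi' : Integrable (fun u => g (y - u)) := hgi.comp_sub_left y
  have I1 : ∫ u in Set.Ioi (0:ℝ), (B u - 1) * ker l (y - u) ≤ ∫ u in Set.Ioi (0:ℝ), g (y - u) := by
    apply setIntegral_mono_on _ hgi'.integrableOn measurableSet_Ioi hpt
    have hkm := ker_measurable l
    refine (((ker_integrable hlpos).comp_sub_left y).const_mul C).integrableOn.mono' 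
      (Measurable.aestronglyMeasurable (by fun_prop)) ?_
    filter_upwards [ae_restrict_mem measurableSet_Ioi] with u hu
    rw [norm_mul, Real.norm_of_nonneg (ker_nonneg hlpos _)]
    have := ker_nonneg hlpos (y - u)
    gcongr
    exact hC u hu
  have I2 : ∫ u in Set.Ioi (0:ℝ), g (y - u) ≤ ∫ u, g (y - u) := by
    rw [← integral_indicator measurableSet_Ioi]
    apply integral_mono (hgi'.indicator measurableSet_Ioi) hgi'
    intro u
    by_cases hu : u ∈ Set.Ioi (0:ℝ)
    · simp [Set.indicator_of_mem hu]
    · rw [Set.indicator_of_notMem hu]; exact hneg u hu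
  have I3 : ∫ u, g (y - u) = -(δ / 2) * c + (C + 1) * (4 * (1 + 4 / h ^ 2) / l) * Real.pi := by
    rw [integral_sub_left_eq_self g volume y]
    simp only [g]
    rw [integral_add ((ker_integrable hlpos).const_mul _) (integrable_inv_one_add_sq.const_mul _),
      MeasureTheory.integral_const_mul, MeasureTheory.integral_const_mul, ker_int_eq hlpos, integral_univ_inv_one_add_sq]
  have I4 : (C + 1) * (4 * (1 + 4 / h ^ 2) / l) * Real.pi = δ * c / 4 := by
    have : (C + 1) * (4 * (1 + 4 / h ^ 2) / l) * Real.pi = A / l := by rw [hA]; ring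
    rw [this, hl]
    field_simp
  linarith

end PNTL

namespace PNTL
open MeasureTheory Filter Topology Complex

open ArithmeticFunction Chebyshev

noncomputable def bb (u : ℝ) : ℝ := psi (Real.exp u) * Real.exp (-u)

noncomputable def GG : ℂ → ℂ := vonMangoldt.LFunctionResidueClassAux (1 : ZMod 1)

lemma GG_eq {s : ℂ} (hs : 1 < s.re) : GG s = LSeries (fun n => ((vonMangoldt n : ℝ) : ℂ)) s - 1 / (s - 1) := by
  have := vonMangoldt.eqOn_LFunctionResidueClassAux (a := (1 : ZMod 1)) isUnit_one hs
  unfold GG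
  rw [this]
  simp only [Nat.totient_one, Nat.cast_one, inv_one]
  congr 2
  ext n
  congr 1
  simp only [vonMangoldt.residueClass]
  rw [Set.indicator_of_mem]
  exact Subsingleton.elim _ _

lemma psi_bound (x : ℝ) (hx : 0 ≤ x) : psi x ≤ (Real.log 4 + 4) * x := psi_le_const_mul_self hx

lemma L_eq {s : ℂ} (hs : 1 < s.re) : LSeries (fun n => ((vonMangoldt n : ℝ) : ℂ)) s =
    s * ∫ t in Set.Ioi (1 : ℝ), (psi t : ℂ) * t ^ (-(s + 1)) := by
  rw [LSeries_eq_mul_integral_of_nonneg (fun n => vonMangoldt n) zero_le_one (by exact_mod_cast hs) _ (fun n => vonMangoldt_nonneg)]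
  · congr 2
    ext t
    congr 1
    unfold Chebyshev.psi
    push_cast
    rfl
  · apply Asymptotics.IsBigO.of_bound (Real.log 4 + 4)
    filter_upwards with n
    have := psi_bound n (Nat.cast_nonneg n)
    unfold Chebyshev.psi at this
    rw [Nat.floor_natCast] at this
    simp only [Real.rpow_one]
    rw [Real.norm_of_nonneg (Finset.sum_nonneg fun i _ => vonMangoldt_nonneg), Real.norm_of_nonneg (by positivity)]
    exact this

lemma bb_meas : Measurable bb := by
  unfold bb
  have : Measurable psi := psi_mono.measurable
  exact (this.comp Real.measurable_exp).mul (by fun_prop)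

lemma psi_nonneg' (x : ℝ) : 0 ≤ psi x := Chebyshev.psi_nonneg x

lemma bb_nonneg (u : ℝ) : 0 ≤ bb u := mul_nonneg (psi_nonneg' _) (Real.exp_pos _).le

lemma bb_le (u : ℝ) : bb u ≤ Real.log 4 + 4 := by
  unfold bb
  have := psi_bound (Real.exp u) (Real.exp_pos u).le
  calc _ ≤ (Real.log 4 + 4) * Real.exp u * Real.exp (-u) := by gcongr
    _ = _ := by rw [mul_assoc, ← Real.exp_add]; simp

lemma bb_mono (u v : ℝ) (h : u ≤ v) : bb u ≤ Real.exp (v - u) * bb v := by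
  unfold bb
  have h1 : psi (Real.exp u) ≤ psi (Real.exp v) := psi_mono (Real.exp_le_exp.2 h)
  calc _ ≤ psi (Real.exp v) * Real.exp (-u) := by gcongr
    _ = psi (Real.exp v) * (Real.exp (v - u) * Real.exp (-v)) := by rw [← Real.exp_add]; ring_nf
    _ = _ := by ring

lemma exp_intble {s : ℂ} (hs : 1 < s.re) : IntegrableOn (fun u : ℝ => cexp (-(s-1)*u)) (Set.Ioi 0) := by
  have := integrableOn_exp_mul_complex_Ioi (a := -(s-1)) (by simp; linarith) 0
  exact this

lemma bb_int {s : ℂ} (hs : 1 < s.re) : ∫ u in Set.Ioi (0:ℝ), (bb u:ℂ) * cexp (-(s-1)*u) = LSeries (fun n => ((vonMangoldt n : ℝ) : ℂ)) s / s := by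
  have hs0 : s ≠ 0 := by rintro rfl; simp at hs; linarith
  rw [L_eq hs, mul_div_cancel_left₀ _ hs0]
  have := MeasureTheory.integral_comp_exp_Ioi (fun t : ℝ => (psi t : ℂ) * (t:ℂ) ^ (-(s + 1))) 0
  rw [Real.exp_zero] at this
  rw [← this]
  apply setIntegral_congr_fun measurableSet_Ioi
  intro u hu
  simp only [bb]
  rw [Complex.real_smul, Complex.ofReal_exp, ← Complex.exp_log (Complex.exp_ne_zero (u:ℂ)), ← Complex.ofReal_exp, ← Complex.ofReal_log (Real.exp_pos u).le, Real.log_exp]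
  rw [Complex.cpow_def_of_ne_zero (by simp)]
  rw [← Complex.ofReal_exp,← Complex.ofReal_log (Real.exp_pos u).le, Real.log_exp]
  push_cast
  have : cexp u * (psi (Real.exp u) * cexp (u * -(s+1))) = psi (Real.exp u) * (cexp u * cexp (u * -(s+1))) := by ring
  rw [this, mul_assoc, ← Complex.exp_add, ← Complex.exp_add]
  congr 2
  ring

lemma bb_int' {s : ℂ} (hs : 1 < s.re) : ∫ u in Set.Ioi (0:ℝ), ((bb u - 1 : ℝ):ℂ) * cexp (-(s-1)*u) = (GG s - 1) / s := by
  have hs0 : s ≠ 0 := by rintro rfl; simp at hs; linarith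
  have hs1 : s - 1 ≠ 0 := by
    intro h
    have : s = 1 := by linear_combination h
    rw [this] at hs; simp at hs
  have e : ∀ u : ℝ, ((bb u - 1 : ℝ):ℂ) * cexp (-(s-1)*u) = (bb u:ℂ) * cexp (-(s-1)*u) - cexp (-(s-1)*u) := by
    intro u; push_cast; ring
  simp_rw [e]
  rw [integral_sub _ (exp_intble hs), bb_int hs, integral_exp_mul_complex_Ioi (a := -(s-1)) (by simp; linarith), GG_eq hs]
  · have hs2 : -(s - 1) ≠ 0 := neg_ne_zero.2 hs1
    have e2 : cexp (-(s - 1) * ((0:ℝ):ℂ)) = 1 := by simp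
    rw [e2, div_neg]
    field_simp
    ring
  · refine Integrable.bdd_mul (c := Real.log 4 + 4) (exp_intble hs) (Measurable.aestronglyMeasurable ?_) ?_
    · have := bb_meas
      fun_prop
    · filter_upwards with u
      rw [Complex.norm_real, Real.norm_of_nonneg (bb_nonneg u)]
      exact bb_le u

lemma H_cont : ContinuousOn (fun s => (GG s - 1) / s) {s : ℂ | 1 ≤ s.re} := by
  apply ContinuousOn.div
  · exact (vonMangoldt.continuousOn_LFunctionResidueClassAux (1 : ZMod 1)).sub continuousOn_const
  · exact continuousOn_id
  · rintro s hs rfl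
    simp at hs
    linarith

/-- Lower half of the prime number theorem. -/
theorem pnt_psi {δ : ℝ} (hδ : 0 < δ) (hδ1 : δ < 1) : ∀ᶠ x : ℝ in atTop, (1 - δ) * x ≤ psi x := by
  have hC : ∀ u > 0, |bb u - 1| ≤ Real.log 4 + 5 := by
    intro u _
    have h1 := bb_nonneg u
    have h2 := bb_le u
    have : 0 ≤ Real.log 4 := Real.log_nonneg (by norm_num)
    rw [abs_le]; constructor <;> linarith
  have h := tauber bb_meas hC (fun u v _ h => bb_mono u v h) bb_nonneg
    (fun l hl => tauber_limit (b := fun u => bb u - 1) (by have := bb_meas; fun_prop) hC H_cont (fun s hs => bb_int' hs) hl) hδ hδ1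
  have h2 := Real.tendsto_log_atTop.eventually h
  filter_upwards [h2, eventually_gt_atTop 0] with x hx hx0
  unfold bb at hx
  rw [Real.exp_neg, Real.exp_log hx0] at hx
  rwa [← div_eq_mul_inv, le_div_iff₀ hx0] at hx

theorem pnt_theta {δ : ℝ} (hδ : 0 < δ) (hδ1 : δ < 1) : ∀ᶠ x : ℝ in atTop, (1 - δ) * x ≤ theta x := by
  have h1 : (fun x : ℝ => Real.log x) =o[atTop] fun x => x ^ (1/2 : ℝ) := isLittleO_log_rpow_atTop (by norm_num)
  filter_upwards [pnt_psi (half_pos hδ) (by linarith), eventually_ge_atTop 1, h1.bound (show 0 < δ / 4 by positivity)] with x hx hx1 hlog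
  have h3 := psi_sub_theta_le hx1
  rw [← Real.sqrt_eq_rpow, Real.norm_of_nonneg (Real.log_nonneg hx1), Real.norm_of_nonneg (Real.sqrt_nonneg x)] at hlog
  have h4 : 2 * √x * Real.log x ≤ 2 * √x * (δ / 4 * √x) := by gcongr
  have h5 : √x * √x = x := Real.mul_self_sqrt (by linarith)
  nlinarith

end PNTL

namespace MertL
open ArithmeticFunction Finset

lemma sum_log_eq (N : ℕ) : ∑ n ∈ Ioc 0 N, Real.log n = ∑ n ∈ Ioc 0 N, vonMangoldt n * ((N / n : ℕ) : ℝ) := by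
  rw [← sum_Ioc_mul_zeta_eq_sum (R := ℝ) vonMangoldt N, vonMangoldt_mul_zeta]
  rfl

lemma sum_log_le (N : ℕ) : ∑ n ∈ Ioc 0 N, Real.log n ≤ N * Real.log N := by
  have : ∑ n ∈ Ioc 0 N, Real.log n ≤ ∑ n ∈ Ioc 0 N, Real.log N := by
    apply sum_le_sum
    intro n hn
    rw [mem_Ioc] at hn
    apply Real.log_le_log
    · exact_mod_cast hn.1
    · exact_mod_cast hn.2
  simpa using this

lemma le_sum_log (N : ℕ) : N * Real.log N - N ≤ ∑ n ∈ Ioc 0 N, Real.log n := by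
  have h1 : ∑ n ∈ Ioc 0 N, Real.log n = Real.log (N.factorial) := by
    rw [show Ioc 0 N = Ico 1 (N+1) from rfl, ← prod_Ico_id_eq_factorial, Nat.cast_prod, Real.log_prod]
    intro i hi
    rw [mem_Ico] at hi
    have := hi.1
    positivity
  rw [h1]
  rcases Nat.eq_zero_or_pos N with rfl | hN
  · simp
  have h2 := Real.pow_div_factorial_le_exp (N:ℝ) (by positivity) N
  have hN' : (0:ℝ) < N := by exact_mod_cast hN
  have h3 := Real.log_le_log (by positivity) h2
  rw [Real.log_exp, Real.log_div (by positivity) (by positivity), Real.log_pow] at h3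
  linarith

lemma mertens_lower (N : ℕ) (hN : 0 < N) : Real.log N - 1 ≤ ∑ n ∈ Ioc 0 N, vonMangoldt n / n := by
  have h := le_sum_log N
  rw [sum_log_eq] at h
  have hN' : (0:ℝ) < N := by exact_mod_cast hN
  have h2 : ∑ n ∈ Ioc 0 N, vonMangoldt n * ((N / n : ℕ) : ℝ) ≤ N * ∑ n ∈ Ioc 0 N, vonMangoldt n / n := by
    rw [mul_sum]
    apply sum_le_sum
    intro n _
    have := Nat.cast_div_le (α := ℝ) (m := N) (n := n)
    calc _ ≤ vonMangoldt n * (N / n : ℝ) := by gcongr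
      _ = _ := by ring
  have : N * (Real.log N - 1) ≤ N * ∑ n ∈ Ioc 0 N, vonMangoldt n / n := by linarith
  exact le_of_mul_le_mul_left this hN'

lemma mertens_upper (N : ℕ) (hN : 0 < N) : ∑ n ∈ Ioc 0 N, vonMangoldt n / n ≤ Real.log N + 6 := by
  have h := sum_log_le N
  rw [sum_log_eq] at h
  have hN' : (0:ℝ) < N := by exact_mod_cast hN
  have h2 : N * ∑ n ∈ Ioc 0 N, vonMangoldt n / n ≤ ∑ n ∈ Ioc 0 N, vonMangoldt n * ((N / n : ℕ) : ℝ) + Chebyshev.psi N := by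
    unfold Chebyshev.psi
    rw [Nat.floor_natCast, mul_sum, ← sum_add_distrib]
    apply sum_le_sum
    intro n hn
    rw [mem_Ioc] at hn
    have hn0 : (0:ℝ) < n := by exact_mod_cast hn.1
    have : (N / n : ℝ) ≤ ((N / n : ℕ) : ℝ) + 1 := by
      rw [div_le_iff₀ hn0]
      exact_mod_cast (Nat.lt_div_mul_add hn.1).le.trans (by rw [add_mul, one_mul])
    calc _ = vonMangoldt n * (N / n : ℝ) := by ring
      _ ≤ vonMangoldt n * (((N / n : ℕ) : ℝ) + 1) := by gcongr
      _ = _ := by ring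
  have h3 : Chebyshev.psi N ≤ _ := Chebyshev.psi_le_const_mul_self hN'.le
  have h4 : Real.log 4 ≤ 2 := by
    have : Real.log 4 = 2 * Real.log 2 := by
      rw [show (4:ℝ) = 2 ^ 2 by norm_num, Real.log_pow]; norm_num
    rw [this]; linarith [Real.log_two_lt_d9]
  have : N * ∑ n ∈ Ioc 0 N, vonMangoldt n / n ≤ N * (Real.log N + 6) := by nlinarith
  exact le_of_mul_le_mul_left this hN'

/-- Mertens on an interval. -/
lemma mertens_Ioc {y z : ℝ} (hy : 1 ≤ y) (hyz : y ≤ z) :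
    ∑ n ∈ Ioc ⌊y⌋₊ ⌊z⌋₊, vonMangoldt n / n ≤ Real.log z - Real.log y + 8 := by
  have hy0 : 0 < ⌊y⌋₊ := Nat.floor_pos.2 hy
  have hle : ⌊y⌋₊ ≤ ⌊z⌋₊ := Nat.floor_mono hyz
  have h1 := mertens_lower _ hy0
  have h2 := mertens_upper ⌊z⌋₊ (hy0.trans_le hle)
  have h3 : ∑ n ∈ Ioc 0 ⌊z⌋₊, vonMangoldt n / n = ∑ n ∈ Ioc 0 ⌊y⌋₊, vonMangoldt n / n + ∑ n ∈ Ioc ⌊y⌋₊ ⌊z⌋₊, vonMangoldt n / n :=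
    (sum_Ioc_consecutive _ (Nat.zero_le _) hle).symm
  have h4 : Real.log ⌊z⌋₊ ≤ Real.log z := by
    apply Real.log_le_log (by exact_mod_cast hy0.trans_le hle)
    exact Nat.floor_le (by linarith)
  have h5 : Real.log y - 1 ≤ Real.log ⌊y⌋₊ := by
    have : Real.log y ≤ Real.log (2 * ⌊y⌋₊) := by
      apply Real.log_le_log (by linarith)
      have := Nat.lt_floor_add_one y
      have h6 : (1:ℝ) ≤ ⌊y⌋₊ := by exact_mod_cast hy0
      linarith
    have h7 : (0:ℝ) < ⌊y⌋₊ := by exact_mod_cast hy0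
    rw [Real.log_mul (by norm_num) h7.ne'] at this
    linarith [Real.log_two_lt_d9]
  linarith
end MertL

namespace SelL
open Finset ArithmeticFunction

noncomputable def DD (k z : ℕ) : Finset ℕ := (Icc 1 z).filter (fun d => Squarefree d ∧ d.Coprime k)

noncomputable def SS (k z : ℕ) : ℝ := ∑ d ∈ DD k z, 1 / (Nat.totient d : ℝ)

noncomputable def lam (k z d : ℕ) : ℝ :=
  (moebius d : ℝ) * (d / SS k z) * ∑ e ∈ DD k z with d ∣ e, 1 / (Nat.totient e : ℝ)

lemma mem_DD {k z d : ℕ} : d ∈ DD k z ↔ (1 ≤ d ∧ d ≤ z) ∧ Squarefree d ∧ d.Coprime k := by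
  simp [DD]

lemma DD_dvd {k z d e : ℕ} (he : e ∈ DD k z) (h : d ∣ e) : d ∈ DD k z := by
  rw [mem_DD] at *
  have hd : 0 < d := Nat.pos_of_dvd_of_pos h he.1.1
  exact ⟨⟨hd, (Nat.le_of_dvd he.1.1 h).trans he.1.2⟩, he.2.1.squarefree_of_dvd h, he.2.2.coprime_dvd_left h⟩

lemma one_mem {k z : ℕ} (hz : 1 ≤ z) : 1 ∈ DD k z := by
  rw [mem_DD]; simp [hz]

lemma tot_pos {k z d : ℕ} (h : d ∈ DD k z) : (0:ℝ) < Nat.totient d := by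
  rw [mem_DD] at h
  exact_mod_cast Nat.totient_pos.2 h.1.1

lemma SS_pos {k z : ℕ} (hz : 1 ≤ z) : 0 < SS k z := by
  unfold SS
  apply sum_pos
  · intro d hd
    have := tot_pos hd
    positivity
  · exact ⟨1, one_mem hz⟩

lemma lam_one {k z : ℕ} (hz : 1 ≤ z) : lam k z 1 = 1 := by
  unfold lam
  have := SS_pos (k := k) hz
  simp only [one_dvd, filter_true]
  have h : ∑ e ∈ DD k z, 1 / (Nat.totient e : ℝ) = SS k z := rfl
  rw [h]
  simp
  field_simp

lemma mu_sum {k z e f : ℕ} (he : e ∈ DD k z) (hf : f ∈ DD k z) :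
    ∑ d ∈ DD k z with e ∣ d ∧ d ∣ f, (moebius d : ℝ) = if e = f then (moebius e : ℝ) else 0 := by
  by_cases hef : e ∣ f
  · obtain ⟨g, rfl⟩ := hef
    have hf' := mem_DD.1 hf
    have he0 : 0 < e := (mem_DD.1 he).1.1
    have hg0 : 0 < g := Nat.pos_of_ne_zero (by rintro rfl; simp at hf')
    have hset : (DD k z).filter (fun d => e ∣ d ∧ d ∣ e * g) = g.divisors.image (fun x => e * x) := by
      ext d
      simp only [mem_filter, mem_image, Nat.mem_divisors]
      constructor
      · rintro ⟨_, ⟨x, rfl⟩, h2⟩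
        exact ⟨x, ⟨Nat.dvd_of_mul_dvd_mul_left he0 h2, hg0.ne'⟩, rfl⟩
      · rintro ⟨x, ⟨h1, _⟩, rfl⟩
        have : e * x ∣ e * g := Nat.mul_dvd_mul_left e h1
        exact ⟨DD_dvd hf this, dvd_mul_right _ _, this⟩
    rw [hset, sum_image (fun a _ b _ h => Nat.eq_of_mul_eq_mul_left he0 h)]
    have hcop : Nat.Coprime e g := Nat.coprime_of_squarefree_mul hf'.2.1
    have h1 : ∀ x ∈ g.divisors, (moebius (e * x) : ℝ) = moebius e * moebius x := by
      intro x hx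
      rw [isMultiplicative_moebius.map_mul_of_coprime (hcop.coprime_dvd_right (Nat.dvd_of_mem_divisors hx))]
      push_cast; rfl
    rw [sum_congr rfl h1, ← mul_sum]
    have h2 : ∑ x ∈ g.divisors, (moebius x : ℝ) = if g = 1 then 1 else 0 := by
      have := congrArg (fun f : ArithmeticFunction ℤ => f g) moebius_mul_coe_zeta
      simp only [coe_mul_zeta_apply, ArithmeticFunction.one_apply] at this
      have h3 := congrArg (fun t : ℤ => (t : ℝ)) this
      push_cast at h3
      exact h3
    rw [h2]
    by_cases hg : g = 1
    · simp [hg]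
    · have : e ≠ e * g := by
        intro h
        apply hg
        have : e * 1 = e * g := by simpa using h
        exact (Nat.eq_of_mul_eq_mul_left he0 this).symm
      simp [hg, this]
  · have hne : e ≠ f := by rintro rfl; exact hef dvd_rfl
    rw [if_neg hne]
    apply sum_eq_zero
    intro d hd
    simp only [mem_filter] at hd
    exact absurd (hd.2.1.trans hd.2.2) hef

lemma y_eq {k z e : ℕ} (hz : 1 ≤ z) (he : e ∈ DD k z) :
    ∑ d ∈ DD k z with e ∣ d, lam k z d / d = moebius e / (SS k z * Nat.totient e) := by
  have hS := SS_pos (k := k) hz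
  have h1 : ∀ d ∈ (DD k z).filter (fun d => e ∣ d), lam k z d / d =
      ∑ f ∈ DD k z, (if d ∣ f then (moebius d : ℝ) / SS k z * (1 / (Nat.totient f : ℝ)) else 0) := by
    intro d hd
    have hd0 : (0:ℝ) < d := by
      have := (mem_DD.1 (mem_filter.1 hd).1).1.1
      exact_mod_cast this
    unfold lam
    rw [← sum_filter, ← mul_sum]
    field_simp
  rw [sum_congr rfl h1, sum_comm]
  have h2 : ∀ f ∈ DD k z, ∑ d ∈ DD k z with e ∣ d, (if d ∣ f then (moebius d : ℝ) / SS k z * (1 / (Nat.totient f : ℝ)) else 0)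
      = if e = f then moebius e / (SS k z * Nat.totient e) else 0 := by
    intro f hf
    rw [← sum_filter, filter_filter, ← sum_mul, ← sum_div, mu_sum he hf]
    split_ifs with h
    · subst h
      field_simp
    · simp
  rw [sum_congr rfl h2, sum_ite_eq]
  simp [he]

lemma main_term {k z : ℕ} (hz : 1 ≤ z) :
    ∑ d₁ ∈ DD k z, ∑ d₂ ∈ DD k z, lam k z d₁ * lam k z d₂ / (Nat.lcm d₁ d₂ : ℝ) = 1 / SS k z := by
  have hS := SS_pos (k := k) hz
  have h1 : ∀ d₁ ∈ DD k z, ∀ d₂ ∈ DD k z, lam k z d₁ * lam k z d₂ / (Nat.lcm d₁ d₂ : ℝ) =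
      ∑ e ∈ DD k z, if e ∣ d₁ ∧ e ∣ d₂ then (Nat.totient e : ℝ) * (lam k z d₁ / d₁) * (lam k z d₂ / d₂) else 0 := by
    intro d₁ h₁ d₂ h₂
    have p₁ : (0:ℝ) < d₁ := by exact_mod_cast (mem_DD.1 h₁).1.1
    have p₂ : (0:ℝ) < d₂ := by exact_mod_cast (mem_DD.1 h₂).1.1
    rw [← sum_filter, ← sum_mul, ← sum_mul]
    have hset : (DD k z).filter (fun e => e ∣ d₁ ∧ e ∣ d₂) = (Nat.gcd d₁ d₂).divisors := by
      ext e
      simp only [mem_filter, Nat.mem_divisors, Nat.dvd_gcd_iff]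
      constructor
      · rintro ⟨_, h⟩
        exact ⟨h, (Nat.gcd_pos_of_pos_left _ (mem_DD.1 h₁).1.1).ne'⟩
      · rintro ⟨h, _⟩
        exact ⟨DD_dvd h₁ h.1, h⟩
    rw [hset]
    have : ∑ i ∈ (d₁.gcd d₂).divisors, (Nat.totient i : ℝ) = (d₁.gcd d₂ : ℝ) := by
      exact_mod_cast Nat.sum_totient (d₁.gcd d₂)
    rw [this]
    have hgl : (d₁.gcd d₂ : ℝ) * (d₁.lcm d₂ : ℝ) = d₁ * d₂ := by exact_mod_cast Nat.gcd_mul_lcm d₁ d₂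
    have hl : (0:ℝ) < d₁.lcm d₂ := by
      exact_mod_cast Nat.lcm_pos (mem_DD.1 h₁).1.1 (mem_DD.1 h₂).1.1
    field_simp
    linear_combination (-1) * hgl * lam k z d₁ * lam k z d₂
  rw [sum_congr rfl fun d₁ h₁ => sum_congr rfl fun d₂ h₂ => h1 d₁ h₁ d₂ h₂]
  have h2 : ∀ d₁ ∈ DD k z, ∑ d₂ ∈ DD k z, ∑ e ∈ DD k z, (if e ∣ d₁ ∧ e ∣ d₂ then (Nat.totient e : ℝ) * (lam k z d₁ / d₁) * (lam k z d₂ / d₂) else 0)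
      = ∑ e ∈ DD k z, ∑ d₂ ∈ DD k z, (if e ∣ d₁ ∧ e ∣ d₂ then (Nat.totient e : ℝ) * (lam k z d₁ / d₁) * (lam k z d₂ / d₂) else 0) :=
    fun _ _ => sum_comm
  rw [sum_congr rfl h2, sum_comm]
  have h3 : ∀ e ∈ DD k z, ∑ d₁ ∈ DD k z, ∑ d₂ ∈ DD k z, (if e ∣ d₁ ∧ e ∣ d₂ then (Nat.totient e : ℝ) * (lam k z d₁ / d₁) * (lam k z d₂ / d₂) else 0)
      = (1 / SS k z) ^ 2 * (1 / Nat.totient e) := by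
    intro e he
    have h4 : ∑ d₁ ∈ DD k z, ∑ d₂ ∈ DD k z, (if e ∣ d₁ ∧ e ∣ d₂ then (Nat.totient e : ℝ) * (lam k z d₁ / d₁) * (lam k z d₂ / d₂) else 0)
       = (Nat.totient e : ℝ) * (∑ d ∈ DD k z with e ∣ d, lam k z d / d) * (∑ d ∈ DD k z with e ∣ d, lam k z d / d) := by
      rw [mul_assoc, sum_mul_sum, mul_sum, sum_filter]
      apply sum_congr rfl
      intro d₁ _
      by_cases hd : e ∣ d₁
      · simp only [hd, true_and, if_true]
        rw [← sum_filter, mul_sum]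
        apply sum_congr rfl
        intros; ring
      · simp [hd]
    rw [h4, y_eq hz he]
    have hmu : (moebius e : ℝ) * moebius e = 1 := by
      have := moebius_sq_eq_one_of_squarefree (mem_DD.1 he).2.1
      rw [sq] at this
      exact_mod_cast this
    have := tot_pos he
    field_simp
    linear_combination hmu
  rw [sum_congr rfl h3, ← mul_sum]
  have h : ∑ e ∈ DD k z, 1 / (Nat.totient e : ℝ) = SS k z := rfl
  rw [h]
  field_simp

lemma lam_le {k z d : ℕ} (hz : 1 ≤ z) (hd : d ∈ DD k z) : |lam k z d| ≤ 1 := by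
  have hS := SS_pos (k := k) hz
  have hd0 : 0 < d := (mem_DD.1 hd).1.1
  have hnn : 0 ≤ ∑ e ∈ DD k z with d ∣ e, 1 / (Nat.totient e : ℝ) := sum_nonneg fun _ _ => by positivity
  have key : (d:ℝ) * ∑ e ∈ DD k z with d ∣ e, 1 / (Nat.totient e : ℝ) ≤ SS k z := by
    have hfac : ∀ e ∈ DD k z, d ∣ e → ∀ l ∈ d.divisors, (Nat.totient (d / l) : ℝ) / Nat.totient e = 1 / Nat.totient (l * (e / d)) := by
      rintro e he ⟨m, rfl⟩ l hl
      obtain ⟨r, hr⟩ := Nat.dvd_of_mem_divisors hl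
      have hsq := (mem_DD.1 he).2.1
      have hl0 : 0 < l := Nat.pos_of_mem_divisors hl
      have hr0 : 0 < r := Nat.pos_of_ne_zero (by rintro rfl; simp at hr; omega)
      have hm0 : 0 < m := Nat.pos_of_ne_zero (by rintro rfl; simp at hsq)
      rw [Nat.mul_div_cancel_left _ hd0]
      have e1 : d / l = r := by rw [hr, Nat.mul_div_cancel_left _ hl0]
      have c1 : Nat.Coprime d m := Nat.coprime_of_squarefree_mul hsq
      have c2 : Nat.Coprime l r := Nat.coprime_of_squarefree_mul (by rw [← hr]; exact (mem_DD.1 hd).2.1)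
      have c3 : Nat.Coprime l m := c1.coprime_dvd_left (Nat.dvd_of_mem_divisors hl)
      rw [e1, Nat.totient_mul c1, Nat.totient_mul c3, hr, Nat.totient_mul c2]
      have := Nat.totient_pos.2 hl0
      have := Nat.totient_pos.2 hr0
      have := Nat.totient_pos.2 hm0
      push_cast
      field_simp
    have e1 : (d:ℝ) = ∑ l ∈ d.divisors, (Nat.totient (d / l) : ℝ) := by
      have := Nat.sum_div_divisors d Nat.totient
      rw [Nat.sum_totient] at this
      exact_mod_cast this.symm
    rw [e1, sum_mul_sum, sum_comm]
    have e2 : ∑ e ∈ DD k z with d ∣ e, ∑ l ∈ d.divisors, (Nat.totient (d / l) : ℝ) * (1 / Nat.totient e) =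
        ∑ x ∈ ((DD k z).filter (fun e => d ∣ e)) ×ˢ d.divisors, 1 / (Nat.totient (x.2 * (x.1 / d)) : ℝ) := by
      rw [sum_product]
      apply sum_congr rfl
      intro e he
      rw [mem_filter] at he
      apply sum_congr rfl
      intro l hl
      rw [mul_one_div]
      exact hfac e he.1 he.2 l hl
    rw [e2]
    have hinj : Set.InjOn (fun x : ℕ × ℕ => x.2 * (x.1 / d)) (((DD k z).filter (fun e => d ∣ e)) ×ˢ d.divisors : Finset (ℕ × ℕ)) := by
      rintro ⟨e, l⟩ h1 ⟨e', l'⟩ h2 h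
      simp only [coe_product, Set.mem_prod, mem_coe, mem_filter] at h1 h2
      obtain ⟨⟨he, m, rfl⟩, hl⟩ := h1
      obtain ⟨⟨he', m', rfl⟩, hl'⟩ := h2
      simp only [Nat.mul_div_cancel_left _ hd0] at h
      have c1 : Nat.Coprime m d := (Nat.coprime_of_squarefree_mul (mem_DD.1 he).2.1).symm
      have c2 : Nat.Coprime m' d := (Nat.coprime_of_squarefree_mul (mem_DD.1 he').2.1).symm
      have g1 : Nat.gcd (l * m) d = l := by
        rw [Nat.Coprime.gcd_mul_right_cancel l c1]; exact Nat.gcd_eq_left (Nat.dvd_of_mem_divisors hl)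
      have g2 : Nat.gcd (l' * m') d = l' := by
        rw [Nat.Coprime.gcd_mul_right_cancel l' c2]; exact Nat.gcd_eq_left (Nat.dvd_of_mem_divisors hl')
      have hll : l = l' := by rw [← g1, h, g2]
      subst hll
      have := Nat.eq_of_mul_eq_mul_left (Nat.pos_of_mem_divisors hl) h
      subst this
      rfl
    rw [← sum_image (f := fun n => 1 / (Nat.totient n : ℝ)) hinj]
    unfold SS
    apply sum_le_sum_of_subset_of_nonneg
    · intro f hf
      rw [mem_image] at hf
      obtain ⟨⟨e, l⟩, h1, rfl⟩ := hf
      simp only [mem_product, mem_filter] at h1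
      obtain ⟨⟨he, m, rfl⟩, hl⟩ := h1
      simp only [Nat.mul_div_cancel_left _ hd0]
      exact DD_dvd he (Nat.mul_dvd_mul_right (Nat.dvd_of_mem_divisors hl) m)
    · intros; positivity
  have hmu : |(moebius d : ℝ)| ≤ 1 := by
    have := abs_moebius_le_one (n := d)
    exact_mod_cast this
  unfold lam
  rw [abs_mul, abs_mul, abs_of_nonneg (show (0:ℝ) ≤ d / SS k z by positivity), abs_of_nonneg hnn]
  calc _ ≤ 1 * (d / SS k z) * ∑ e ∈ DD k z with d ∣ e, 1 / (Nat.totient e : ℝ) := by gcongr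
    _ = (d * ∑ e ∈ DD k z with d ∣ e, 1 / (Nat.totient e : ℝ)) / SS k z := by ring
    _ ≤ 1 := by rw [div_le_one hS]; exact key
end SelL

namespace SelL
open Finset ArithmeticFunction

lemma ap_count (X r v : ℕ) (hr : 0 < r) :
    |(((Ioc 0 X).filter (fun n => n ≡ v [MOD r])).card : ℝ) - (X : ℝ) / r| ≤ 1 := by
  have h := Nat.Ioc_filter_modEq_card 0 X hr v
  set c := ((Ioc 0 X).filter (fun n => n ≡ v [MOD r])).card with hc
  have hmono : ⌊(((0:ℕ):ℚ) - v) / r⌋ ≤ ⌊((X:ℚ) - v) / r⌋ := by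
    apply Int.floor_mono
    gcongr
    simp
  rw [max_eq_left (by omega)] at h
  have h1 := Int.floor_le (((X:ℚ) - v) / r)
  have h2 := Int.lt_floor_add_one (((X:ℚ) - v) / r)
  have h3 := Int.floor_le ((((0:ℕ):ℚ) - v) / r)
  have h4 := Int.lt_floor_add_one ((((0:ℕ):ℚ) - v) / r)
  have h5 : (c : ℚ) = (⌊((X:ℚ) - v) / r⌋ : ℚ) - (⌊(((0:ℕ):ℚ) - v) / r⌋ : ℚ) := by exact_mod_cast h
  have h6 : ((X:ℚ) - v) / r - (((0:ℕ):ℚ) - v) / r = (X:ℚ) / r := by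
    push_cast; ring
  have : |(c : ℚ) - (X : ℚ) / r| ≤ 1 := by
    rw [abs_le]
    constructor <;> linarith
  have h7 : ((|(c : ℚ) - (X : ℚ) / r| : ℚ) : ℝ) ≤ ((1 : ℚ) : ℝ) := Rat.cast_le.2 this
  push_cast at h7
  exact h7

lemma ap_count_dvd (X k b m : ℕ) (hk : 0 < k) (hm : 0 < m) (hc : m.Coprime k) :
    |(((Ioc 0 X).filter (fun n => n ≡ b [MOD k] ∧ m ∣ n)).card : ℝ) - (X : ℝ) / k / m| ≤ 1 := by
  obtain ⟨c, hc1, hc2⟩ := Nat.chineseRemainder hc.symm b 0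
  have h := ap_count X (k * m) c (Nat.mul_pos hk hm)
  have : (Ioc 0 X).filter (fun n => n ≡ b [MOD k] ∧ m ∣ n) = (Ioc 0 X).filter (fun n => n ≡ c [MOD k * m]) := by
    ext n
    simp only [mem_filter, and_congr_right_iff]
    intro _
    rw [← Nat.modEq_and_modEq_iff_modEq_mul hc.symm, ← Nat.modEq_zero_iff_dvd]
    constructor
    · rintro ⟨h1, h2⟩
      exact ⟨h1.trans hc1.symm, h2.trans hc2.symm⟩
    · rintro ⟨h1, h2⟩
      exact ⟨h1.trans hc1, h2.trans hc2⟩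
  rw [this, div_div]
  exact_mod_cast h

lemma sieve (X k b z : ℕ) (hk : 0 < k) (hz : 1 ≤ z) :
    (((Ioc 0 X).filter (fun p => p.Prime ∧ p ≡ b [MOD k])).card : ℝ) ≤ X / k / SS k z + z ^ 2 + z := by
  set P := (Ioc 0 X).filter (fun p => p.Prime ∧ p ≡ b [MOD k])
  set AA := (Ioc 0 X).filter (fun n => n ≡ b [MOD k])
  let w : ℕ → ℝ := fun n => (∑ d ∈ DD k z with d ∣ n, lam k z d) ^ 2
  have h1 : (P.card : ℝ) ≤ ∑ n ∈ AA, w n + z := by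
    have hsub : P ⊆ (AA.filter (fun n => n.Prime ∧ z < n)) ∪ Ioc 0 z := by
      intro p hp
      simp only [P, AA, mem_union, mem_filter, mem_Ioc] at hp ⊢
      by_cases h : z < p
      · left; exact ⟨⟨hp.1, hp.2.2⟩, hp.2.1, h⟩
      · right; exact ⟨hp.1.1, by omega⟩
    have h2 := (card_le_card hsub).trans (card_union_le _ _)
    rw [Nat.card_Ioc, Nat.sub_zero] at h2
    have h3 : ((AA.filter (fun n => n.Prime ∧ z < n)).card : ℝ) ≤ ∑ n ∈ AA, w n := by
      rw [card_eq_sum_ones, Nat.cast_sum]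
      calc _ ≤ ∑ n ∈ AA.filter (fun n => n.Prime ∧ z < n), w n := by
            apply sum_le_sum
            intro p hp
            rw [mem_filter] at hp
            obtain ⟨_, hp, hzp⟩ := hp
            have : (DD k z).filter (fun d => d ∣ p) = {1} := by
              ext d
              simp only [mem_filter, mem_singleton]
              constructor
              · rintro ⟨hd, hdp⟩
                rcases (Nat.dvd_prime hp).1 hdp with h | h
                · exact h
                · have := (mem_DD.1 hd).1.2
                  omega
              · rintro rfl
                exact ⟨one_mem hz, one_dvd _⟩
            simp only [w, this, sum_singleton, lam_one hz]
            norm_num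
        _ ≤ _ := by
            apply sum_le_sum_of_subset_of_nonneg (filter_subset _ _)
            intros; positivity
    have h4 : (P.card : ℝ) ≤ ((AA.filter (fun n => n.Prime ∧ z < n)).card : ℝ) + z := by exact_mod_cast h2
    linarith
  have h2 : ∑ n ∈ AA, w n = ∑ d₁ ∈ DD k z, ∑ d₂ ∈ DD k z, lam k z d₁ * lam k z d₂ *
      (((Ioc 0 X).filter (fun n => n ≡ b [MOD k] ∧ Nat.lcm d₁ d₂ ∣ n)).card : ℝ) := by
    have : ∀ n ∈ AA, w n = ∑ d₁ ∈ DD k z, ∑ d₂ ∈ DD k z, (if Nat.lcm d₁ d₂ ∣ n then lam k z d₁ * lam k z d₂ else 0) := by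
      intro n _
      simp only [w]
      rw [sq, sum_mul_sum, sum_filter]
      apply sum_congr rfl
      intro d₁ _
      split_ifs with h
      · rw [sum_filter]
        apply sum_congr rfl
        intro d₂ _
        simp [Nat.lcm_dvd_iff, h]
      · symm
        apply sum_eq_zero
        intro d₂ _
        simp [Nat.lcm_dvd_iff, h]
    rw [sum_congr rfl this, sum_comm]
    apply sum_congr rfl
    intro d₁ _
    rw [sum_comm]
    apply sum_congr rfl
    intro d₂ _
    rw [← sum_filter, sum_const, filter_filter, nsmul_eq_mul, mul_comm]
  have h3 : ∑ n ∈ AA, w n ≤ ∑ d₁ ∈ DD k z, ∑ d₂ ∈ DD k z, (lam k z d₁ * lam k z d₂ / (Nat.lcm d₁ d₂ : ℝ) * (X / k) + 1) := by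
    rw [h2]
    apply sum_le_sum
    intro d₁ h₁
    apply sum_le_sum
    intro d₂ h₂
    have hlpos : 0 < Nat.lcm d₁ d₂ := Nat.lcm_pos (mem_DD.1 h₁).1.1 (mem_DD.1 h₂).1.1
    have hcop : (Nat.lcm d₁ d₂).Coprime k := by
      apply Nat.Coprime.coprime_dvd_left (Nat.lcm_dvd_mul d₁ d₂)
      exact Nat.Coprime.mul_left (mem_DD.1 h₁).2.2 (mem_DD.1 h₂).2.2
    have hcount := ap_count_dvd X k b _ hk hlpos hcop
    set c : ℝ := (((Ioc 0 X).filter (fun n => n ≡ b [MOD k] ∧ Nat.lcm d₁ d₂ ∣ n)).card : ℝ)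
    have hl : |lam k z d₁ * lam k z d₂| ≤ 1 := by
      rw [abs_mul]
      exact mul_le_one₀ (lam_le hz h₁) (abs_nonneg _) (lam_le hz h₂)
    have : |lam k z d₁ * lam k z d₂ * (c - X / k / (Nat.lcm d₁ d₂ : ℝ))| ≤ 1 := by
      rw [abs_mul]
      exact mul_le_one₀ hl (abs_nonneg _) hcount
    have := (abs_le.1 this).2
    have e : lam k z d₁ * lam k z d₂ * (c - X / k / (Nat.lcm d₁ d₂ : ℝ)) = lam k z d₁ * lam k z d₂ * c - lam k z d₁ * lam k z d₂ / (Nat.lcm d₁ d₂ : ℝ) * (X / k) := by ring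
    linarith
  have h4 : ∑ d₁ ∈ DD k z, ∑ d₂ ∈ DD k z, (lam k z d₁ * lam k z d₂ / (Nat.lcm d₁ d₂ : ℝ) * (X / k) + 1) = 1 / SS k z * (X / k) + ((DD k z).card : ℝ) ^ 2 := by
    simp_rw [sum_add_distrib, ← sum_mul]
    rw [main_term hz]
    simp [sq]
  have h5 : ((DD k z).card : ℝ) ≤ z := by
    have : (DD k z).card ≤ (Icc 1 z).card := card_filter_le _ _
    rw [Nat.card_Icc, Nat.add_sub_cancel] at this
    exact_mod_cast this
  have h6 : ((DD k z).card : ℝ) ^ 2 ≤ (z : ℝ) ^ 2 := by gcongr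
  have h7 : (X:ℝ) / k / SS k z = 1 / SS k z * (X / k) := by ring
  linarith

noncomputable def invHom : ℕ →* ℝ where
  toFun n := (n:ℝ)⁻¹
  map_one' := by simp
  map_mul' a b := by simp [mul_comm]

lemma fact_sum (N : ℕ) (hN : 0 < N) (T : Finset ℕ) (hT : ∀ m ∈ T, m ∈ Nat.factoredNumbers N.primeFactors) :
    ∑ m ∈ T, (m:ℝ)⁻¹ ≤ N / Nat.totient N := by
  have h := (EulerProduct.summable_and_hasSum_factoredNumbers_prod_filter_prime_geometric (f := invHom) (by
    intro p hp
    have : (1:ℝ) < p := by exact_mod_cast hp.one_lt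
    show ‖(p:ℝ)⁻¹‖ < 1
    rw [Real.norm_of_nonneg (by positivity)]
    exact inv_lt_one_of_one_lt₀ this) N.primeFactors).2
  have hf : N.primeFactors.filter Nat.Prime = N.primeFactors := by
    apply filter_true_of_mem
    intro p hp
    exact Nat.prime_of_mem_primeFactors hp
  rw [hf] at h
  have e1 : ∏ p ∈ N.primeFactors, (1 - invHom p)⁻¹ = (N:ℝ) / Nat.totient N := by
    have := Nat.totient_eq_mul_prod_factors N
    have h2 := congrArg (fun t : ℚ => (t : ℝ)) this
    push_cast at h2
    have htp : (0:ℝ) < Nat.totient N := by exact_mod_cast Nat.totient_pos.2 hN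
    have hN' : (0:ℝ) < N := by exact_mod_cast hN
    rw [prod_inv_distrib]
    have e : ∏ p ∈ N.primeFactors, (1 - invHom p) = ∏ p ∈ N.primeFactors, (1 - (p:ℝ)⁻¹) := rfl
    rw [e, h2]
    have : ∏ p ∈ N.primeFactors, (1 - (p:ℝ)⁻¹) ≠ 0 := by
      intro h0
      rw [h0, mul_zero] at h2
      linarith
    field_simp
  rw [e1] at h
  have h3 := sum_le_hasSum (T.attach.map ⟨fun m => (⟨m.1, hT m.1 m.2⟩ : Nat.factoredNumbers N.primeFactors), by
    intro a b hab
    exact Subtype.ext (congrArg (fun t : Nat.factoredNumbers N.primeFactors => (t : ℕ)) hab)⟩) (by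
    intro i _
    show 0 ≤ ((i:ℕ):ℝ)⁻¹
    positivity) h
  rw [sum_map] at h3
  have : ∑ m ∈ T, (m:ℝ)⁻¹ = ∑ x ∈ T.attach, ((x:ℕ):ℝ)⁻¹ := (sum_attach T (fun m => (m:ℝ)⁻¹)).symm
  rw [this]
  exact h3

lemma S_lower (k z : ℕ) (hk : 0 < k) (hz : 1 ≤ z) : (Nat.totient k : ℝ) / k * Real.log z ≤ SS k z := by
  let g : ℕ → ℕ := fun n => ∏ p ∈ n.primeFactors \ k.primeFactors, p
  have hgdvd : ∀ n, g n ∣ n := fun n =>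
    (prod_dvd_prod_of_subset _ _ _ sdiff_subset).trans (Nat.prod_primeFactors_dvd n)
  have hgprime : ∀ n, n ≠ 0 → ∀ p, p.Prime → p ∣ n → p ∣ g n * k := by
    intro n hn p hp hpn
    by_cases hpk : p ∣ k
    · exact hpk.mul_left _
    · apply Dvd.dvd.mul_right
      apply dvd_prod_of_mem (fun p => p)
      simp [hp, hpn, hn, hpk]
  have hgD : ∀ n ∈ Icc 1 z, g n ∈ DD k z := by
    intro n hn
    rw [mem_Icc] at hn
    rw [mem_DD]
    refine ⟨⟨Nat.pos_of_dvd_of_pos (hgdvd n) hn.1, (Nat.le_of_dvd hn.1 (hgdvd n)).trans hn.2⟩, ?_, ?_⟩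
    · apply Finset.squarefree_prod_of_pairwise_isCoprime
      · intro p hp q hq hpq
        simp only [coe_sdiff, Set.mem_sdiff, mem_coe] at hp hq
        exact Nat.coprime_iff_isRelPrime.1 ((Nat.coprime_primes (Nat.prime_of_mem_primeFactors hp.1) (Nat.prime_of_mem_primeFactors hq.1)).2 hpq)
      · intro p hp
        rw [mem_sdiff] at hp
        exact (Nat.prime_of_mem_primeFactors hp.1).squarefree
    · apply Nat.Coprime.prod_left
      intro p hp
      rw [mem_sdiff] at hp
      have hpp := Nat.prime_of_mem_primeFactors hp.1
      rw [hpp.coprime_iff_not_dvd]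
      intro h
      exact hp.2 (Nat.mem_primeFactors.2 ⟨hpp, h, hk.ne'⟩)
  have hk' : (0:ℝ) < k := by exact_mod_cast hk
  have htk : (0:ℝ) < Nat.totient k := by exact_mod_cast Nat.totient_pos.2 hk
  have hfib : ∀ d ∈ DD k z, ∑ n ∈ Icc 1 z with g n = d, (n:ℝ)⁻¹ ≤ (1 / Nat.totient d) * (k / Nat.totient k) := by
    intro d hd
    have hd0 : 0 < d := (mem_DD.1 hd).1.1
    have hd' : (0:ℝ) < d := by exact_mod_cast hd0
    have htd := tot_pos hd
    have hinj : Set.InjOn (fun n => n / d) ((Icc 1 z).filter (fun n => g n = d) : Finset ℕ) := by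
      intro a ha b hb hab
      simp only [coe_filter, Set.mem_ofPred_eq] at ha hb
      have h1 := hgdvd a
      have h2 := hgdvd b
      rw [ha.2] at h1
      rw [hb.2] at h2
      exact (Nat.div_left_inj h1 h2).1 hab
    have h1 := fact_sum (d * k) (Nat.mul_pos hd0 hk) (((Icc 1 z).filter (fun n => g n = d)).image (fun n => n / d)) (by
      intro m hm
      rw [mem_image] at hm
      obtain ⟨n, hn, rfl⟩ := hm
      rw [mem_filter, mem_Icc] at hn
      have hdn := hgdvd n
      rw [hn.2] at hdn
      have hnd : n / d ≠ 0 := (Nat.div_pos (Nat.le_of_dvd hn.1.1 hdn) hd0).ne'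
      apply Nat.mem_factoredNumbers_of_primeFactors_subset hnd
      intro p hp
      rw [Nat.mem_primeFactors] at hp ⊢
      refine ⟨hp.1, ?_, (Nat.mul_pos hd0 hk).ne'⟩
      have := hgprime n (by omega) p hp.1 (hp.2.1.trans (Nat.div_dvd_of_dvd hdn))
      rwa [hn.2] at this)
    rw [sum_image hinj, Nat.totient_mul (mem_DD.1 hd).2.2] at h1
    have h2 : ∀ n ∈ (Icc 1 z).filter (fun n => g n = d), (n:ℝ)⁻¹ = (d:ℝ)⁻¹ * ((n / d : ℕ):ℝ)⁻¹ := by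
      intro n hn
      rw [mem_filter] at hn
      have hdn := hgdvd n
      rw [hn.2] at hdn
      rw [Nat.cast_div hdn hd'.ne', inv_div]
      field_simp
    rw [sum_congr rfl h2, ← mul_sum]
    calc _ ≤ (d:ℝ)⁻¹ * (((d * k : ℕ) : ℝ) / ((Nat.totient d * Nat.totient k : ℕ) : ℝ)) := by gcongr
      _ = _ := by push_cast; field_simp
  have h1 : ∑ n ∈ Icc 1 z, (n:ℝ)⁻¹ ≤ SS k z * (k / Nat.totient k) := by
    rw [← sum_fiberwise_of_maps_to hgD]
    unfold SS
    rw [sum_mul]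
    exact sum_le_sum hfib
  have h2 : Real.log z ≤ ∑ n ∈ Icc 1 z, (n:ℝ)⁻¹ := by
    have := log_le_harmonic_floor (z:ℝ) (by positivity)
    rw [Nat.floor_natCast, harmonic_eq_sum_Icc] at this
    push_cast at this
    exact this
  calc _ ≤ (Nat.totient k : ℝ) / k * (SS k z * (k / Nat.totient k)) := by gcongr; linarith
    _ = _ := by field_simp

lemma bt1 (X k b z : ℕ) (hk : 0 < k) (hz : 2 ≤ z) :
    (((Ioc 0 X).filter (fun p => p.Prime ∧ p ≡ b [MOD k])).card : ℝ) ≤ X / (Nat.totient k * Real.log z) + 2 * z ^ 2 := by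
  have h := sieve X k b z hk (by omega)
  have h2 := S_lower k z hk (by omega)
  have hk' : (0:ℝ) < k := by exact_mod_cast hk
  have htk : (0:ℝ) < Nat.totient k := by exact_mod_cast Nat.totient_pos.2 hk
  have hz' : (2:ℝ) ≤ z := by exact_mod_cast hz
  have hlz : 0 < Real.log z := Real.log_pos (by linarith)
  have h3 : (X:ℝ) / k / SS k z ≤ X / k / ((Nat.totient k : ℝ) / k * Real.log z) := by gcongr
  have h4 : (X:ℝ) / k / ((Nat.totient k : ℝ) / k * Real.log z) = X / (Nat.totient k * Real.log z) := by field_simp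
  nlinarith

/-- Brun-Titchmarsh. -/
theorem brun_titchmarsh {ε : ℝ} (hε : 0 < ε) : ∃ Y0 : ℝ, 1 < Y0 ∧ ∀ X k b : ℕ, 0 < k → Y0 ≤ (X:ℝ) / k →
    (((Ioc 0 X).filter (fun p => p.Prime ∧ p ≡ b [MOD k])).card : ℝ) ≤ (2 + ε) * X / (Nat.totient k * Real.log (X / k)) := by
  -- choose z = floor (Y^a)
  obtain ⟨a, ha0, ha, hae⟩ : ∃ a : ℝ, 0 < a ∧ a < 1 / 2 ∧ 1 / a ≤ 2 + ε / 4 := by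
    refine ⟨1 / (2 + ε / 4), by positivity, ?_, by simp⟩
    rw [div_lt_div_iff₀ (by positivity) (by positivity)]
    linarith
  have t1 : Filter.Tendsto (fun Y : ℝ => Y ^ a) Filter.atTop Filter.atTop := tendsto_rpow_atTop ha0
  have t2 : (fun x : ℝ => Real.log x) =o[Filter.atTop] fun x => x ^ (1 - 2 * a) := isLittleO_log_rpow_atTop (by linarith)
  have t3 : Filter.Tendsto (fun Y : ℝ => Real.log Y) Filter.atTop Filter.atTop := Real.tendsto_log_atTop
  have ev := ((t1.eventually_ge_atTop 2).and (t2.bound (show 0 < ε / 4 by positivity))).and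
    ((t3.eventually_ge_atTop ((2 + ε) * 4 / ε / a)).and (Filter.eventually_ge_atTop 2))
  obtain ⟨Y0, hY0⟩ := Filter.eventually_atTop.1 ev
  refine ⟨max Y0 2, lt_of_lt_of_le (by norm_num) (le_max_right _ _), ?_⟩
  intro X k b hk hY
  set Y : ℝ := (X:ℝ) / k with hYdef
  obtain ⟨⟨e1, e2⟩, e3, e4⟩ := hY0 Y ((le_max_left _ _).trans hY)
  have hk' : (0:ℝ) < k := by exact_mod_cast hk
  have htk : (0:ℝ) < Nat.totient k := by exact_mod_cast Nat.totient_pos.2 hk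
  have htk2 : (Nat.totient k : ℝ) ≤ k := by exact_mod_cast Nat.totient_le k
  have hY0' : 0 < Y := by linarith
  have hlY : 0 < Real.log Y := Real.log_pos (by linarith)
  set z := ⌊Y ^ a⌋₊ with hz
  have hz2 : 2 ≤ z := Nat.le_floor (by exact_mod_cast e1)
  have hz2' : (2:ℝ) ≤ z := by exact_mod_cast hz2
  have h := bt1 X k b z hk hz2
  have hzle : (z:ℝ) ≤ Y ^ a := Nat.floor_le (by positivity)
  have hzge : Y ^ a ≤ 2 * z := by
    have := Nat.lt_floor_add_one (Y ^ a)
    linarith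
  have hlog : a * Real.log Y - 1 ≤ Real.log z := by
    have : Real.log (Y ^ a) ≤ Real.log (2 * z) := Real.log_le_log (by positivity) hzge
    rw [Real.log_rpow hY0', Real.log_mul (by norm_num) (by linarith)] at this
    linarith [Real.log_two_lt_d9]
  -- main term
  have hX : (X:ℝ) = Y * k := by rw [hYdef]; field_simp
  have m1 : 1 / Real.log z ≤ (2 + ε / 2) / Real.log Y := by
    have hlz : 0 < Real.log z := Real.log_pos (by linarith)
    rw [div_le_div_iff₀ hlz hlY, one_mul]
    have h6 : (2 + ε) * 4 / ε / a ≤ Real.log Y := e3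
    rw [div_le_iff₀ ha0, div_le_iff₀ hε] at h6
    have h7 : 1 ≤ (2 + ε / 4) * a := by rwa [div_le_iff₀ ha0] at hae
    nlinarith
  have m2 : 2 * (z:ℝ) ^ 2 ≤ ε / 2 * Y / Real.log Y := by
    have h8 : (z:ℝ) ^ 2 ≤ Y ^ (2 * a) := by
      calc (z:ℝ) ^ 2 ≤ (Y ^ a) ^ 2 := by gcongr
        _ = Y ^ (2 * a) := by rw [← Real.rpow_natCast, ← Real.rpow_mul hY0'.le]; norm_num; ring_nf
    rw [Real.norm_of_nonneg hlY.le, Real.norm_of_nonneg (by positivity)] at e2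
    rw [le_div_iff₀ hlY]
    calc _ ≤ 2 * Y ^ (2 * a) * (ε / 4 * Y ^ (1 - 2 * a)) := by gcongr
      _ = ε / 2 * (Y ^ (2 * a) * Y ^ (1 - 2 * a)) := by ring
      _ = _ := by rw [← Real.rpow_add hY0']; norm_num
  calc _ ≤ _ := h
    _ = X / Nat.totient k * (1 / Real.log z) + 2 * z ^ 2 := by rw [mul_one_div, div_div]
    _ ≤ X / Nat.totient k * ((2 + ε / 2) / Real.log Y) + ε / 2 * Y / Real.log Y := by gcongr
    _ ≤ X / Nat.totient k * ((2 + ε / 2) / Real.log Y) + ε / 2 * (X / Nat.totient k) / Real.log Y := by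
        have : Y ≤ X / Nat.totient k := by
          rw [hYdef]; gcongr
        gcongr
    _ = _ := by field_simp; ring
end SelL

namespace LSL
open Finset Complex

noncomputable def ee (t : ℝ) : ℂ := cexp (((2 * Real.pi * t : ℝ) : ℂ) * I)

lemma ee_norm (t : ℝ) : ‖ee t‖ = 1 := norm_exp_ofReal_mul_I _

lemma ee_add (a b : ℝ) : ee (a + b) = ee a * ee b := by
  unfold ee
  rw [← Complex.exp_add]
  congr 1
  push_cast
  ring

lemma ee_int (m : ℤ) : ee m = 1 := by
  unfold ee
  rw [Complex.exp_eq_one_iff]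
  exact ⟨m, by push_cast; ring⟩

lemma ee_conj (a : ℝ) : (starRingEnd ℂ) (ee a) = ee (-a) := by
  unfold ee
  rw [← Complex.exp_conj]
  congr 1
  rw [map_mul, Complex.conj_ofReal, Complex.conj_I]
  push_cast
  ring

lemma ee_add_int (a : ℝ) (m : ℤ) : ee (a + m) = ee a := by rw [ee_add, ee_int, mul_one]

lemma ee_zero : ee 0 = 1 := by simpa using ee_int 0

lemma ee_nat_mul (j : ℕ) (a : ℝ) : ee (j * a) = ee a ^ j := by
  unfold ee
  rw [← Complex.exp_nat_mul]
  congr 1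
  push_cast
  ring

noncomputable def KK (L : ℕ) (θ : ℝ) : ℝ := ‖∑ j ∈ range L, ee (j * θ)‖ ^ 2

lemma KK_nonneg (L : ℕ) (θ : ℝ) : 0 ≤ KK L θ := by unfold KK; positivity

lemma KK_le (L : ℕ) (θ : ℝ) : KK L θ ≤ (L:ℝ) ^ 2 := by
  unfold KK
  have : ‖∑ j ∈ range L, ee (j * θ)‖ ≤ ∑ j ∈ range L, ‖ee (j * θ)‖ := norm_sum_le _ _
  simp only [ee_norm] at this
  simp at this
  gcongr

lemma KK_neg (L : ℕ) (θ : ℝ) : KK L (-θ) = KK L θ := by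
  unfold KK
  rw [← Complex.norm_conj (∑ j ∈ range L, ee (j * θ)), map_sum]
  simp [ee_conj]

lemma KK_add_int (L : ℕ) (θ : ℝ) (m : ℤ) : KK L (θ + m) = KK L θ := by
  unfold KK
  congr 2
  apply sum_congr rfl
  intro j _
  have : (j:ℝ) * (θ + m) = j * θ + ((j * m : ℤ) : ℝ) := by push_cast; ring
  rw [this, ee_add_int]

lemma ee_sub_one (θ : ℝ) : ‖ee θ - 1‖ = 2 * |Real.sin (Real.pi * θ)| := by
  unfold ee
  rw [mul_comm, norm_exp_I_mul_ofReal_sub_one, norm_mul, Real.norm_eq_abs, Real.norm_eq_abs]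
  rw [abs_of_pos (by norm_num : (0:ℝ) < 2)]
  congr 3
  ring

lemma sin_ge {θ : ℝ} (h0 : 0 < θ) (h1 : θ < 1) : 2 * min θ (1 - θ) ≤ Real.sin (Real.pi * θ) := by
  have hpi := Real.pi_pos
  rcases le_total θ (1/2) with h | h
  · have := Real.mul_le_sin (x := Real.pi * θ) (by positivity) (by nlinarith)
    have e : 2 / Real.pi * (Real.pi * θ) = 2 * θ := by field_simp
    rw [e] at this
    exact le_trans (by gcongr; exact min_le_left _ _) this
  · have := Real.mul_le_sin (x := Real.pi * (1 - θ)) (by apply mul_nonneg hpi.le; linarith) (by nlinarith)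
    have e : 2 / Real.pi * (Real.pi * (1 - θ)) = 2 * (1 - θ) := by field_simp
    have e2 : Real.sin (Real.pi * (1 - θ)) = Real.sin (Real.pi * θ) := by
      rw [mul_sub, mul_one, Real.sin_pi_sub]
    rw [e, e2] at this
    exact le_trans (by gcongr; exact min_le_right _ _) this

lemma geom_le (L : ℕ) {θ : ℝ} (h0 : 0 < θ) (h1 : θ < 1) :
    ‖∑ j ∈ range L, ee (j * θ)‖ ≤ 1 / (2 * min θ (1 - θ)) := by
  have hmin : 0 < min θ (1 - θ) := lt_min h0 (by linarith)
  have hs := sin_ge h0 h1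
  have hne : ee θ - 1 ≠ 0 := by
    rw [← norm_pos_iff, ee_sub_one, abs_of_pos (by linarith)]
    linarith
  simp_rw [ee_nat_mul]
  rw [geom_sum_eq (by intro h; rw [h] at hne; simp at hne), norm_div, ee_sub_one, abs_of_pos (by linarith)]
  have : ‖ee θ ^ L - 1‖ ≤ 2 := by
    refine (norm_sub_le _ _).trans ?_
    rw [norm_pow, ee_norm]; norm_num
  calc _ ≤ 2 / (2 * (2 * min θ (1 - θ))) := by gcongr
    _ = _ := by field_simp

lemma KK_le' (L : ℕ) {θ : ℝ} (h0 : 0 < θ) (h1 : θ < 1) : KK L θ ≤ 1 / θ ^ 2 + 1 / (1 - θ) ^ 2 := by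
  have h := geom_le L h0 h1
  have h1' : 0 < 1 - θ := by linarith
  unfold KK
  have hmin : 0 < min θ (1 - θ) := lt_min h0 h1'
  have : ‖∑ j ∈ range L, ee (j * θ)‖ ≤ 1 / min θ (1 - θ) := h.trans (by gcongr; linarith)
  have h2 : ‖∑ j ∈ range L, ee (j * θ)‖ ^ 2 ≤ (1 / min θ (1 - θ)) ^ 2 := by gcongr
  refine h2.trans ?_
  have p1 : 0 ≤ 1 / θ ^ 2 := by positivity
  have p2 : 0 ≤ 1 / (1 - θ) ^ 2 := by positivity
  rw [_root_.one_div_pow]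
  rcases min_choice θ (1 - θ) with h | h <;> rw [h] <;> linarith

lemma sum_inv_sq_le (T : Finset ℕ) (hT : ∀ i ∈ T, 1 ≤ i) : ∑ i ∈ T, 1 / (i:ℝ) ^ 2 ≤ 2 := by
  have h1 : ∑ i ∈ T, 1 / (i:ℝ) ^ 2 ≤ ∑' i : ℕ, 1 / (i:ℝ) ^ 2 :=
    hasSum_zeta_two.summable.sum_le_tsum T (fun i _ => by positivity)
  rw [hasSum_zeta_two.tsum_eq] at h1
  have := Real.pi_lt_d2
  have := Real.pi_pos
  nlinarith

lemma bin_sum {ι : Type*} (s : Finset ι) (θ : ι → ℝ) {δ : ℝ} (hδ : 0 < δ)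
    (hθ : ∀ r ∈ s, δ ≤ θ r) (hsep : ∀ r ∈ s, ∀ t ∈ s, r ≠ t → δ ≤ |θ r - θ t|) :
    ∑ r ∈ s, 1 / θ r ^ 2 ≤ 2 / δ ^ 2 := by
  let i : ι → ℕ := fun r => ⌊θ r / δ⌋₊
  have hinj : Set.InjOn i s := by
    intro r hr t ht h
    by_contra hne
    have h1 := hsep r hr t ht hne
    have hr0 : 0 ≤ θ r / δ := div_nonneg (hδ.le.trans (hθ r hr)) hδ.le
    have ht0 : 0 ≤ θ t / δ := div_nonneg (hδ.le.trans (hθ t ht)) hδ.le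
    have a1 := Nat.floor_le hr0
    have a2 := Nat.lt_floor_add_one (θ r / δ)
    have a3 := Nat.floor_le ht0
    have a4 := Nat.lt_floor_add_one (θ t / δ)
    simp only [i] at h
    rw [h] at a1 a2
    have : |θ r / δ - θ t / δ| < 1 := by rw [abs_lt]; constructor <;> linarith
    rw [← sub_div, abs_div, abs_of_pos hδ, div_lt_one hδ] at this
    linarith
  have hi : ∀ r ∈ s, 1 ≤ i r := by
    intro r hr
    apply Nat.le_floor
    rw [le_div_iff₀ hδ]
    simpa using hθ r hr
  have h1 : ∀ r ∈ s, 1 / θ r ^ 2 ≤ 1 / δ ^ 2 * (1 / (i r : ℝ) ^ 2) := by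
    intro r hr
    have hr0 : 0 ≤ θ r / δ := div_nonneg (hδ.le.trans (hθ r hr)) hδ.le
    have a1 : (i r : ℝ) ≤ θ r / δ := Nat.floor_le hr0
    have a2 : (1:ℝ) ≤ i r := by exact_mod_cast hi r hr
    have a3 : δ * i r ≤ θ r := by rwa [le_div_iff₀ hδ, mul_comm] at a1
    have e : 1 / δ ^ 2 * (1 / (i r : ℝ) ^ 2) = 1 / (δ * i r) ^ 2 := by
      rw [mul_pow]; field_simp
    rw [e]
    have : 0 < δ * i r := by positivity
    gcongr
  calc _ ≤ ∑ r ∈ s, 1 / δ ^ 2 * (1 / (i r : ℝ) ^ 2) := sum_le_sum h1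
    _ = 1 / δ ^ 2 * ∑ j ∈ s.image i, (1 / (j : ℝ) ^ 2) := by rw [← mul_sum, sum_image hinj]
    _ ≤ 1 / δ ^ 2 * 2 := by
      gcongr
      apply sum_inv_sq_le
      intro j hj
      rw [mem_image] at hj
      obtain ⟨r, hr, rfl⟩ := hj
      exact hi r hr
    _ = _ := by ring

lemma row_sum {ι : Type*} [DecidableEq ι] (s : Finset ι) (α : ι → ℝ) {δ : ℝ} (hδ : 0 < δ)
    (hsep : ∀ r ∈ s, ∀ t ∈ s, r ≠ t → ∀ m : ℤ, δ ≤ |α r - α t - m|) (L : ℕ) (r : ι) (hr : r ∈ s) :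
    ∑ t ∈ s, KK L (α r - α t) ≤ (L:ℝ) ^ 2 + 4 / δ ^ 2 := by
  rw [← add_sum_erase s _ hr]
  have h0 : KK L (α r - α r) ≤ (L:ℝ) ^ 2 := KK_le _ _
  let θ : ι → ℝ := fun t => Int.fract (α r - α t)
  have hθ1 : ∀ t ∈ s.erase r, δ ≤ θ t := by
    intro t ht
    rw [mem_erase] at ht
    have := hsep r hr t ht.2 ht.1.symm ⌊α r - α t⌋
    rw [← Int.fract, abs_of_nonneg (Int.fract_nonneg _)] at this
    exact this
  have hθ2 : ∀ t ∈ s.erase r, δ ≤ 1 - θ t := by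
    intro t ht
    rw [mem_erase] at ht
    have := hsep r hr t ht.2 ht.1.symm (⌊α r - α t⌋ + 1)
    have e : α r - α t - ((⌊α r - α t⌋ + 1 : ℤ) : ℝ) = -(1 - θ t) := by
      simp only [θ, Int.fract]; push_cast; ring
    have hlt : θ t < 1 := Int.fract_lt_one _
    rw [e, abs_neg, abs_of_pos (by linarith)] at this
    exact this
  have hθs : ∀ t ∈ s.erase r, ∀ u ∈ s.erase r, t ≠ u → δ ≤ |θ t - θ u| := by
    intro t ht u hu htu
    rw [mem_erase] at ht hu
    have := hsep u hu.2 t ht.2 htu.symm (⌊α r - α t⌋ - ⌊α r - α u⌋)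
    have e : α u - α t - ((⌊α r - α t⌋ - ⌊α r - α u⌋ : ℤ) : ℝ) = θ t - θ u := by
      simp only [θ, Int.fract]; push_cast; ring
    rwa [e] at this
  have h1 : ∑ t ∈ s.erase r, KK L (α r - α t) ≤ ∑ t ∈ s.erase r, (1 / θ t ^ 2 + 1 / (1 - θ t) ^ 2) := by
    apply sum_le_sum
    intro t ht
    have e : α r - α t = θ t + (⌊α r - α t⌋ : ℤ) := by simp only [θ, Int.fract]; ring
    rw [e, KK_add_int]
    exact KK_le' L (hδ.trans_le (hθ1 t ht)) (by linarith [hθ2 t ht])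
  rw [sum_add_distrib] at h1
  have h2 := bin_sum (s.erase r) θ hδ hθ1 hθs
  have h3 := bin_sum (s.erase r) (fun t => 1 - θ t) hδ hθ2 (by
    intro t ht u hu htu
    have := hθs t ht u hu htu
    rw [abs_sub_comm] at this
    convert this using 2
    ring)
  have e : 4 / δ ^ 2 = 2 / δ ^ 2 + 2 / δ ^ 2 := by ring
  linarith

lemma ls_dual {ι : Type*} [DecidableEq ι] (s : Finset ι) (α : ι → ℝ) {δ : ℝ} (hδ : 0 < δ)
    (hsep : ∀ r ∈ s, ∀ t ∈ s, r ≠ t → ∀ m : ℤ, δ ≤ |α r - α t - m|) (N : ℕ) (hN : 1 / δ ≤ N) (c : ι → ℂ) :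
    ∑ n ∈ range N, ‖∑ r ∈ s, c r * ee (n * α r)‖ ^ 2 ≤ 8 * N * ∑ r ∈ s, ‖c r‖ ^ 2 := by
  have hN0 : (0:ℝ) < N := lt_of_lt_of_le (by positivity) hN
  let T : ℝ → ℂ := fun t => ∑ r ∈ s, c r * ee (t * α r)
  have h1 : ((∑ j ∈ range (2*N), ∑ j' ∈ range (2*N), ‖T ((j:ℝ) - j')‖ ^ 2 : ℝ) : ℂ)
      = ∑ r ∈ s, ∑ t ∈ s, c r * (starRingEnd ℂ) (c t) * (KK (2*N) (α r - α t) : ℂ) := by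
    have e1 : ∀ t : ℝ, ((‖T t‖ ^ 2 : ℝ) : ℂ) = ∑ r ∈ s, ∑ u ∈ s, c r * (starRingEnd ℂ) (c u) * ee (t * (α r - α u)) := by
      intro t
      have : ((‖T t‖ ^ 2 : ℝ) : ℂ) = T t * (starRingEnd ℂ) (T t) := by
        rw [Complex.mul_conj, Complex.normSq_eq_norm_sq]
      rw [this]
      simp only [T]
      rw [map_sum, sum_mul_sum]
      apply sum_congr rfl; intro r _
      apply sum_congr rfl; intro u _
      rw [map_mul, ee_conj, show t * (α r - α u) = t * α r + -(t * α u) by ring, ee_add]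
      ring
    have e2 : ∀ θ : ℝ, (KK (2*N) θ : ℂ) = ∑ j ∈ range (2*N), ∑ j' ∈ range (2*N), ee (((j:ℝ) - j') * θ) := by
      intro θ
      unfold KK
      rw [← Complex.normSq_eq_norm_sq, ← Complex.mul_conj, map_sum, sum_mul_sum]
      apply sum_congr rfl; intro j _
      apply sum_congr rfl; intro j' _
      rw [ee_conj, ← ee_add]
      congr 1; ring
    rw [Complex.ofReal_sum]
    simp_rw [Complex.ofReal_sum, e1, e2, mul_sum]
    have : ∀ j ∈ range (2*N), ∑ j' ∈ range (2*N), ∑ r ∈ s, ∑ u ∈ s, c r * (starRingEnd ℂ) (c u) * ee (((j:ℝ) - j') * (α r - α u))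
       = ∑ r ∈ s, ∑ u ∈ s, ∑ j' ∈ range (2*N), c r * (starRingEnd ℂ) (c u) * ee (((j:ℝ) - j') * (α r - α u)) := by
      intro j _
      rw [sum_comm]
      apply sum_congr rfl; intro r _
      rw [sum_comm]
    rw [sum_congr rfl this, sum_comm]
    apply sum_congr rfl; intro r _
    rw [sum_comm]
  have h2 : ∑ j ∈ range (2*N), ∑ j' ∈ range (2*N), ‖T ((j:ℝ) - j')‖ ^ 2 ≤ 8 * N ^ 2 * ∑ r ∈ s, ‖c r‖ ^ 2 := by
    have h3 : ∑ j ∈ range (2*N), ∑ j' ∈ range (2*N), ‖T ((j:ℝ) - j')‖ ^ 2 ≤ ∑ r ∈ s, ∑ t ∈ s, ‖c r‖ * ‖c t‖ * KK (2*N) (α r - α t) := by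
      have hnn : 0 ≤ ∑ j ∈ range (2*N), ∑ j' ∈ range (2*N), ‖T ((j:ℝ) - j')‖ ^ 2 := by positivity
      rw [← Real.norm_of_nonneg hnn, ← Complex.norm_real, h1]
      refine (norm_sum_le _ _).trans (sum_le_sum fun r _ => (norm_sum_le _ _).trans (sum_le_sum fun t _ => ?_))
      rw [norm_mul, norm_mul, Complex.norm_conj, Complex.norm_real, Real.norm_of_nonneg (KK_nonneg _ _)]
    refine h3.trans ?_
    have h4 : ∑ r ∈ s, ∑ t ∈ s, ‖c r‖ * ‖c t‖ * KK (2*N) (α r - α t) ≤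
        ∑ r ∈ s, ∑ t ∈ s, (‖c r‖ ^ 2 / 2 * KK (2*N) (α r - α t) + ‖c t‖ ^ 2 / 2 * KK (2*N) (α t - α r)) := by
      apply sum_le_sum; intro r _
      apply sum_le_sum; intro t _
      have : KK (2*N) (α t - α r) = KK (2*N) (α r - α t) := by rw [← KK_neg]; congr 1; ring
      rw [this]
      have := KK_nonneg (2*N) (α r - α t)
      nlinarith [sq_nonneg (‖c r‖ - ‖c t‖)]
    have h5 : ∑ r ∈ s, ∑ t ∈ s, (‖c r‖ ^ 2 / 2 * KK (2*N) (α r - α t) + ‖c t‖ ^ 2 / 2 * KK (2*N) (α t - α r))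
       = ∑ r ∈ s, ‖c r‖ ^ 2 * ∑ t ∈ s, KK (2*N) (α r - α t) := by
      simp_rw [sum_add_distrib]
      rw [sum_comm (f := fun r t => ‖c t‖ ^ 2 / 2 * KK (2*N) (α t - α r)), ← sum_add_distrib]
      apply sum_congr rfl; intro r _
      rw [← mul_sum]
      ring
    rw [h5] at h4
    refine h4.trans ?_
    rw [mul_sum]
    apply sum_le_sum
    intro r hr
    have h6 := row_sum s α hδ hsep (2*N) r hr
    have h7 : 1 / δ ^ 2 ≤ (N:ℝ) ^ 2 := by
      rw [← _root_.one_div_pow]; gcongr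
    have h8 : ((2 * N : ℕ) : ℝ) ^ 2 + 4 / δ ^ 2 ≤ 8 * N ^ 2 := by
      push_cast
      have : 4 / δ ^ 2 = 4 * (1 / δ ^ 2) := by ring
      rw [this]
      nlinarith
    calc _ ≤ ‖c r‖ ^ 2 * (8 * N ^ 2) := by gcongr; exact h6.trans h8
      _ = _ := by ring
  have h9 : N * ∑ n ∈ range N, ‖T n‖ ^ 2 ≤ ∑ j ∈ range (2*N), ∑ j' ∈ range (2*N), ‖T ((j:ℝ) - j')‖ ^ 2 := by
    rw [sum_comm]
    have : (N:ℝ) * ∑ n ∈ range N, ‖T n‖ ^ 2 = ∑ j' ∈ range N, ∑ n ∈ range N, ‖T n‖ ^ 2 := by simp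
    rw [this]
    calc _ ≤ ∑ j' ∈ range N, ∑ j ∈ range (2 * N), ‖T ((j:ℝ) - j')‖ ^ 2 := by
          apply sum_le_sum
          intro j' hj'
          rw [mem_range] at hj'
          have : ∑ n ∈ range N, ‖T n‖ ^ 2 = ∑ j ∈ (range N).map (addRightEmbedding j'), ‖T ((j:ℝ) - j')‖ ^ 2 := by
            rw [sum_map]
            apply sum_congr rfl
            intro n _
            simp
          rw [this]
          apply sum_le_sum_of_subset_of_nonneg
          · intro j hj
            rw [mem_map] at hj
            obtain ⟨n, hn, rfl⟩ := hj
            rw [mem_range] at hn ⊢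
            simp; omega
          · intros; positivity
      _ ≤ _ := by
          apply sum_le_sum_of_subset_of_nonneg
          · intro j hj
            rw [mem_range] at hj ⊢; omega
          · intros; positivity
  have h10 : (N:ℝ) * ∑ n ∈ range N, ‖T n‖ ^ 2 ≤ N * (8 * N * ∑ r ∈ s, ‖c r‖ ^ 2) := by
    calc _ ≤ _ := h9
      _ ≤ _ := h2
      _ = _ := by ring
  exact le_of_mul_le_mul_left h10 hN0

lemma duality {ι κ : Type*} (s : Finset ι) (u : Finset κ) (x : ι → κ → ℂ) {B : ℝ} (hB : 0 ≤ B)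
    (h : ∀ c : ι → ℂ, ∑ n ∈ u, ‖∑ r ∈ s, c r * x r n‖ ^ 2 ≤ B * ∑ r ∈ s, ‖c r‖ ^ 2) (a : κ → ℂ) :
    ∑ r ∈ s, ‖∑ n ∈ u, a n * x r n‖ ^ 2 ≤ B * ∑ n ∈ u, ‖a n‖ ^ 2 := by
  let c : ι → ℂ := fun r => (starRingEnd ℂ) (∑ n ∈ u, a n * x r n)
  set Q := ∑ r ∈ s, ‖∑ n ∈ u, a n * x r n‖ ^ 2 with hQ
  have hQc : ∑ r ∈ s, ‖c r‖ ^ 2 = Q := by simp only [c, Complex.norm_conj, hQ]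
  have hQ0 : 0 ≤ Q := by positivity
  have hc := h c
  rw [hQc] at hc
  have e : (Q : ℂ) = ∑ n ∈ u, a n * ∑ r ∈ s, c r * x r n := by
    rw [hQ, Complex.ofReal_sum]
    simp_rw [mul_sum]
    rw [sum_comm]
    apply sum_congr rfl
    intro r _
    have : ((‖∑ n ∈ u, a n * x r n‖ ^ 2 : ℝ) : ℂ) = c r * (∑ n ∈ u, a n * x r n) := by
      simp only [c]
      rw [mul_comm, Complex.mul_conj, Complex.normSq_eq_norm_sq]
    rw [this, mul_sum]
    apply sum_congr rfl
    intros; ring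
  have h1 : Q ≤ ∑ n ∈ u, ‖a n‖ * ‖∑ r ∈ s, c r * x r n‖ := by
    have : Q = ‖(Q:ℂ)‖ := by rw [Complex.norm_real, Real.norm_of_nonneg hQ0]
    rw [this, e]
    refine (norm_sum_le _ _).trans (sum_le_sum fun n _ => ?_)
    rw [norm_mul]
  have h2 : Q ^ 2 ≤ (∑ n ∈ u, ‖a n‖ ^ 2) * (B * Q) := by
    calc Q ^ 2 ≤ (∑ n ∈ u, ‖a n‖ * ‖∑ r ∈ s, c r * x r n‖) ^ 2 := by gcongr
      _ ≤ (∑ n ∈ u, ‖a n‖ ^ 2) * (∑ n ∈ u, ‖∑ r ∈ s, c r * x r n‖ ^ 2) := sum_mul_sq_le_sq_mul_sq _ _ _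
      _ ≤ _ := by gcongr
  rcases hQ0.eq_or_lt with h0 | h0
  · rw [← h0]
    positivity
  · have : Q * Q ≤ Q * (B * ∑ n ∈ u, ‖a n‖ ^ 2) := by nlinarith
    exact le_of_mul_le_mul_left this h0

theorem large_sieve {ι : Type*} [DecidableEq ι] (s : Finset ι) (α : ι → ℝ) {δ : ℝ} (hδ : 0 < δ)
    (hsep : ∀ r ∈ s, ∀ t ∈ s, r ≠ t → ∀ m : ℤ, δ ≤ |α r - α t - m|) (N : ℕ) (a : ℕ → ℂ) :
    ∑ r ∈ s, ‖∑ n ∈ range N, a n * ee (n * α r)‖ ^ 2 ≤ 8 * (N + 1 / δ + 1) * ∑ n ∈ range N, ‖a n‖ ^ 2 := by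
  apply duality s (range N) (fun r n => ee (n * α r)) (by positivity)
  intro c
  set N' := N + ⌈1 / δ⌉₊
  have h1 : 1 / δ ≤ N' := by
    simp only [N']; push_cast
    have := Nat.le_ceil (1 / δ)
    linarith [(Nat.cast_nonneg N : (0:ℝ) ≤ N)]
  have h2 : (N' : ℝ) ≤ N + 1 / δ + 1 := by
    simp only [N']; push_cast
    have := Nat.ceil_lt_add_one (show 0 ≤ 1 / δ by positivity)
    linarith
  calc _ ≤ ∑ n ∈ range N', ‖∑ r ∈ s, c r * ee (n * α r)‖ ^ 2 := by
        apply sum_le_sum_of_subset_of_nonneg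
        · intro j hj
          rw [mem_range] at hj ⊢; simp only [N']; omega
        · intros; positivity
    _ ≤ 8 * N' * ∑ r ∈ s, ‖c r‖ ^ 2 := ls_dual s α hδ hsep N' h1 c
    _ ≤ _ := by gcongr
end LSL

namespace LSL
open Finset Complex

open Classical in
/-- nontrivial characters -/
noncomputable def NC (q : ℕ) : Finset (DirichletCharacter ℂ q) := univ.filter (fun ψ => ψ ≠ 1)

lemma mem_NC {q : ℕ} {ψ : DirichletCharacter ℂ q} : ψ ∈ NC q ↔ ψ ≠ 1 := by
  classical
  simp [NC]

section onemod
variable (q : ℕ) [Fact q.Prime]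

lemma gs_shift (ψ : DirichletCharacter ℂ q) (hψ : ψ ≠ 1) (n : ZMod q) :
    ∑ b : ZMod q, ψ⁻¹ b * ZMod.stdAddChar (b * n) = ψ n * gaussSum ψ⁻¹ ZMod.stdAddChar := by
  by_cases hn : n = 0
  · have h1 : ψ⁻¹ ≠ 1 := by simpa using hψ
    subst hn
    rw [MulChar.map_zero ψ]
    simp [MulChar.sum_eq_zero_of_ne_one h1]
  · have := gaussSum_mulShift_eq ψ⁻¹ (ZMod.stdAddChar (N := q)) (Units.mk0 n hn)
    rw [inv_inv] at this
    rw [Units.val_mk0] at this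
    rw [← this, gaussSum]
    apply Finset.sum_congr rfl
    intro b _
    rw [AddChar.mulShift_apply, mul_comm n b]

lemma gs_norm (ψ : DirichletCharacter ℂ q) (hψ : ψ ≠ 1) :
    ‖gaussSum ψ⁻¹ (ZMod.stdAddChar (N := q))‖ ^ 2 = q := by
  have h1 : ψ⁻¹ ≠ 1 := by simpa using hψ
  have h := gaussSum_mul_gaussSum_eq_card h1 (ZMod.isPrimitive_stdAddChar q)
  rw [← star_gaussSum_eq, ← starRingEnd_apply, Complex.mul_conj, Complex.normSq_eq_norm_sq,
    ZMod.card] at h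
  exact_mod_cast h

lemma char_parseval (S : ZMod q → ℂ) :
    ∑ ψ : DirichletCharacter ℂ q, ‖∑ b : ZMod q, ψ⁻¹ b * S b‖ ^ 2 =
      (q - 1 : ℝ) * ∑ b ∈ univ.filter (fun b : ZMod q => b ≠ 0), ‖S b‖ ^ 2 := by
  have key : ∀ ψ : DirichletCharacter ℂ q, ((‖∑ b : ZMod q, ψ⁻¹ b * S b‖ ^ 2 : ℝ) : ℂ) =
      ∑ b ∈ univ.filter (fun b : ZMod q => b ≠ 0), ∑ c : ZMod q, S b * (starRingEnd ℂ) (S c) * (ψ b⁻¹ * ψ c) := by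
    intro ψ
    rw [← Complex.normSq_eq_norm_sq, ← Complex.mul_conj, map_sum, Finset.sum_mul_sum,
      Finset.sum_filter]
    apply Finset.sum_congr rfl
    intro b _
    split_ifs with hb
    · apply Finset.sum_congr rfl
      intro c _
      rw [map_mul, MulChar.inv_apply', starRingEnd_apply (ψ⁻¹ c), MulChar.star_apply', inv_inv]
      ring
    · push Not at hb
      subst hb
      simp [MulChar.map_zero]
  have hq : ((q.totient : ℕ) : ℂ) = ((q - 1 : ℝ) : ℂ) := by
    rw [Nat.totient_prime (Fact.out), Nat.cast_sub (Nat.Prime.one_le (Fact.out))]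
    push_cast; rfl
  have : ((∑ ψ : DirichletCharacter ℂ q, ‖∑ b : ZMod q, ψ⁻¹ b * S b‖ ^ 2 : ℝ) : ℂ) =
     (((q - 1 : ℝ) * ∑ b ∈ univ.filter (fun b : ZMod q => b ≠ 0), ‖S b‖ ^ 2 : ℝ) : ℂ) := by
    rw [Complex.ofReal_sum]
    simp_rw [key]
    rw [Finset.sum_comm, Complex.ofReal_mul, Complex.ofReal_sum, Finset.mul_sum]
    apply Finset.sum_congr rfl
    intro b hb
    rw [Finset.mem_filter] at hb
    rw [Finset.sum_comm]
    simp_rw [← Finset.mul_sum]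
    simp_rw [DirichletCharacter.sum_char_inv_mul_char_eq ℂ (isUnit_iff_ne_zero.mpr hb.2)]
    simp only [mul_ite, mul_zero, Finset.sum_ite_eq, Finset.mem_univ, if_true]
    rw [hq, Complex.mul_conj, Complex.normSq_eq_norm_sq, mul_comm]
  exact_mod_cast this

lemma onemod (N : ℕ) (a : ℕ → ℂ) :
    ∑ ψ ∈ NC q, ‖∑ n ∈ range N, a n * ψ n‖ ^ 2 ≤
      ∑ b ∈ Ioo 0 q, ‖∑ n ∈ range N, a n * ee (n * ((b:ℝ) / q))‖ ^ 2 := by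
  have hqp : q.Prime := Fact.out
  have hq0 : (0:ℝ) < q := by exact_mod_cast hqp.pos
  set S : ZMod q → ℂ := fun b => ∑ n ∈ range N, a n * ZMod.stdAddChar (b * (n : ZMod q)) with hS
  have h1 : ∀ ψ : DirichletCharacter ℂ q, ψ ≠ 1 →
      (q:ℝ) * ‖∑ n ∈ range N, a n * ψ n‖ ^ 2 = ‖∑ b : ZMod q, ψ⁻¹ b * S b‖ ^ 2 := by
    intro ψ hψ
    rw [← gs_norm q ψ hψ, ← mul_pow, ← norm_mul]
    congr 2
    rw [hS]
    simp_rw [Finset.mul_sum]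
    rw [Finset.sum_comm]
    apply Finset.sum_congr rfl
    intro n _
    calc _ = a n * (ψ n * gaussSum ψ⁻¹ ZMod.stdAddChar) := by ring
      _ = _ := by
        rw [← gs_shift q ψ hψ, Finset.mul_sum]
        apply Finset.sum_congr rfl
        intro b _
        ring
  have h2 : ∑ b ∈ univ.filter (fun b : ZMod q => b ≠ 0), ‖S b‖ ^ 2 =
      ∑ b ∈ Ioo 0 q, ‖∑ n ∈ range N, a n * ee (n * ((b:ℝ) / q))‖ ^ 2 := by
    apply Finset.sum_bij' (fun (b : ZMod q) _ => b.val) (fun (n : ℕ) _ => (n : ZMod q))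
    · intro b hb
      simp only [Finset.mem_filter, Finset.mem_univ, true_and] at hb
      simp only [Finset.mem_Ioo]
      exact ⟨Nat.pos_of_ne_zero ((ZMod.val_ne_zero b).mpr hb), ZMod.val_lt b⟩
    · intro n hn
      simp only [Finset.mem_Ioo] at hn
      simp only [Finset.mem_filter, Finset.mem_univ, true_and]
      intro h
      rw [ZMod.natCast_eq_zero_iff] at h
      exact absurd (Nat.le_of_dvd hn.1 h) (by omega)
    · intro b _
      simp
    · intro n hn
      simp only [Finset.mem_Ioo] at hn
      exact ZMod.val_cast_of_lt hn.2
    · intro b _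
      congr 2
      rw [hS]
      apply Finset.sum_congr rfl
      intro n _
      congr 1
      have : b * (n : ZMod q) = (((b.val * n : ℕ) : ℤ) : ZMod q) := by simp
      rw [this, ZMod.stdAddChar_coe, ee]
      congr 1
      push_cast
      ring
  have h3 := char_parseval q S
  have h4 : (q:ℝ) * ∑ ψ ∈ NC q, ‖∑ n ∈ range N, a n * ψ n‖ ^ 2 ≤
      (q - 1 : ℝ) * ∑ b ∈ univ.filter (fun b : ZMod q => b ≠ 0), ‖S b‖ ^ 2 := by
    rw [← h3, Finset.mul_sum]
    refine le_trans (le_of_eq (Finset.sum_congr rfl (fun ψ hψ => h1 ψ (mem_NC.mp hψ)))) ?_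
    exact Finset.sum_le_sum_of_subset_of_nonneg (Finset.subset_univ _) (fun _ _ _ => by positivity)
  rw [h2] at h4
  have h5 : 0 ≤ ∑ b ∈ Ioo 0 q, ‖∑ n ∈ range N, a n * ee (n * ((b:ℝ) / q))‖ ^ 2 :=
    Finset.sum_nonneg (fun _ _ => by positivity)
  nlinarith
end onemod

theorem mult_ls (Q : Finset ℕ) (hQ : ∀ q ∈ Q, q.Prime) (R : ℝ) (hR : 0 < R) (hQR : ∀ q ∈ Q, (q:ℝ) ≤ 2 * R)
    (N : ℕ) (a : ℕ → ℂ) :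
    ∑ q ∈ Q, ∑ ψ ∈ NC q, ‖∑ n ∈ range N, a n * ψ n‖ ^ 2 ≤
      8 * (N + 4 * R ^ 2 + 1) * ∑ n ∈ range N, ‖a n‖ ^ 2 := by
  calc _ ≤ ∑ q ∈ Q, ∑ b ∈ Ioo 0 q, ‖∑ n ∈ range N, a n * ee (n * ((b:ℝ) / q))‖ ^ 2 := by
        apply Finset.sum_le_sum
        intro q hq
        have : Fact q.Prime := ⟨hQ q hq⟩
        exact onemod q N a
    _ = ∑ x ∈ Q.sigma (fun q => Ioo 0 q), ‖∑ n ∈ range N, a n * ee (n * ((x.2:ℝ) / x.1))‖ ^ 2 := by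
        rw [Finset.sum_sigma]
    _ ≤ 8 * (N + 1 / (1 / (4 * R ^ 2)) + 1) * ∑ n ∈ range N, ‖a n‖ ^ 2 := by
        apply large_sieve (Q.sigma (fun q => Ioo 0 q)) (fun x : (_ : ℕ) × ℕ => (x.2:ℝ) / x.1) (by positivity)
        rintro ⟨q, b⟩ h1 ⟨q', b'⟩ h2 hne m
        simp only [Finset.mem_sigma, Finset.mem_Ioo] at h1 h2
        have hq := hQ q h1.1
        have hq' := hQ q' h2.1
        have l1 := hQR q h1.1
        have l2 := hQR q' h2.1
        have hq0 : (0:ℝ) < q := by exact_mod_cast hq.pos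
        have hq0' : (0:ℝ) < q' := by exact_mod_cast hq'.pos
        have e : (b:ℝ) / q - b' / q' - m = ((b * q' - b' * q - m * q * q' : ℤ) : ℝ) / (q * q') := by
          push_cast
          field_simp
        simp only
        rw [e, abs_div, abs_of_pos (by positivity : (0:ℝ) < q * q')]
        have hnz : (b * q' - b' * q - m * q * q' : ℤ) ≠ 0 := by
          intro h0
          by_cases hqq : q = q'
          · subst hqq
            have hbb : (b:ℤ) - b' = m * q := by
              have : (q:ℤ) * (b - b' - m * q) = 0 := by linear_combination h0
              rcases mul_eq_zero.mp this with h | h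
              · exact absurd h (by exact_mod_cast hq.ne_zero)
              · linarith
            apply hne
            have hm : m = 0 := by
              have hb1 : (b:ℤ) < q := by exact_mod_cast h1.2.2
              have hb2 : (b':ℤ) < q := by exact_mod_cast h2.2.2
              have hb3 : (0:ℤ) < b := by exact_mod_cast h1.2.1
              have hb4 : (0:ℤ) < b' := by exact_mod_cast h2.2.1
              by_contra hm
              rcases lt_or_gt_of_ne hm with h | h
              · nlinarith
              · nlinarith
            subst hm
            have : b = b' := by
              have : (b:ℤ) = b' := by linarith
              exact_mod_cast this
            subst this
            rfl
          · have hd : (q:ℤ) ∣ (b * q' : ℤ) := ⟨b' + m * q', by linear_combination h0⟩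
            have hd' : q ∣ b * q' := by exact_mod_cast hd
            rcases hq.dvd_mul.mp hd' with h | h
            · exact absurd (Nat.le_of_dvd h1.2.1 h) (by omega)
            · exact hqq ((Nat.prime_dvd_prime_iff_eq hq hq').mp h)
        have h1' : (1:ℝ) ≤ |((b * q' - b' * q - m * q * q' : ℤ) : ℝ)| := by
          rw [← Int.cast_abs]
          exact_mod_cast Int.one_le_abs hnz
        have : (q:ℝ) * q' ≤ 4 * R ^ 2 := by nlinarith
        gcongr
    _ = _ := by rw [one_div_one_div]

end LSL

namespace BVL
open Finset LSL

structure GoodChi (D : ℕ) (χ : ℕ → ℤ) : Prop where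
  pos : 0 < D
  mul : ∀ m n, χ (m * n) = χ m * χ n
  val : ∀ n, χ n = 0 ∨ χ n = 1 ∨ χ n = -1
  per : ∀ n, χ (n + D) = χ n

/-- twisted character -/
noncomputable def GG (χ : ℕ → ℤ) (q : ℕ) (ψ : DirichletCharacter ℂ q) (n : ℕ) : ℂ :=
  ψ (((n : ℤ) * χ n : ℤ) : ZMod q)

variable {D : ℕ} {χ : ℕ → ℤ}

lemma GG_mul (h : GoodChi D χ) (q : ℕ) (ψ : DirichletCharacter ℂ q) (m n : ℕ) :
    GG χ q ψ (m * n) = GG χ q ψ m * GG χ q ψ n := by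
  unfold GG
  rw [← map_mul, h.mul]
  congr 1
  push_cast
  ring

lemma GG_norm (q : ℕ) (ψ : DirichletCharacter ℂ q) (n : ℕ) : ‖GG χ q ψ n‖ ≤ 1 :=
  DirichletCharacter.norm_le_one ψ _

lemma GG_zero (q : ℕ) (hq : q.Prime) (ψ : DirichletCharacter ℂ q) : GG χ q ψ 0 = 0 := by
  have : Fact q.Prime := ⟨hq⟩
  unfold GG
  simp [MulChar.map_zero]

lemma per_mul (h : GoodChi D χ) (c j : ℕ) : χ (c + j * D) = χ c := by
  induction j with
  | zero => simp
  | succ j ih => rw [← ih, ← h.per (c + j * D)]; congr 1; ring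

lemma sum_range_zmod (q : ℕ) [Fact q.Prime] (f : ZMod q → ℂ) :
    ∑ j ∈ range q, f (j : ZMod q) = ∑ z : ZMod q, f z := by
  have hqp : q.Prime := Fact.out
  apply Finset.sum_bij' (fun (n : ℕ) _ => (n : ZMod q)) (fun (b : ZMod q) _ => b.val)
  · intro n hn; simp
  · intro b _; simpa using ZMod.val_lt b
  · intro n hn
    exact ZMod.val_cast_of_lt (by simpa using hn)
  · intro b _; simp
  · intro n _; rfl

lemma sum_inner (h : GoodChi D χ) (q : ℕ) (hq : q.Prime) (hqD : ¬ q ∣ D) (ψ : DirichletCharacter ℂ q)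
    (hψ : ψ ≠ 1) (c : ℕ) : ∑ j ∈ range q, GG χ q ψ (c + j * D) = 0 := by
  have : Fact q.Prime := ⟨hq⟩
  have hD : (D : ZMod q) ≠ 0 := by
    rwa [Ne, ZMod.natCast_eq_zero_iff]
  have e : ∀ j ∈ range q, GG χ q ψ (c + j * D) =
      (fun z : ZMod q => ψ ((c + z * D)) * ψ (χ c : ZMod q)) (j : ZMod q) := by
    intro j _
    simp only
    rw [GG, per_mul h, ← map_mul]
    congr 1
    push_cast
    ring
  rw [Finset.sum_congr rfl e, sum_range_zmod q (fun z : ZMod q => ψ ((c + z * D)) * ψ (χ c : ZMod q)),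
    ← Finset.sum_mul]
  have : ∑ z : ZMod q, ψ (c + z * D) = ∑ z : ZMod q, ψ z := by
    have hb : Function.Bijective (fun z : ZMod q => (c + z * D : ZMod q)) := by
      apply Function.Injective.bijective_of_finite
      intro a b hab
      simp only at hab
      exact mul_right_cancel₀ hD (add_left_cancel hab)
    exact Fintype.sum_bijective _ hb _ _ (fun _ => rfl)
  rw [this, MulChar.sum_eq_zero_of_ne_one hψ, zero_mul]

lemma sum_block (h : GoodChi D χ) (q : ℕ) (hq : q.Prime) (hqD : ¬ q ∣ D) (ψ : DirichletCharacter ℂ q)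
    (hψ : ψ ≠ 1) (c : ℕ) : ∑ n ∈ range (q * D), GG χ q ψ (c + n) = 0 := by
  have : ∑ n ∈ range (q * D), GG χ q ψ (c + n) =
      ∑ i ∈ range D, ∑ j ∈ range q, GG χ q ψ (c + i + j * D) := by
    rw [Finset.sum_comm, ← Finset.sum_product']
    symm
    apply Finset.sum_bij' (fun (p : ℕ × ℕ) _ => p.2 + p.1 * D) (fun n _ => (n / D, n % D))
    · rintro ⟨j, i⟩ hp
      simp only [mem_product, mem_range] at hp ⊢
      calc i + j * D < D + j * D := by omega
        _ = (j + 1) * D := by ring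
        _ ≤ q * D := Nat.mul_le_mul_right _ hp.1
    · intro n hn
      simp only [mem_product, mem_range] at hn ⊢
      exact ⟨Nat.div_lt_of_lt_mul (by rwa [mul_comm]), Nat.mod_lt _ h.pos⟩
    · rintro ⟨j, i⟩ hp
      simp only [mem_product, mem_range] at hp ⊢
      rw [Nat.add_mul_div_right _ _ h.pos, Nat.div_eq_of_lt hp.2, Nat.add_mul_mod_self_right,
        Nat.mod_eq_of_lt hp.2, zero_add]
    · intro n _
      simp only
      rw [mul_comm]
      exact Nat.mod_add_div n D
    · rintro ⟨j, i⟩ _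
      simp only [add_assoc]
  rw [this]
  exact Finset.sum_eq_zero (fun i _ => sum_inner h q hq hqD ψ hψ (c + i))

lemma sum_shift_le (h : GoodChi D χ) (q : ℕ) (hq : q.Prime) (hqD : ¬ q ∣ D) (ψ : DirichletCharacter ℂ q)
    (hψ : ψ ≠ 1) (y : ℕ) : ∀ c, ‖∑ n ∈ range y, GG χ q ψ (c + n)‖ ≤ q * D := by
  induction y using Nat.strong_induction_on with
  | _ y ih =>
    intro c
    by_cases hy : y < q * D
    · refine (norm_sum_le _ _).trans ?_
      refine (Finset.sum_le_card_nsmul _ _ 1 (fun n _ => GG_norm _ _ _)).trans ?_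
      simp only [card_range, nsmul_eq_mul, mul_one]
      exact_mod_cast hy.le
    · push Not at hy
      have hpos : 0 < q * D := Nat.mul_pos hq.pos h.pos
      obtain ⟨z, rfl⟩ := Nat.exists_eq_add_of_le hy
      rw [Finset.sum_range_add, sum_block h q hq hqD ψ hψ c, zero_add]
      simp_rw [← add_assoc]
      exact ih z (by omega) (c + q * D)

lemma sum_Ioc_le (h : GoodChi D χ) (q : ℕ) (hq : q.Prime) (hqD : ¬ q ∣ D) (ψ : DirichletCharacter ℂ q)
    (hψ : ψ ≠ 1) (a b : ℕ) : ‖∑ n ∈ Ioc a b, GG χ q ψ n‖ ≤ q * D := by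
  have : ∑ n ∈ Ioc a b, GG χ q ψ n = ∑ n ∈ range (b - a), GG χ q ψ (a + 1 + n) := by
    have hI : Ioc a b = Ico (a + 1) (b + 1) := by ext; simp
    rw [hI, Finset.sum_Ico_eq_sum_range]
    congr 2
    omega
  rw [this]
  exact sum_shift_le h q hq hqD ψ hψ _ _

lemma sum_log_Ioc_le (h : GoodChi D χ) (q : ℕ) (hq : q.Prime) (hqD : ¬ q ∣ D) (ψ : DirichletCharacter ℂ q)
    (hψ : ψ ≠ 1) (y : ℕ) : ‖∑ n ∈ Ioc 0 y, (Real.log n : ℂ) * GG χ q ψ n‖ ≤ 2 * (q * D) * Real.log y := by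
  have key : ∀ y : ℕ, ∑ n ∈ Ioc 0 y, (Real.log n : ℂ) * GG χ q ψ n =
      Real.log y * ∑ n ∈ Ioc 0 y, GG χ q ψ n -
        ∑ k ∈ Ico 1 y, ((Real.log (k + 1 : ℕ) - Real.log k : ℝ) : ℂ) * ∑ n ∈ Ioc 0 k, GG χ q ψ n := by
    intro y
    induction y with
    | zero => simp
    | succ y ih =>
      rcases Nat.eq_zero_or_pos y with rfl | hy
      · simp
      · rw [Finset.sum_Ioc_succ_top (Nat.zero_le y), ih, Finset.sum_Ioc_succ_top (Nat.zero_le y),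
          Finset.sum_Ico_succ_top hy]
        push_cast
        ring
  rw [key]
  have tele : ∀ y : ℕ, 1 ≤ y → ∑ k ∈ Ico 1 y, (Real.log (k + 1 : ℕ) - Real.log k) = Real.log y := by
    intro y hy
    induction y, hy using Nat.le_induction with
    | base => simp
    | succ y hy ih => rw [Finset.sum_Ico_succ_top hy, ih]; ring
  have hl : 0 ≤ Real.log y := Real.log_natCast_nonneg y
  have hmon : ∀ k ∈ Ico 1 y, 0 ≤ Real.log (k + 1 : ℕ) - Real.log k := by
    intro k hk
    have : 1 ≤ k := (Finset.mem_Ico.mp hk).1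
    have := Real.log_le_log (by exact_mod_cast this : (0:ℝ) < k) (by push_cast; linarith : (k:ℝ) ≤ ((k+1:ℕ):ℝ))
    linarith
  refine (norm_sub_le _ _).trans ?_
  have h1 : ‖(Real.log y : ℂ) * ∑ n ∈ Ioc 0 y, GG χ q ψ n‖ ≤ Real.log y * (q * D) := by
    rw [norm_mul, Complex.norm_real, Real.norm_of_nonneg hl]
    exact mul_le_mul_of_nonneg_left (sum_Ioc_le h q hq hqD ψ hψ _ _) hl
  have h2 : ‖∑ k ∈ Ico 1 y, ((Real.log (k + 1 : ℕ) - Real.log k : ℝ) : ℂ) * ∑ n ∈ Ioc 0 k, GG χ q ψ n‖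
      ≤ Real.log y * (q * D) := by
    refine (norm_sum_le _ _).trans ?_
    have : ∀ k ∈ Ico 1 y, ‖((Real.log (k + 1 : ℕ) - Real.log k : ℝ) : ℂ) * ∑ n ∈ Ioc 0 k, GG χ q ψ n‖ ≤
        (Real.log (k + 1 : ℕ) - Real.log k) * (q * D) := by
      intro k hk
      rw [norm_mul, Complex.norm_real, Real.norm_of_nonneg (hmon k hk)]
      exact mul_le_mul_of_nonneg_left (sum_Ioc_le h q hq hqD ψ hψ _ _) (hmon k hk)
    refine (Finset.sum_le_sum this).trans ?_
    rw [← Finset.sum_mul]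
    rcases Nat.eq_zero_or_pos y with rfl | hy
    · simp
    · rw [tele y hy]
  linarith

theorem GG_ls (h : GoodChi D χ) (Q : Finset ℕ) (hQ : ∀ q ∈ Q, q.Prime) (R : ℝ) (hR : 0 < R) (hQR : ∀ q ∈ Q, (q:ℝ) ≤ 2 * R)
    (N : ℕ) (a : ℕ → ℂ) :
    ∑ q ∈ Q, ∑ ψ ∈ NC q, ‖∑ n ∈ range N, a n * GG χ q ψ n‖ ^ 2 ≤
      16 * (N + 4 * R ^ 2 + 1) * ∑ n ∈ range N, ‖a n‖ ^ 2 := by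
  set a1 : ℕ → ℂ := fun n => if χ n = 1 then a n else 0 with ha1
  set a2 : ℕ → ℂ := fun n => if χ n = -1 then a n else 0 with ha2
  have hb1 := mult_ls Q hQ R hR hQR N a1
  have hb2 := mult_ls Q hQ R hR hQR N a2
  have hpt : ∀ q ∈ Q, ∀ ψ ∈ NC q, ‖∑ n ∈ range N, a n * GG χ q ψ n‖ ^ 2 ≤
      2 * ‖∑ n ∈ range N, a1 n * ψ n‖ ^ 2 + 2 * ‖∑ n ∈ range N, a2 n * ψ n‖ ^ 2 := by
    intro q hq ψ _
    have : Fact q.Prime := ⟨hQ q hq⟩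
    have e : ∑ n ∈ range N, a n * GG χ q ψ n =
        ∑ n ∈ range N, a1 n * ψ n + ψ (-1) * ∑ n ∈ range N, a2 n * ψ n := by
      rw [Finset.mul_sum, ← Finset.sum_add_distrib]
      apply Finset.sum_congr rfl
      intro n _
      unfold GG
      rcases h.val n with h0 | h0 | h0
      · simp [ha1, ha2, h0, MulChar.map_zero]
      · simp [ha1, ha2, h0]
      · have : ψ (-(n : ZMod q)) = ψ (-1) * ψ n := by rw [← map_mul]; congr 1; ring
        simp only [ha1, ha2, h0]
        norm_num
        rw [this]
        ring
    rw [e]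
    have n1 : ‖ψ (-1)‖ ≤ 1 := DirichletCharacter.norm_le_one ψ _
    set A := ∑ n ∈ range N, a1 n * ψ n
    set B := ∑ n ∈ range N, a2 n * ψ n
    have n2 : ‖A + ψ (-1) * B‖ ≤ ‖A‖ + ‖B‖ := by
      refine (norm_add_le _ _).trans ?_
      rw [norm_mul]
      nlinarith [norm_nonneg B]
    have := norm_nonneg (A + ψ (-1) * B)
    nlinarith [sq_nonneg (‖A‖ - ‖B‖)]
  have hsum : ∑ n ∈ range N, ‖a1 n‖ ^ 2 + ∑ n ∈ range N, ‖a2 n‖ ^ 2 ≤ ∑ n ∈ range N, ‖a n‖ ^ 2 := by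
    rw [← Finset.sum_add_distrib]
    apply Finset.sum_le_sum
    intro n _
    rcases h.val n with h0 | h0 | h0
    · simp [ha1, ha2, h0]
    · simp [ha1, ha2, h0]
    · simp [ha1, ha2, h0]
  calc _ ≤ ∑ q ∈ Q, ∑ ψ ∈ NC q, (2 * ‖∑ n ∈ range N, a1 n * ψ n‖ ^ 2 + 2 * ‖∑ n ∈ range N, a2 n * ψ n‖ ^ 2) :=
        Finset.sum_le_sum (fun q hq => Finset.sum_le_sum (hpt q hq))
    _ = 2 * ∑ q ∈ Q, ∑ ψ ∈ NC q, ‖∑ n ∈ range N, a1 n * ψ n‖ ^ 2 + 2 * ∑ q ∈ Q, ∑ ψ ∈ NC q, ‖∑ n ∈ range N, a2 n * ψ n‖ ^ 2 := by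
        simp_rw [Finset.sum_add_distrib, Finset.mul_sum]
    _ ≤ 2 * (8 * (N + 4 * R ^ 2 + 1) * ∑ n ∈ range N, ‖a1 n‖ ^ 2) + 2 * (8 * (N + 4 * R ^ 2 + 1) * ∑ n ∈ range N, ‖a2 n‖ ^ 2) := by linarith
    _ = 16 * (N + 4 * R ^ 2 + 1) * (∑ n ∈ range N, ‖a1 n‖ ^ 2 + ∑ n ∈ range N, ‖a2 n‖ ^ 2) := by ring
    _ ≤ _ := by gcongr

end BVL

namespace BVL
open Finset LSL

lemma orth (N n j : ℕ) (hn : n < N) (hj : j < N) :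
    ∑ h ∈ range N, ee ((h:ℝ) * (((n:ℝ) - j) / N)) = if n = j then (N:ℂ) else 0 := by
  have hN : (0:ℝ) < N := by exact_mod_cast (by omega : 0 < N)
  simp_rw [ee_nat_mul]
  split_ifs with hnj
  · subst hnj
    simp [ee_zero]
  · have hr : ee (((n:ℝ) - j) / N) ≠ 1 := by
      intro h1
      unfold ee at h1
      rw [Complex.exp_eq_one_iff] at h1
      obtain ⟨k, hk⟩ := h1
      have hpi : (2 * (Real.pi : ℂ) * Complex.I) ≠ 0 := by simp [Real.pi_ne_zero]
      have h2 : (((((n:ℝ) - j) / N) : ℝ) : ℂ) = ((k : ℝ) : ℂ) := by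
        apply mul_right_cancel₀ hpi
        rw [Complex.ofReal_intCast, ← hk]
        push_cast
        ring
      have h3 : ((n:ℝ) - j) / N = k := by exact_mod_cast h2
      rw [div_eq_iff hN.ne'] at h3
      have h4 : (n:ℤ) - j = k * N := by exact_mod_cast h3
      have hk0 : k = 0 := by
        by_contra hk0
        have hn' : (n:ℤ) < N := by exact_mod_cast hn
        have hj' : (j:ℤ) < N := by exact_mod_cast hj
        rcases lt_or_gt_of_ne hk0 with h | h
        · nlinarith
        · nlinarith
      subst hk0
      omega
    rw [geom_sum_eq hr, ← ee_nat_mul]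
    have : (N:ℝ) * (((n:ℝ) - j) / N) = ((n - j : ℤ) : ℝ) := by
      push_cast; field_simp
    rw [this, ee_int]
    simp

/-- separation coefficients -/
noncomputable def cc (N h y : ℕ) : ℂ := (1 / N : ℂ) * ∑ j ∈ range (y + 1), ee (-((j:ℝ) * ((h:ℝ) / N)))

noncomputable def ww (N h : ℕ) : ℝ := if h = 0 then 1 else (1 / (h:ℝ) + 1 / ((N:ℝ) - h)) / 2

lemma ww_nonneg {N h : ℕ} (hh : h < N) : 0 ≤ ww N h := by
  unfold ww
  have : (h:ℝ) < N := by exact_mod_cast hh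
  have : 0 < (N:ℝ) - h := by linarith
  split_ifs <;> positivity

lemma cc_sep (N n y : ℕ) (hn : n < N) (hy : y < N) :
    ∑ h ∈ range N, cc N h y * ee ((h:ℝ) * n / N) = if n ≤ y then 1 else 0 := by
  have hN : (N:ℂ) ≠ 0 := by exact_mod_cast (by omega : N ≠ 0)
  unfold cc
  have e : ∀ h ∈ range N, ((1 / N : ℂ) * ∑ j ∈ range (y + 1), ee (-((j:ℝ) * ((h:ℝ) / N)))) * ee ((h:ℝ) * n / N)
      = (1 / N : ℂ) * ∑ j ∈ range (y + 1), ee ((h:ℝ) * (((n:ℝ) - j) / N)) := by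
    intro h _
    rw [mul_assoc, Finset.sum_mul]
    congr 1
    apply Finset.sum_congr rfl
    intro j _
    rw [← ee_add]
    congr 1
    ring
  rw [Finset.sum_congr rfl e, ← Finset.mul_sum, Finset.sum_comm]
  rw [Finset.sum_congr rfl (fun j hj => orth N n j hn (by have := Finset.mem_range.mp hj; omega))]
  rw [Finset.sum_ite_eq]
  by_cases h : n ≤ y
  · rw [if_pos (by simp; omega), if_pos h]
    field_simp
  · rw [if_neg (by simp; omega), if_neg h, mul_zero]

lemma cc_le (N h y : ℕ) (hh : h < N) (hy : y < N) : ‖cc N h y‖ ≤ ww N h := by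
  have hN : (0:ℝ) < N := by exact_mod_cast (by omega : 0 < N)
  unfold cc ww
  rw [norm_mul]
  have hn : ‖(1 / N : ℂ)‖ = 1 / N := by simp
  rw [hn]
  split_ifs with h0
  · subst h0
    have : ‖∑ j ∈ range (y + 1), ee (-((j:ℝ) * (((0:ℕ):ℝ) / N)))‖ ≤ N := by
      refine (norm_sum_le _ _).trans ?_
      simp only [ee_norm]
      simp
      exact_mod_cast hy
    calc _ ≤ 1 / (N:ℝ) * N := by gcongr
      _ = 1 := by field_simp
  · have hh' : (h:ℝ) < N := by exact_mod_cast hh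
    have hp : (0:ℝ) < h := by exact_mod_cast Nat.pos_of_ne_zero h0
    have hθ0 : 0 < (h:ℝ) / N := by positivity
    have hθ1 : (h:ℝ) / N < 1 := by rw [div_lt_one hN]; exact hh'
    have e : ‖∑ j ∈ range (y + 1), ee (-((j:ℝ) * ((h:ℝ) / N)))‖ = ‖∑ j ∈ range (y + 1), ee (((j:ℝ) * ((h:ℝ) / N)))‖ := by
      rw [← Complex.norm_conj (∑ j ∈ range (y + 1), ee (((j:ℝ) * ((h:ℝ) / N)))), map_sum]
      simp_rw [ee_conj]
    rw [e]
    have hg := geom_le (y + 1) hθ0 hθ1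
    have hNh : 0 < (N:ℝ) - h := by linarith
    have hm : 1 / (2 * min ((h:ℝ) / N) (1 - h / N)) ≤ N * ((1 / (h:ℝ) + 1 / ((N:ℝ) - h)) / 2) := by
      have e1 : 1 - (h:ℝ) / N = (N - h) / N := by field_simp
      rw [e1]
      have p1 : (0:ℝ) < 1 / h := by positivity
      have p2 : (0:ℝ) < 1 / (N - h) := by positivity
      rcases min_choice ((h:ℝ) / N) ((N - h) / N) with h' | h'
      · rw [h']
        have : 1 / (2 * ((h:ℝ) / N)) = N * (1 / h / 2) := by field_simp
        rw [this]
        gcongr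
        linarith
      · rw [h']
        have : 1 / (2 * (((N:ℝ) - h) / N)) = N * (1 / (N - h) / 2) := by field_simp
        rw [this]
        gcongr
        linarith
    calc _ ≤ 1 / (N:ℝ) * (N * ((1 / (h:ℝ) + 1 / ((N:ℝ) - h)) / 2)) := by
          gcongr
          exact hg.trans hm
      _ = _ := by field_simp

lemma sum_inv_le (N : ℕ) : ∑ h ∈ range N, (1 / ((h + 1 : ℕ) : ℝ)) ≤ 1 + Real.log N := by
  have := harmonic_le_one_add_log N
  unfold harmonic at this
  push_cast at this
  simpa using this

lemma ww_sum (N : ℕ) (hN : 0 < N) : ∑ h ∈ range N, ww N h ≤ 2 + Real.log N := by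
  obtain ⟨K, rfl⟩ : ∃ K, N = K + 1 := ⟨N - 1, by omega⟩
  rw [Finset.sum_range_succ']
  have e0 : ww (K + 1) 0 = 1 := by simp [ww]
  have e1 : ∀ h ∈ range K, ww (K + 1) (h + 1) = (1 / ((h + 1 : ℕ) : ℝ)) / 2 + (1 / (((K - 1 - h) + 1 : ℕ) : ℝ)) / 2 := by
    intro h hh
    have := Finset.mem_range.mp hh
    unfold ww
    rw [if_neg (by omega), add_div]
    congr 3
    have : (K - 1 - h) + 1 = K - h := by omega
    rw [this, Nat.cast_sub (by omega)]
    push_cast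
    ring
  rw [e0, Finset.sum_congr rfl e1, Finset.sum_add_distrib,
    Finset.sum_range_reflect (fun j => (1 / ((j + 1 : ℕ) : ℝ)) / 2) K, ← Finset.sum_div]
  have := sum_inv_le K
  have hl : Real.log K ≤ Real.log ((K + 1 : ℕ) : ℝ) := by
    rcases Nat.eq_zero_or_pos K with rfl | hK
    · simp
    · apply Real.log_le_log (by exact_mod_cast hK)
      push_cast; linarith
  linarith

variable {D : ℕ} {χ : ℕ → ℤ}

theorem bilinear (h : GoodChi D χ) (Q : Finset ℕ) (hQ : ∀ q ∈ Q, q.Prime) (R : ℝ) (hR : 0 < R) (hQR : ∀ q ∈ Q, (q:ℝ) ≤ 2 * R)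
    (M N : ℕ) (hN : 0 < N) (α β : ℕ → ℂ) (y : ℕ → ℕ) (hy : ∀ m < M, y m < N) :
    ∑ q ∈ Q, ∑ ψ ∈ NC q, ‖∑ m ∈ range M, α m * GG χ q ψ m * ∑ n ∈ range (y m + 1), β n * GG χ q ψ n‖ ≤
      16 * (2 + Real.log N) * (√(M + 4 * R ^ 2 + 1) * √(N + 4 * R ^ 2 + 1)) *
        (√(∑ m ∈ range M, ‖α m‖ ^ 2) * √(∑ n ∈ range N, ‖β n‖ ^ 2)) := by
  set AA : ℕ → (q : ℕ) → DirichletCharacter ℂ q → ℂ :=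
    fun k q ψ => ∑ m ∈ range M, (α m * cc N k (y m)) * GG χ q ψ m with hAA
  set BB : ℕ → (q : ℕ) → DirichletCharacter ℂ q → ℂ :=
    fun k q ψ => ∑ n ∈ range N, (β n * ee ((k:ℝ) * n / N)) * GG χ q ψ n with hBB
  have e1 : ∀ q (ψ : DirichletCharacter ℂ q), ∑ m ∈ range M, α m * GG χ q ψ m * ∑ n ∈ range (y m + 1), β n * GG χ q ψ n =
      ∑ k ∈ range N, AA k q ψ * BB k q ψ := by
    intro q ψ
    simp only [hAA, Finset.sum_mul]
    rw [Finset.sum_comm]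
    apply Finset.sum_congr rfl
    intro m hm
    have hym := hy m (Finset.mem_range.mp hm)
    have : ∑ n ∈ range (y m + 1), β n * GG χ q ψ n = ∑ k ∈ range N, cc N k (y m) * BB k q ψ := by
      simp only [hBB, Finset.mul_sum]
      rw [Finset.sum_comm]
      have e2 : ∀ n ∈ range N, ∑ k ∈ range N, cc N k (y m) * ((β n * ee ((k:ℝ) * n / N)) * GG χ q ψ n) =
          if n ≤ y m then β n * GG χ q ψ n else 0 := by
        intro n hn
        have := cc_sep N n (y m) (Finset.mem_range.mp hn) hym
        calc _ = (∑ k ∈ range N, cc N k (y m) * ee ((k:ℝ) * n / N)) * (β n * GG χ q ψ n) := by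
              rw [Finset.sum_mul]; apply Finset.sum_congr rfl; intro k _; ring
          _ = _ := by rw [this]; split_ifs <;> simp
      rw [Finset.sum_congr rfl e2, ← Finset.sum_filter]
      apply Finset.sum_congr _ (fun _ _ => rfl)
      ext n
      simp only [Finset.mem_range, Finset.mem_filter]
      omega
    rw [this, Finset.mul_sum]
    apply Finset.sum_congr rfl
    intro k _
    ring
  have hAk : ∀ k ∈ range N, ∑ q ∈ Q, ∑ ψ ∈ NC q, ‖AA k q ψ‖ ^ 2 ≤
      ww N k ^ 2 * (16 * (M + 4 * R ^ 2 + 1) * ∑ m ∈ range M, ‖α m‖ ^ 2) := by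
    intro k hk
    refine (GG_ls h Q hQ R hR hQR M _).trans ?_
    have : ∑ m ∈ range M, ‖α m * cc N k (y m)‖ ^ 2 ≤ ww N k ^ 2 * ∑ m ∈ range M, ‖α m‖ ^ 2 := by
      rw [Finset.mul_sum]
      apply Finset.sum_le_sum
      intro m hm
      rw [norm_mul, mul_pow, mul_comm]
      have := cc_le N k (y m) (Finset.mem_range.mp hk) (hy m (Finset.mem_range.mp hm))
      gcongr
    calc _ ≤ 16 * (M + 4 * R ^ 2 + 1) * (ww N k ^ 2 * ∑ m ∈ range M, ‖α m‖ ^ 2) := by gcongr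
      _ = _ := by ring
  have hBk : ∀ k, ∑ q ∈ Q, ∑ ψ ∈ NC q, ‖BB k q ψ‖ ^ 2 ≤
      (16 * (N + 4 * R ^ 2 + 1) * ∑ n ∈ range N, ‖β n‖ ^ 2) := by
    intro k
    refine (GG_ls h Q hQ R hR hQR N _).trans ?_
    simp only [norm_mul, ee_norm, mul_one]
    exact le_rfl
  set SA := ∑ m ∈ range M, ‖α m‖ ^ 2
  set SB := ∑ n ∈ range N, ‖β n‖ ^ 2
  have hSA : 0 ≤ SA := Finset.sum_nonneg (fun _ _ => by positivity)
  have hSB : 0 ≤ SB := Finset.sum_nonneg (fun _ _ => by positivity)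
  have hk : ∀ k ∈ range N, ∑ q ∈ Q, ∑ ψ ∈ NC q, ‖AA k q ψ‖ * ‖BB k q ψ‖ ≤
      ww N k * (16 * (√(M + 4 * R ^ 2 + 1) * √(N + 4 * R ^ 2 + 1)) * (√SA * √SB)) := by
    intro k hk
    have hw := ww_nonneg (Finset.mem_range.mp hk)
    have c1 : ∑ q ∈ Q, ∑ ψ ∈ NC q, ‖AA k q ψ‖ * ‖BB k q ψ‖ ≤
        √(∑ q ∈ Q, ∑ ψ ∈ NC q, ‖AA k q ψ‖ ^ 2) * √(∑ q ∈ Q, ∑ ψ ∈ NC q, ‖BB k q ψ‖ ^ 2) := by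
      have := Real.sum_mul_le_sqrt_mul_sqrt (Q.sigma (fun q => NC q)) (fun x => ‖AA k x.1 x.2‖) (fun x => ‖BB k x.1 x.2‖)
      simpa only [Finset.sum_sigma] using this
    refine c1.trans ?_
    calc _ ≤ √(ww N k ^ 2 * (16 * (M + 4 * R ^ 2 + 1) * SA)) * √(16 * (N + 4 * R ^ 2 + 1) * SB) := by
          gcongr
          · exact hAk k hk
          · exact hBk k
      _ = _ := by
          have s16 : √(16:ℝ) = 4 := by
            rw [show (16:ℝ) = 4 ^ 2 by norm_num]; exact Real.sqrt_sq (by norm_num)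
          rw [Real.sqrt_mul (by positivity), Real.sqrt_sq hw, Real.sqrt_mul (by positivity),
            Real.sqrt_mul (by norm_num), Real.sqrt_mul (by positivity), Real.sqrt_mul (by norm_num), s16]
          ring
  calc _ ≤ ∑ q ∈ Q, ∑ ψ ∈ NC q, ∑ k ∈ range N, ‖AA k q ψ‖ * ‖BB k q ψ‖ := by
        apply Finset.sum_le_sum
        intro q _
        apply Finset.sum_le_sum
        intro ψ _
        rw [e1]
        refine (norm_sum_le _ _).trans ?_
        simp_rw [norm_mul]
        exact le_rfl
    _ = ∑ k ∈ range N, ∑ q ∈ Q, ∑ ψ ∈ NC q, ‖AA k q ψ‖ * ‖BB k q ψ‖ := by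
        rw [Finset.sum_comm]
        conv_rhs => rw [Finset.sum_comm]
        rw [Finset.sum_comm]
        apply Finset.sum_congr rfl
        intro q _
        rw [Finset.sum_comm]
    _ ≤ ∑ k ∈ range N, ww N k * (16 * (√(M + 4 * R ^ 2 + 1) * √(N + 4 * R ^ 2 + 1)) * (√SA * √SB)) :=
        Finset.sum_le_sum hk
    _ ≤ (2 + Real.log N) * (16 * (√(M + 4 * R ^ 2 + 1) * √(N + 4 * R ^ 2 + 1)) * (√SA * √SB)) := by
        rw [← Finset.sum_mul]
        gcongr
        exact ww_sum N hN
    _ = _ := by ring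

end BVL

namespace BVL
open Finset LSL ArithmeticFunction

lemma dconv {E : Type*} [AddCommMonoid E] (N : ℕ) (g : ℕ → ℕ → E) :
    ∑ n ∈ Ioc 0 N, ∑ x ∈ n.divisorsAntidiagonal, g x.1 x.2 =
      ∑ d ∈ Ioc 0 N, ∑ k ∈ Ioc 0 (N / d), g d k := by
  trans ∑ n ∈ Ioc 0 N, ∑ x ∈ Ioc 0 N ×ˢ Ioc 0 N with x.1 * x.2 = n, g x.1 x.2
  · refine sum_congr rfl fun n hn ↦ ?_
    simp only [mem_Ioc] at hn
    rw [Nat.divisorsAntidiagonal_eq_prod_filter_of_le hn.1.ne' hn.2]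
  trans ∑ x ∈ Ioc 0 N ×ˢ Ioc 0 N with x.1 * x.2 ≤ N, g x.1 x.2
  · simp_rw [sum_filter]
    rw [sum_comm]
    exact sum_congr rfl fun _ _ ↦ (by simp_all)
  rw [sum_filter, sum_product]
  refine sum_congr rfl fun n hn ↦ ?_
  rw [← sum_filter]
  apply sum_congr _ (fun _ _ => rfl)
  ext m
  simp only [mem_filter, mem_Ioc] at hn ⊢
  constructor
  · rintro ⟨⟨h1, _⟩, h⟩
    exact ⟨h1, (Nat.le_div_iff_mul_le hn.1).mpr (by rwa [mul_comm])⟩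
  · rintro ⟨h1, h⟩
    refine ⟨⟨h1, h.trans (Nat.div_le_self _ _)⟩, ?_⟩
    rw [mul_comm]
    exact (Nat.le_div_iff_mul_le hn.1).mp h

lemma tau_conv (N : ℕ) (f : ℕ → ℝ) :
    ∑ n ∈ Ioc 0 N, (n.divisors.card : ℝ) * f n = ∑ d ∈ Ioc 0 N, ∑ k ∈ Ioc 0 (N / d), f (d * k) := by
  rw [← dconv N (fun d k => f (d * k))]
  apply sum_congr rfl
  intro n _
  have : ∀ x ∈ n.divisorsAntidiagonal, f (x.1 * x.2) = f n := by
    intro x hx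
    rw [(Nat.mem_divisorsAntidiagonal.mp hx).1]
  rw [sum_congr rfl this, sum_const, nsmul_eq_mul]
  congr 2
  rw [← Nat.map_div_right_divisors]
  simp

lemma H_le (N : ℕ) : ∑ n ∈ Ioc 0 N, (1 / (n:ℝ)) ≤ 1 + Real.log N := by
  have := sum_inv_le N
  have hI : Ioc 0 N = Ico 1 (N + 1) := by ext; simp; omega
  rw [hI, Finset.sum_Ico_eq_sum_range]
  simpa [add_comm] using this

lemma log_mono_nat {m n : ℕ} (h : m ≤ n) : Real.log m ≤ Real.log n := by
  rcases Nat.eq_zero_or_pos m with rfl | hm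
  · simpa using Real.log_natCast_nonneg n
  · exact Real.log_le_log (by exact_mod_cast hm) (by exact_mod_cast h)

lemma tau_sum (N : ℕ) : ∑ n ∈ Ioc 0 N, (n.divisors.card : ℝ) ≤ N * (1 + Real.log N) := by
  have h := tau_conv N (fun _ => 1)
  simp only [mul_one] at h
  rw [h]
  calc _ ≤ ∑ d ∈ Ioc 0 N, (N:ℝ) * (1 / d) := by
        apply sum_le_sum
        intro d _
        simp only [sum_const, Nat.card_Ioc, Nat.sub_zero, nsmul_eq_mul, mul_one]
        rw [mul_one_div]
        exact Nat.cast_div_le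
    _ = N * ∑ d ∈ Ioc 0 N, (1 / (d:ℝ)) := by rw [mul_sum]
    _ ≤ _ := by gcongr; exact H_le N

lemma tau_sum_div (N : ℕ) : ∑ n ∈ Ioc 0 N, (n.divisors.card : ℝ) * (1 / (n:ℝ)) ≤ (1 + Real.log N) ^ 2 := by
  rw [tau_conv N (fun n => 1 / (n:ℝ))]
  have hL : 0 ≤ Real.log N := Real.log_natCast_nonneg N
  calc _ ≤ ∑ d ∈ Ioc 0 N, (1 / (d:ℝ)) * (1 + Real.log N) := by
        apply sum_le_sum
        intro d _
        have : ∑ k ∈ Ioc 0 (N / d), (1 / ((d * k : ℕ):ℝ)) = (1 / (d:ℝ)) * ∑ k ∈ Ioc 0 (N / d), (1 / (k:ℝ)) := by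
          rw [mul_sum]
          apply sum_congr rfl
          intro k _
          push_cast
          rw [one_div_mul_one_div]
        rw [this]
        gcongr
        refine (H_le _).trans ?_
        have := log_mono_nat (Nat.div_le_self N d)
        linarith
    _ = (∑ d ∈ Ioc 0 N, (1 / (d:ℝ))) * (1 + Real.log N) := by rw [sum_mul]
    _ ≤ (1 + Real.log N) * (1 + Real.log N) := by gcongr; exact H_le N
    _ = _ := by ring

open scoped Pointwise in
lemma tau_mul_le (m n : ℕ) : ((m * n).divisors.card : ℝ) ≤ m.divisors.card * n.divisors.card := by
  rw [Nat.divisors_mul]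
  exact_mod_cast Finset.card_mul_le

lemma tau_sq (N : ℕ) : ∑ n ∈ Ioc 0 N, (n.divisors.card : ℝ) ^ 2 ≤ N * (1 + Real.log N) ^ 3 := by
  have h := tau_conv N (fun n => (n.divisors.card : ℝ))
  simp_rw [← sq] at h
  rw [h]
  have hL : 0 ≤ Real.log N := Real.log_natCast_nonneg N
  calc _ ≤ ∑ d ∈ Ioc 0 N, (N * (1 + Real.log N)) * ((d.divisors.card : ℝ) * (1 / (d:ℝ))) := by
        apply sum_le_sum
        intro d _
        calc _ ≤ ∑ k ∈ Ioc 0 (N / d), (d.divisors.card : ℝ) * k.divisors.card := sum_le_sum (fun k _ => tau_mul_le d k)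
          _ = (d.divisors.card : ℝ) * ∑ k ∈ Ioc 0 (N / d), (k.divisors.card : ℝ) := by rw [mul_sum]
          _ ≤ (d.divisors.card : ℝ) * (((N:ℝ) / d) * (1 + Real.log N)) := by
              gcongr
              refine (tau_sum _).trans ?_
              have := log_mono_nat (Nat.div_le_self N d)
              have h2 : ((N / d : ℕ) : ℝ) ≤ (N:ℝ) / d := Nat.cast_div_le
              have h3 : 0 ≤ Real.log ((N / d : ℕ) : ℝ) := Real.log_natCast_nonneg _
              gcongr
          _ = _ := by ring
    _ = (N * (1 + Real.log N)) * ∑ d ∈ Ioc 0 N, ((d.divisors.card : ℝ) * (1 / (d:ℝ))) := by rw [mul_sum]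
    _ ≤ (N * (1 + Real.log N)) * (1 + Real.log N) ^ 2 := by gcongr; exact tau_sum_div N
    _ = _ := by ring

/-- truncations -/
noncomputable def lo (U : ℕ) (f : ArithmeticFunction ℝ) : ArithmeticFunction ℝ :=
  ⟨fun n => if n ≤ U then f n else 0, by simp⟩
noncomputable def hi (U : ℕ) (f : ArithmeticFunction ℝ) : ArithmeticFunction ℝ :=
  ⟨fun n => if n ≤ U then 0 else f n, by simp⟩

lemma lo_apply (U : ℕ) (f : ArithmeticFunction ℝ) (n : ℕ) : lo U f n = if n ≤ U then f n else 0 := rfl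
lemma hi_apply (U : ℕ) (f : ArithmeticFunction ℝ) (n : ℕ) : hi U f n = if n ≤ U then 0 else f n := rfl

lemma lo_add_hi (U : ℕ) (f : ArithmeticFunction ℝ) : f = lo U f + hi U f := by
  ext n
  rw [ArithmeticFunction.add_apply, lo_apply, hi_apply]
  split_ifs <;> simp

/-- real Moebius -/
noncomputable def mu' : ArithmeticFunction ℝ := ((moebius : ArithmeticFunction ℤ) : ArithmeticFunction ℝ)
noncomputable def ze' : ArithmeticFunction ℝ := ((zeta : ArithmeticFunction ℕ) : ArithmeticFunction ℝ)

lemma mu'_abs (n : ℕ) : |mu' n| ≤ 1 := by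
  unfold mu'
  rw [intCoe_apply, ← Int.cast_abs]
  exact_mod_cast abs_moebius_le_one

lemma vaughan (U : ℕ) : vonMangoldt = lo U vonMangoldt + lo U mu' * ArithmeticFunction.log
    - lo U mu' * (lo U vonMangoldt * ze') + hi U vonMangoldt * (hi U mu' * ze') := by
  have h1 := lo_add_hi U mu'
  have h2 := lo_add_hi U vonMangoldt
  have h3 : ze' * mu' = 1 := coe_zeta_mul_coe_moebius
  have h4 : vonMangoldt * ze' = ArithmeticFunction.log := vonMangoldt_mul_zeta
  linear_combination (1 : ArithmeticFunction ℝ) * h2 - hi U vonMangoldt * h3 + hi U vonMangoldt * ze' * h1 + lo U mu' * h4 - lo U mu' * ze' * h2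

variable {D : ℕ} {χ : ℕ → ℤ}

/-- twisted sum -/
noncomputable def SS (χ : ℕ → ℤ) (q : ℕ) (ψ : DirichletCharacter ℂ q) (f : ArithmeticFunction ℝ) (X : ℕ) : ℂ :=
  ∑ n ∈ Ioc 0 X, (f n : ℂ) * GG χ q ψ n

lemma SS_add (q : ℕ) (ψ : DirichletCharacter ℂ q) (f g : ArithmeticFunction ℝ) (X : ℕ) :
    SS χ q ψ (f + g) X = SS χ q ψ f X + SS χ q ψ g X := by
  unfold SS
  rw [← sum_add_distrib]
  apply sum_congr rfl
  intro n _
  rw [ArithmeticFunction.add_apply]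
  push_cast
  ring

lemma SS_sub (q : ℕ) (ψ : DirichletCharacter ℂ q) (f g : ArithmeticFunction ℝ) (X : ℕ) :
    SS χ q ψ (f - g) X = SS χ q ψ f X - SS χ q ψ g X := by
  have := SS_add (χ := χ) q ψ (f - g) g X
  rw [sub_add_cancel] at this
  rw [this]; ring

lemma SS_mul (h : GoodChi D χ) (q : ℕ) (ψ : DirichletCharacter ℂ q) (f g : ArithmeticFunction ℝ) (X : ℕ) :
    SS χ q ψ (f * g) X = ∑ n ∈ Ioc 0 X, (f n : ℂ) * GG χ q ψ n * SS χ q ψ g (X / n) := by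
  unfold SS
  simp_rw [mul_sum]
  rw [← dconv X (fun d k => (f d : ℂ) * GG χ q ψ d * ((g k : ℂ) * GG χ q ψ k))]
  apply sum_congr rfl
  intro n _
  rw [ArithmeticFunction.mul_apply]
  push_cast
  rw [sum_mul]
  apply sum_congr rfl
  intro x hx
  rw [← (Nat.mem_divisorsAntidiagonal.mp hx).1, GG_mul h]
  ring

lemma SS_lo_mul (h : GoodChi D χ) (q : ℕ) (ψ : DirichletCharacter ℂ q) (U : ℕ) (f g : ArithmeticFunction ℝ) (X : ℕ)
    (B : ℝ) (hB0 : 0 ≤ B) (hB : ∀ Y ≤ X, ‖SS χ q ψ g Y‖ ≤ B) :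
    ‖SS χ q ψ (lo U f * g) X‖ ≤ (∑ n ∈ Ioc 0 U, |f n|) * B := by
  rw [SS_mul h]
  refine (norm_sum_le _ _).trans ?_
  calc _ ≤ ∑ n ∈ Ioc 0 X, |lo U f n| * B := by
        apply sum_le_sum
        intro n _
        rw [norm_mul, norm_mul, Complex.norm_real, Real.norm_eq_abs]
        have h1 := GG_norm (χ := χ) q ψ n
        have h2 := hB (X / n) (Nat.div_le_self _ _)
        calc _ ≤ |lo U f n| * 1 * B := by gcongr
          _ = _ := by ring
    _ = (∑ n ∈ Ioc 0 X, |lo U f n|) * B := by rw [sum_mul]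
    _ ≤ _ := by
        gcongr
        calc _ = ∑ n ∈ (Ioc 0 X).filter (fun n => n ≤ U), |f n| := by
              rw [sum_filter]
              apply sum_congr rfl
              intro n _
              rw [lo_apply]
              split_ifs <;> simp
          _ ≤ _ := by
              apply sum_le_sum_of_subset_of_nonneg
              · intro n hn
                simp only [mem_filter, mem_Ioc] at hn ⊢
                exact ⟨hn.1.1, hn.2⟩
              · intros; positivity

lemma psi_le6 (U : ℕ) : ∑ n ∈ Ioc 0 U, vonMangoldt n ≤ 6 * U := by
  have h := Chebyshev.psi_le_const_mul_self (x := (U:ℝ)) (by positivity)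
  unfold Chebyshev.psi at h
  rw [Nat.floor_natCast] at h
  have h4 : Real.log 4 ≤ 2 := by
    rw [show (4:ℝ) = 2 ^ 2 by norm_num, Real.log_pow]
    have := Real.log_two_lt_d9
    push_cast; linarith
  have : (0:ℝ) ≤ U := by positivity
  nlinarith

lemma typeI (h : GoodChi D χ) (q : ℕ) (hq : q.Prime) (hqD : ¬ q ∣ D) (ψ : DirichletCharacter ℂ q)
    (hψ : ψ ≠ 1) (U X : ℕ) (hX : 3 ≤ X) (hU : 1 ≤ U) :
    ‖SS χ q ψ vonMangoldt X‖ ≤ 14 * (q * D * U ^ 2) * Real.log X +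
      ‖SS χ q ψ (hi U vonMangoldt * (hi U mu' * ze')) X‖ := by
  have hL : 1 ≤ Real.log X := by
    rw [Real.le_log_iff_exp_le (by positivity)]
    have := Real.exp_one_lt_d9
    have : (3:ℝ) ≤ X := by exact_mod_cast hX
    linarith
  have hP := psi_le6 U
  have hP' : ∑ n ∈ Ioc 0 U, |vonMangoldt n| ≤ 6 * U := by
    refine le_trans (le_of_eq ?_) hP
    exact sum_congr rfl (fun n _ => abs_of_nonneg vonMangoldt_nonneg)
  have hM : ∑ n ∈ Ioc 0 U, |mu' n| ≤ U := by
    refine (sum_le_card_nsmul _ _ 1 (fun n _ => mu'_abs n)).trans ?_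
    simp
  have hqr : (1:ℝ) ≤ q := by exact_mod_cast hq.one_le
  have hDr : (1:ℝ) ≤ D := by exact_mod_cast h.pos
  have hUr : (1:ℝ) ≤ U := by exact_mod_cast hU
  have b0 : ‖SS χ q ψ (lo U vonMangoldt) X‖ ≤ 6 * U := by
    refine le_trans ?_ hP'
    unfold SS
    refine (norm_sum_le _ _).trans ?_
    calc _ ≤ ∑ n ∈ (Ioc 0 X).filter (fun n => n ≤ U), |vonMangoldt n| := by
          rw [sum_filter]
          apply sum_le_sum
          intro n _
          rw [lo_apply, norm_mul]
          have h1 := GG_norm (χ := χ) q ψ n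
          split_ifs
          · rw [Complex.norm_real, Real.norm_eq_abs]
            nlinarith [abs_nonneg (vonMangoldt n)]
          · simp
      _ ≤ _ := by
          apply sum_le_sum_of_subset_of_nonneg
          · intro n hn
            simp only [mem_filter, mem_Ioc] at hn ⊢
            exact ⟨hn.1.1, hn.2⟩
          · intros; positivity
  have b1 : ‖SS χ q ψ (lo U mu' * ArithmeticFunction.log) X‖ ≤ U * (2 * (q * D) * Real.log X) := by
    refine (SS_lo_mul h q ψ U mu' _ X (2 * (q * D) * Real.log X) (by positivity) ?_).trans ?_
    · intro Y hY
      refine (sum_log_Ioc_le h q hq hqD ψ hψ Y).trans ?_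
      have := log_mono_nat hY
      gcongr
    · gcongr
  have bz : ∀ Y, ‖SS χ q ψ ze' Y‖ ≤ q * D := by
    intro Y
    refine le_trans (le_of_eq ?_) (sum_Ioc_le h q hq hqD ψ hψ 0 Y)
    unfold SS
    congr 1
    apply sum_congr rfl
    intro n hn
    have : n ≠ 0 := by have := (mem_Ioc.mp hn).1; omega
    simp [ze', natCoe_apply, zeta_apply, this]
  have b2 : ‖SS χ q ψ (lo U mu' * (lo U vonMangoldt * ze')) X‖ ≤ U * (6 * U * (q * D)) := by
    refine (SS_lo_mul h q ψ U mu' _ X (6 * U * (q * D)) (by positivity) ?_).trans ?_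
    · intro Y hY
      refine (SS_lo_mul h q ψ U vonMangoldt _ Y (q * D) (by positivity) (fun Z _ => bz Z)).trans ?_
      gcongr
    · gcongr
  have e := congrArg (fun f => SS χ q ψ f X) (vaughan U)
  beta_reduce at e
  rw [SS_add, SS_sub, SS_add] at e
  set T3 := SS χ q ψ (hi U vonMangoldt * (hi U mu' * ze')) X
  have n1 : ‖SS χ q ψ vonMangoldt X‖ ≤ ‖SS χ q ψ (lo U vonMangoldt) X‖ + ‖SS χ q ψ (lo U mu' * ArithmeticFunction.log) X‖
      + ‖SS χ q ψ (lo U mu' * (lo U vonMangoldt * ze')) X‖ + ‖T3‖ := by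
    rw [e]
    refine (norm_add_le _ _).trans ?_
    gcongr
    refine (norm_sub_le _ _).trans ?_
    gcongr
    exact norm_add_le _ _
  have qd : (1:ℝ) ≤ q * D := by nlinarith
  have u2 : (U:ℝ) ≤ U ^ 2 := by nlinarith
  have c0 : (6 * U:ℝ) ≤ 6 * (q * D * U ^ 2) * Real.log X := by
    calc (6 * U:ℝ) = 6 * (1 * U) * 1 := by ring
      _ ≤ _ := by gcongr
  have c1 : (U * (2 * (q * D) * Real.log X):ℝ) ≤ 2 * (q * D * U ^ 2) * Real.log X := by
    calc (U * (2 * (q * D) * Real.log X):ℝ) = 2 * (q * D * U) * Real.log X := by ring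
      _ ≤ _ := by gcongr
  have c2 : (U * (6 * U * (q * D)):ℝ) ≤ 6 * (q * D * U ^ 2) * Real.log X := by
    calc (U * (6 * U * (q * D)):ℝ) = 6 * (q * D * U ^ 2) * 1 := by ring
      _ ≤ _ := by gcongr
  linarith

end BVL

namespace BVL
open Finset LSL ArithmeticFunction

variable {D : ℕ} {χ : ℕ → ℤ}

/-- type II coefficient -/
noncomputable def bb (U : ℕ) : ArithmeticFunction ℝ := hi U mu' * ze'

lemma bb_abs (U n : ℕ) : |bb U n| ≤ n.divisors.card := by
  unfold bb
  rw [ArithmeticFunction.mul_apply]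
  refine (abs_sum_le_sum_abs _ _).trans ?_
  have : ∀ x ∈ n.divisorsAntidiagonal, |hi U mu' x.1 * ze' x.2| ≤ 1 := by
    intro x _
    rw [abs_mul]
    have h1 : |hi U mu' x.1| ≤ 1 := by
      rw [hi_apply]; split_ifs
      · simp
      · exact mu'_abs _
    have h2 : |ze' x.2| ≤ 1 := by
      simp only [ze', natCoe_apply, zeta_apply]
      split_ifs <;> simp
    exact mul_le_one₀ h1 (abs_nonneg _) h2
  refine (sum_le_card_nsmul _ _ 1 this).trans ?_
  rw [nsmul_eq_mul, mul_one, ← Nat.map_div_right_divisors]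
  simp

lemma bb_zero (U n : ℕ) (hn : n ≤ U) : bb U n = 0 := by
  unfold bb
  rw [ArithmeticFunction.mul_apply]
  apply sum_eq_zero
  intro x hx
  rw [Nat.mem_divisorsAntidiagonal] at hx
  have hd : x.1 ≤ n := Nat.le_of_dvd (Nat.pos_of_ne_zero hx.2) ⟨x.2, hx.1.symm⟩
  rw [hi_apply, if_pos (hd.trans hn), zero_mul]

lemma SS_bb_zero (q : ℕ) (ψ : DirichletCharacter ℂ q) (U Y : ℕ) (hY : Y ≤ U) : SS χ q ψ (bb U) Y = 0 := by
  unfold SS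
  apply sum_eq_zero
  intro n hn
  rw [bb_zero U n ((mem_Ioc.mp hn).2.trans hY)]
  simp

lemma range_succ_ins (k : ℕ) : range (k + 1) = insert 0 (Ioc 0 k) := by
  ext n
  simp only [mem_range, mem_insert, mem_Ioc]
  omega

lemma dyadic_sum (U K : ℕ) (t : ℕ → ℂ) :
    ∑ m ∈ Ioc U (U * 2 ^ K), t m = ∑ i ∈ range K, ∑ m ∈ Ioc (U * 2 ^ i) (2 * (U * 2 ^ i)), t m := by
  induction K with
  | zero => simp
  | succ K ih =>
    rw [sum_range_succ, ← ih]
    have e : U * 2 ^ (K + 1) = 2 * (U * 2 ^ K) := by ring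
    rw [e, Finset.sum_Ioc_consecutive]
    · exact Nat.le_mul_of_pos_right _ (by positivity)
    · omega

lemma typeII_block (h : GoodChi D χ) (Q : Finset ℕ) (hQ : ∀ q ∈ Q, q.Prime) (R : ℝ) (hR : 1 ≤ R)
    (hQR : ∀ q ∈ Q, (q:ℝ) ≤ 2 * R) (U X M : ℕ) (hU : 2 ≤ U) (hX : 3 ≤ X) (hUM : U ≤ M) (hMX : M * U < X) :
    ∑ q ∈ Q, ∑ ψ ∈ NC q, ‖∑ m ∈ Ioc M (2 * M), (vonMangoldt m : ℂ) * GG χ q ψ m * SS χ q ψ (bb U) (X / m)‖ ≤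
      1920 * Real.log X ^ 3 * (X + 2 * R * X / √U + R ^ 2 * √X) := by
  set L := Real.log X with hLdef
  have hL : 1 ≤ L := by
    rw [hLdef, Real.le_log_iff_exp_le (by positivity)]
    have := Real.exp_one_lt_d9
    have : (3:ℝ) ≤ X := by exact_mod_cast hX
    linarith
  set α : ℕ → ℂ := fun m => if M < m then (vonMangoldt m : ℂ) else 0 with hα
  set β : ℕ → ℂ := fun n => (bb U n : ℂ) with hβ
  set y : ℕ → ℕ := fun m => if M < m then X / m else 0 with hy
  set N := X / M + 1 with hN
  have hM0 : 0 < M := by omega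
  have hbil := bilinear h Q hQ R (by linarith) hQR (2 * M + 1) N (Nat.succ_pos _) α β y (by
    intro m _
    simp only [hy, hN]
    split_ifs with hm
    · exact Nat.lt_succ_of_le (Nat.div_le_div_left hm.le hM0)
    · exact Nat.succ_pos _)
  have conv : ∀ q (ψ : DirichletCharacter ℂ q),
      ∑ m ∈ range (2 * M + 1), α m * GG χ q ψ m * ∑ n ∈ range (y m + 1), β n * GG χ q ψ n =
      ∑ m ∈ Ioc M (2 * M), (vonMangoldt m : ℂ) * GG χ q ψ m * SS χ q ψ (bb U) (X / m) := by
    intro q ψ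
    have hsub : Ioc M (2 * M) ⊆ range (2 * M + 1) := by
      intro m hm
      simp only [mem_Ioc, mem_range] at hm ⊢
      omega
    symm
    rw [← sum_subset hsub]
    · apply sum_congr rfl
      intro m hm
      have hm' := (mem_Ioc.mp hm).1
      simp only [hα, hy, if_pos hm']
      congr 1
      unfold SS
      have : range (X / m + 1) = insert 0 (Ioc 0 (X / m)) := range_succ_ins _
      rw [this, sum_insert (by simp)]
      simp [hβ]
    · intro m hm hm'
      simp only [mem_Ioc, mem_range] at hm hm'
      have : ¬ M < m := by omega
      simp [hα, this]
  simp_rw [conv] at hbil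
  refine hbil.trans ?_
  have hXM : X / M ≤ X := Nat.div_le_self _ _
  have hUr : (2:ℝ) ≤ U := by exact_mod_cast hU
  have hUMr : (U:ℝ) ≤ M := by exact_mod_cast hUM
  have hMXr : (M:ℝ) * U < X := by exact_mod_cast hMX
  have hMr : (0:ℝ) < M := by linarith
  have hXr : (0:ℝ) < X := by nlinarith
  have hNr : (N:ℝ) ≤ X / M + 1 := by
    rw [hN]; push_cast
    gcongr
    exact Nat.cast_div_le
  have hUXM : (U:ℝ) ≤ X / M := by
    rw [le_div_iff₀ hMr]; nlinarith
  have hlogN : Real.log N ≤ L := by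
    apply log_mono_nat
    rw [hN]
    have : X / M ≤ X / 2 := Nat.div_le_div_left (by omega) (by norm_num)
    omega
  -- alpha norm
  have hA : ∑ m ∈ range (2 * M + 1), ‖α m‖ ^ 2 ≤ 12 * M * L := by
    have hsub : Ioc 0 (2 * M) ⊆ range (2 * M + 1) := by
      intro m hm
      simp only [mem_Ioc, mem_range] at hm ⊢
      omega
    rw [← sum_subset hsub]
    · calc _ ≤ ∑ m ∈ Ioc 0 (2 * M), L * vonMangoldt m := by
            apply sum_le_sum
            intro m hm
            simp only [mem_Ioc] at hm
            have hv : 0 ≤ vonMangoldt m := vonMangoldt_nonneg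
            have hvl : vonMangoldt m ≤ L := vonMangoldt_le_log.trans (log_mono_nat (by nlinarith))
            simp only [hα]
            split_ifs
            · rw [Complex.norm_real, Real.norm_of_nonneg hv, sq]
              gcongr
            · simp; positivity
        _ = L * ∑ m ∈ Ioc 0 (2 * M), vonMangoldt m := by rw [mul_sum]
        _ ≤ L * (6 * (2 * M : ℕ)) := by gcongr; exact psi_le6 _
        _ = _ := by push_cast; ring
    · intro m hm hm'
      simp only [mem_Ioc, mem_range] at hm hm'
      have : ¬ M < m := by omega
      simp [hα, this]
  have hB : ∑ n ∈ range N, ‖β n‖ ^ 2 ≤ X / M * (8 * L ^ 3) := by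
    have hr : range N = insert 0 (Ioc 0 (X / M)) := range_succ_ins _
    rw [hr, sum_insert (by simp)]
    have : ‖β 0‖ ^ 2 = 0 := by simp [hβ]
    rw [this, zero_add]
    calc _ ≤ ∑ n ∈ Ioc 0 (X / M), (n.divisors.card : ℝ) ^ 2 := by
          apply sum_le_sum
          intro n _
          simp only [hβ, Complex.norm_real, Real.norm_eq_abs]
          gcongr
          exact bb_abs U n
      _ ≤ _ := tau_sq _
      _ ≤ X / M * (2 * L) ^ 3 := by
          have := Real.log_natCast_nonneg (X / M)
          have h2 := log_mono_nat hXM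
          gcongr
          · exact Nat.cast_div_le
          · linarith
      _ = _ := by ring
  have hAB : √(∑ m ∈ range (2 * M + 1), ‖α m‖ ^ 2) * √(∑ n ∈ range N, ‖β n‖ ^ 2) ≤ 10 * √X * L ^ 2 := by
    calc _ ≤ √(12 * M * L) * √(X / M * (8 * L ^ 3)) := by gcongr
      _ = √(96 * X * (L ^ 2) ^ 2) := by
          rw [← Real.sqrt_mul (by positivity)]
          congr 1
          field_simp
          ring
      _ ≤ √(10 ^ 2 * X * (L ^ 2) ^ 2) := by gcongr; norm_num
      _ = _ := by
          rw [Real.sqrt_mul (by positivity), Real.sqrt_mul (by positivity), Real.sqrt_sq (by norm_num),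
            Real.sqrt_sq (by positivity)]
  have hsU : 0 < √(U:ℝ) := Real.sqrt_pos.mpr (by linarith)
  have hMN : √(((2 * M + 1 : ℕ):ℝ) + 4 * R ^ 2 + 1) * √(N + 4 * R ^ 2 + 1) ≤ 4 * (√X + 2 * R * √X / √U + R ^ 2) := by
    rw [← Real.sqrt_mul (by positivity)]
    apply Real.sqrt_le_iff.mpr
    refine ⟨by positivity, ?_⟩
    have e1 : ((2 * M + 1 : ℕ):ℝ) + 4 * R ^ 2 + 1 ≤ 4 * (M + R ^ 2) := by push_cast; nlinarith
    have e2 : N + 4 * R ^ 2 + 1 ≤ 4 * ((X:ℝ) / M + R ^ 2) := by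
      have : 0 ≤ R ^ 2 := by positivity
      linarith
    have sX : √(X:ℝ) ^ 2 = X := Real.sq_sqrt hXr.le
    have sU : √(U:ℝ) ^ 2 = U := Real.sq_sqrt (by linarith)
    have m1 : (M:ℝ) ≤ X / U := by rw [le_div_iff₀ (by linarith)]; exact hMXr.le
    have m2 : (X:ℝ) / M ≤ X / U := by gcongr
    have e3 : ((M:ℝ) + R ^ 2) * (X / M + R ^ 2) = X + R ^ 2 * M + R ^ 2 * (X / M) + R ^ 4 := by
      field_simp
      ring
    have e4 : (2 * R * √X / √U) ^ 2 = 4 * (R ^ 2 * (X / U)) := by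
      rw [div_pow, mul_pow, sX, sU]; ring
    calc _ ≤ (4 * (M + R ^ 2)) * (4 * ((X:ℝ) / M + R ^ 2)) := by gcongr
      _ = 16 * (X + R ^ 2 * M + R ^ 2 * (X / M) + R ^ 4) := by rw [← e3]; ring
      _ ≤ 16 * (√X ^ 2 + (2 * R * √X / √U) ^ 2 + R ^ 4) := by
          rw [sX, e4]
          have k1 : R ^ 2 * M ≤ R ^ 2 * (X / U) := by gcongr
          have k2 : R ^ 2 * (X / M) ≤ R ^ 2 * (X / U) := by gcongr
          have k3 : 0 ≤ R ^ 2 * (X / U:ℝ) := by positivity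
          linarith
      _ ≤ _ := by
          have k1 : 0 ≤ √(X:ℝ) := by positivity
          have k2 : 0 ≤ 2 * R * √X / √U := by positivity
          have k3 : 0 ≤ R ^ 2 := by positivity
          nlinarith [mul_nonneg k1 k2, mul_nonneg k1 k3, mul_nonneg k2 k3]
  have hlogN0 : 0 ≤ Real.log N := Real.log_natCast_nonneg _
  calc _ ≤ 16 * (3 * L) * (4 * (√X + 2 * R * √X / √U + R ^ 2)) * (10 * √X * L ^ 2) := by
        gcongr
        linarith
    _ = 1920 * L ^ 3 * (√X ^ 2 + 2 * R * √X ^ 2 / √U + R ^ 2 * √X) := by ring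
    _ = _ := by rw [Real.sq_sqrt hXr.le]

lemma typeII (h : GoodChi D χ) (Q : Finset ℕ) (hQ : ∀ q ∈ Q, q.Prime) (R : ℝ) (hR : 1 ≤ R)
    (hQR : ∀ q ∈ Q, (q:ℝ) ≤ 2 * R) (U X : ℕ) (hU : 2 ≤ U) (hX : 3 ≤ X) :
    ∑ q ∈ Q, ∑ ψ ∈ NC q, ‖SS χ q ψ (hi U vonMangoldt * bb U) X‖ ≤
      6000 * Real.log X ^ 4 * (X + 2 * R * X / √U + R ^ 2 * √X) := by
  set L := Real.log X with hLdef
  have hL : 1 ≤ L := by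
    rw [hLdef, Real.le_log_iff_exp_le (by positivity)]
    have := Real.exp_one_lt_d9
    have : (3:ℝ) ≤ X := by exact_mod_cast hX
    linarith
  set K := Nat.log 2 X + 1 with hK
  have hK2 : X < 2 ^ K := Nat.lt_pow_succ_log_self (by norm_num) X
  have hKr : (K:ℝ) ≤ 3 * L := by
    have h1 : ((2 ^ Nat.log 2 X : ℕ) : ℝ) ≤ X := by exact_mod_cast Nat.pow_log_le_self 2 (by omega)
    have h2 := Real.log_le_log (by positivity) h1
    push_cast at h2
    rw [Real.log_pow] at h2
    have := Real.log_two_gt_d9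
    rw [hK]; push_cast
    have h3 : (0:ℝ) ≤ Nat.log 2 X := by positivity
    nlinarith
  have hsplit : ∀ q (ψ : DirichletCharacter ℂ q), SS χ q ψ (hi U vonMangoldt * bb U) X =
      ∑ i ∈ range K, ∑ m ∈ Ioc (U * 2 ^ i) (2 * (U * 2 ^ i)), (vonMangoldt m : ℂ) * GG χ q ψ m * SS χ q ψ (bb U) (X / m) := by
    intro q ψ
    rw [← dyadic_sum, SS_mul h]
    have hXle : X ≤ U * 2 ^ K := hK2.le.trans (Nat.le_mul_of_pos_left _ (by omega))
    have s1 : Ioc 0 X ⊆ Ioc 0 (U * 2 ^ K) := Ioc_subset_Ioc_right hXle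
    have s2 : Ioc U (U * 2 ^ K) ⊆ Ioc 0 (U * 2 ^ K) := Ioc_subset_Ioc_left (Nat.zero_le _)
    rw [sum_subset s1, ← sum_subset s2 (f := fun n => ((hi U vonMangoldt) n : ℂ) * GG χ q ψ n * SS χ q ψ (bb U) (X / n))]
    · apply sum_congr rfl
      intro m hm
      rw [hi_apply, if_neg (by have := (mem_Ioc.mp hm).1; omega)]
    · intro m hm hm'
      simp only [mem_Ioc] at hm hm'
      rw [hi_apply, if_pos (by omega)]
      simp
    · intro m hm hm'
      simp only [mem_Ioc] at hm hm'
      rw [Nat.div_eq_of_lt (by omega), SS_bb_zero _ _ _ _ (Nat.zero_le _), mul_zero]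
  set Bd := 1920 * L ^ 3 * (X + 2 * R * X / √U + R ^ 2 * √X) with hBd
  have hBd0 : 0 ≤ Bd := by positivity
  have hblock : ∀ i ∈ range K, ∑ q ∈ Q, ∑ ψ ∈ NC q,
      ‖∑ m ∈ Ioc (U * 2 ^ i) (2 * (U * 2 ^ i)), (vonMangoldt m : ℂ) * GG χ q ψ m * SS χ q ψ (bb U) (X / m)‖ ≤ Bd := by
    intro i _
    by_cases hc : (U * 2 ^ i) * U < X
    · exact typeII_block h Q hQ R hR hQR U X (U * 2 ^ i) hU hX (Nat.le_mul_of_pos_right _ (by positivity)) hc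
    · push Not at hc
      refine le_trans (le_of_eq ?_) hBd0
      apply sum_eq_zero
      intro q _
      apply sum_eq_zero
      intro ψ _
      rw [norm_eq_zero]
      apply sum_eq_zero
      intro m hm
      have hm := (mem_Ioc.mp hm).1
      rw [SS_bb_zero, mul_zero]
      apply Nat.le_of_lt_succ
      apply Nat.div_lt_of_lt_mul
      nlinarith
  calc _ ≤ ∑ q ∈ Q, ∑ ψ ∈ NC q, ∑ i ∈ range K,
      ‖∑ m ∈ Ioc (U * 2 ^ i) (2 * (U * 2 ^ i)), (vonMangoldt m : ℂ) * GG χ q ψ m * SS χ q ψ (bb U) (X / m)‖ := by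
        apply sum_le_sum
        intro q _
        apply sum_le_sum
        intro ψ _
        rw [hsplit]
        exact norm_sum_le _ _
    _ = ∑ i ∈ range K, ∑ q ∈ Q, ∑ ψ ∈ NC q,
      ‖∑ m ∈ Ioc (U * 2 ^ i) (2 * (U * 2 ^ i)), (vonMangoldt m : ℂ) * GG χ q ψ m * SS χ q ψ (bb U) (X / m)‖ := by
        symm
        rw [sum_comm]
        apply sum_congr rfl
        intro q _
        rw [sum_comm]
    _ ≤ ∑ i ∈ range K, Bd := sum_le_sum hblock
    _ = K * Bd := by simp
    _ ≤ 3 * L * Bd := by gcongr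
    _ = 5760 * L ^ 4 * (X + 2 * R * X / √U + R ^ 2 * √X) := by rw [hBd]; ring
    _ ≤ _ := by
        gcongr
        norm_num

lemma card_NC (q : ℕ) (hq : q.Prime) : ((NC q).card : ℝ) ≤ q := by
  have : Fact q.Prime := ⟨hq⟩
  have h1 : (NC q).card ≤ Fintype.card (DirichletCharacter ℂ q) := card_le_univ _
  have h2 := DirichletCharacter.card_eq_totient_of_hasEnoughRootsOfUnity ℂ q
  rw [Nat.card_eq_fintype_card] at h2
  rw [h2] at h1
  exact_mod_cast h1.trans (Nat.totient_le q)

theorem bv_block (h : GoodChi D χ) (Q : Finset ℕ) (hQ : ∀ q ∈ Q, q.Prime) (hQD : ∀ q ∈ Q, ¬ q ∣ D) (R : ℝ) (hR : 1 ≤ R)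
    (hQR : ∀ q ∈ Q, (q:ℝ) ≤ 2 * R) (U X : ℕ) (hU : 2 ≤ U) (hX : 3 ≤ X) :
    ∑ q ∈ Q, ∑ ψ ∈ NC q, ‖SS χ q ψ vonMangoldt X‖ ≤ 112 * D * R ^ 3 * U ^ 2 * Real.log X +
      6000 * Real.log X ^ 4 * (X + 2 * R * X / √U + R ^ 2 * √X) := by
  have hL : 0 ≤ Real.log X := Real.log_natCast_nonneg _
  calc _ ≤ ∑ q ∈ Q, ∑ ψ ∈ NC q, (14 * (q * D * U ^ 2) * Real.log X + ‖SS χ q ψ (hi U vonMangoldt * bb U) X‖) := by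
        apply sum_le_sum
        intro q hq
        apply sum_le_sum
        intro ψ hψ
        exact typeI h q (hQ q hq) (hQD q hq) ψ (mem_NC.mp hψ) U X hX (by omega)
    _ = ∑ q ∈ Q, ((NC q).card : ℝ) * (14 * (q * D * U ^ 2) * Real.log X) + ∑ q ∈ Q, ∑ ψ ∈ NC q, ‖SS χ q ψ (hi U vonMangoldt * bb U) X‖ := by
        rw [← sum_add_distrib]
        apply sum_congr rfl
        intro q _
        rw [sum_add_distrib, sum_const, nsmul_eq_mul]
    _ ≤ 112 * D * R ^ 3 * U ^ 2 * Real.log X + 6000 * Real.log X ^ 4 * (X + 2 * R * X / √U + R ^ 2 * √X) := by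
        gcongr ?_ + ?_
        · have hc : (Q.card : ℝ) ≤ 2 * R := by
            have : Q ⊆ Ioc 0 ⌊2 * R⌋₊ := by
              intro q hq
              rw [mem_Ioc]
              exact ⟨(hQ q hq).pos, Nat.le_floor (hQR q hq)⟩
            have := card_le_card this
            simp only [Nat.card_Ioc, Nat.sub_zero] at this
            calc (Q.card : ℝ) ≤ ⌊2 * R⌋₊ := by exact_mod_cast this
              _ ≤ _ := Nat.floor_le (by linarith)
          calc _ ≤ ∑ q ∈ Q, (2 * R) * (14 * ((2 * R) * D * U ^ 2) * Real.log X) := by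
                apply sum_le_sum
                intro q hq
                have := card_NC q (hQ q hq)
                have := hQR q hq
                gcongr
                linarith
            _ = Q.card * ((2 * R) * (14 * ((2 * R) * D * U ^ 2) * Real.log X)) := by
                rw [sum_const, nsmul_eq_mul]
            _ ≤ (2 * R) * ((2 * R) * (14 * ((2 * R) * D * U ^ 2) * Real.log X)) := by gcongr
            _ = _ := by ring
        · exact typeII h Q hQ R hR hQR U X hU hX

end BVL

namespace BVL
open Finset LSL ArithmeticFunction

variable {D : ℕ} {χ : ℕ → ℤ}

noncomputable def EE (χ : ℕ → ℤ) (q X : ℕ) : ℝ := ∑ ψ ∈ NC q, ‖SS χ q ψ vonMangoldt X‖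

lemma EE_nonneg (q X : ℕ) : 0 ≤ EE χ q X := sum_nonneg (fun _ _ => norm_nonneg _)

lemma detect (q : ℕ) (hq : q.Prime) (X : ℕ) :
    ∑ n ∈ (Ioc 0 X).filter (fun n : ℕ => (((n : ℤ) * χ n : ℤ) : ZMod q) = 1), vonMangoldt n ≤
      (Chebyshev.psi X + EE χ q X) / (q - 1) := by
  classical
  have : Fact q.Prime := ⟨hq⟩
  have hq1 : (0:ℝ) < q - 1 := by
    have : (2:ℝ) ≤ q := by exact_mod_cast hq.two_le
    linarith
  rw [le_div_iff₀ hq1]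
  have hqt : ((q.totient : ℕ) : ℂ) = ((q - 1 : ℝ) : ℂ) := by
    rw [Nat.totient_prime hq, Nat.cast_sub hq.one_le]
    push_cast; rfl
  have e : (((∑ n ∈ (Ioc 0 X).filter (fun n : ℕ => (((n : ℤ) * χ n : ℤ) : ZMod q) = 1), vonMangoldt n) * (q - 1) : ℝ) : ℂ) =
      ∑ ψ : DirichletCharacter ℂ q, SS χ q ψ vonMangoldt X := by
    unfold SS
    rw [sum_comm]
    simp_rw [← mul_sum]
    have : ∀ n ∈ Ioc 0 X, (vonMangoldt n : ℂ) * ∑ ψ : DirichletCharacter ℂ q, GG χ q ψ n =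
        if (((n : ℤ) * χ n : ℤ) : ZMod q) = 1 then (vonMangoldt n : ℂ) * ((q - 1 : ℝ) : ℂ) else 0 := by
      intro n _
      unfold GG
      rw [DirichletCharacter.sum_characters_eq ℂ, hqt]
      split_ifs <;> simp
    rw [sum_congr rfl this, ← sum_filter, ← sum_mul]
    push_cast
    rfl
  have hn : 0 ≤ (∑ n ∈ (Ioc 0 X).filter (fun n : ℕ => (((n : ℤ) * χ n : ℤ) : ZMod q) = 1), vonMangoldt n) * ((q:ℝ) - 1) :=
    mul_nonneg (sum_nonneg (fun _ _ => vonMangoldt_nonneg)) hq1.le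
  have e2 : (∑ n ∈ (Ioc 0 X).filter (fun n : ℕ => (((n : ℤ) * χ n : ℤ) : ZMod q) = 1), vonMangoldt n) * ((q:ℝ) - 1) =
      ‖∑ ψ : DirichletCharacter ℂ q, SS χ q ψ vonMangoldt X‖ := by
    rw [← e, Complex.norm_real, Real.norm_of_nonneg hn]
  rw [e2]
  have hsplit : (∑ ψ : DirichletCharacter ℂ q, SS χ q ψ vonMangoldt X) =
      SS χ q 1 vonMangoldt X + ∑ ψ ∈ NC q, SS χ q ψ vonMangoldt X := by
    have : NC q = univ.erase 1 := by ext ψ; rw [mem_NC]; simp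
    rw [this]
    exact (add_sum_erase univ (fun ψ => SS χ q ψ vonMangoldt X) (mem_univ 1)).symm
  rw [hsplit]
  refine (norm_add_le _ _).trans ?_
  gcongr
  · unfold SS Chebyshev.psi
    rw [Nat.floor_natCast]
    refine (norm_sum_le _ _).trans ?_
    apply sum_le_sum
    intro n _
    rw [norm_mul, Complex.norm_real, Real.norm_of_nonneg vonMangoldt_nonneg]
    have := GG_norm (χ := χ) q 1 n
    have hv : 0 ≤ vonMangoldt n := vonMangoldt_nonneg
    nlinarith
  · exact norm_sum_le _ _

/-- medium primes -/
noncomputable def QM (D : ℕ) (δ : ℝ) (X : ℕ) : Finset ℕ :=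
  (Ioc 0 X).filter (fun q => q.Prime ∧ ¬ q ∣ D ∧ (X:ℝ) ^ δ < q ∧ (q:ℝ) ≤ (X:ℝ) ^ (1 / 2 - δ))

lemma dy_bound (h : GoodChi D χ) {δ : ℝ} (hδ : 0 < δ) (hδ2 : δ < 1 / 4) (X : ℕ) (hX : 3 ≤ X) (j : ℕ) :
    ∑ q ∈ (QM D δ X).filter (fun q => Nat.log 2 (q - 1) = j), Real.log q / (q - 1) * EE χ q X ≤
      (1008 * D + 30000) * Real.log X ^ 5 * (X:ℝ) ^ (1 - δ / 4) := by
  have hXr : (3:ℝ) ≤ X := by exact_mod_cast hX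
  have hX0 : (0:ℝ) < X := by linarith
  have hX1 : (1:ℝ) ≤ X := by linarith
  set L := Real.log X with hLdef
  have hL : 1 ≤ L := by
    rw [hLdef, Real.le_log_iff_exp_le (by positivity)]
    have := Real.exp_one_lt_d9
    linarith
  set Q := (QM D δ X).filter (fun q => Nat.log 2 (q - 1) = j) with hQdef
  rcases Q.eq_empty_or_nonempty with hem | ⟨q0, hq0⟩
  · rw [hem, sum_empty]; positivity
  have hmem : ∀ q ∈ Q, q.Prime ∧ ¬ q ∣ D ∧ (X:ℝ) ^ δ < q ∧ (q:ℝ) ≤ (X:ℝ) ^ (1 / 2 - δ) ∧ q ≤ X ∧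
      2 ^ j ≤ q - 1 ∧ q - 1 < 2 ^ (j + 1) := by
    intro q hq
    simp only [hQdef, QM, mem_filter, mem_Ioc] at hq
    obtain ⟨⟨⟨h1, h2⟩, h3, h4, h5, h6⟩, h7⟩ := hq
    refine ⟨h3, h4, h5, h6, h2, ?_, ?_⟩
    · rw [← h7]; exact Nat.pow_log_le_self 2 (by have := h3.two_le; omega)
    · rw [← h7]; exact Nat.lt_pow_succ_log_self (by norm_num) _
  set R : ℝ := 2 ^ j with hR
  have hR1 : 1 ≤ R := one_le_pow₀ (by norm_num)
  have hq1 : ∀ q ∈ Q, R ≤ (q:ℝ) - 1 := by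
    intro q hq
    obtain ⟨h3, h4, h5, h6, h2, h8, h9⟩ := hmem q hq
    have : ((2 ^ j : ℕ) : ℝ) ≤ ((q - 1 : ℕ) : ℝ) := by exact_mod_cast h8
    rw [Nat.cast_sub h3.one_le] at this
    push_cast at this
    exact this
  have hq2 : ∀ q ∈ Q, (q:ℝ) ≤ 2 * R := by
    intro q hq
    obtain ⟨h3, h4, h5, h6, h2, h8, h9⟩ := hmem q hq
    have : q ≤ 2 * 2 ^ j := by
      have : 2 ^ (j + 1) = 2 * 2 ^ j := by ring
      omega
    have h10 : (q:ℝ) ≤ 2 * 2 ^ j := by exact_mod_cast this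
    exact h10
  have hRlo : (X:ℝ) ^ δ ≤ 2 * R := by
    have := hq2 q0 hq0
    have := (hmem q0 hq0).2.2.1
    linarith
  have hRhi : R ≤ (X:ℝ) ^ (1 / 2 - δ) := by
    have := hq1 q0 hq0
    have := (hmem q0 hq0).2.2.2.1
    linarith
  set U := ⌈(X:ℝ) ^ (δ / 2)⌉₊ + 1 with hU
  have hXd : 1 ≤ (X:ℝ) ^ (δ / 2) := Real.one_le_rpow hX1 (by linarith)
  have hUlo : (X:ℝ) ^ (δ / 2) ≤ U := by
    rw [hU]; push_cast
    have := Nat.le_ceil ((X:ℝ) ^ (δ / 2))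
    linarith
  have hUhi : (U:ℝ) ≤ 3 * (X:ℝ) ^ (δ / 2) := by
    rw [hU]; push_cast
    have := Nat.ceil_lt_add_one (by positivity : 0 ≤ (X:ℝ) ^ (δ / 2))
    linarith
  have hU2 : 2 ≤ U := by
    rw [hU]
    have : 0 < ⌈(X:ℝ) ^ (δ / 2)⌉₊ := Nat.ceil_pos.mpr (by linarith)
    omega
  have hb := bv_block h Q (fun q hq => (hmem q hq).1) (fun q hq => (hmem q hq).2.1) R hR1 hq2 U X hU2 hX
  have step1 : ∑ q ∈ Q, Real.log q / (q - 1) * EE χ q X ≤ L / R * ∑ q ∈ Q, EE χ q X := by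
    rw [mul_sum]
    apply sum_le_sum
    intro q hq
    obtain ⟨h3, h4, h5, h6, h2, h8, h9⟩ := hmem q hq
    have a1 := hq1 q hq
    have a2 : Real.log q ≤ L := log_mono_nat h2
    have a3 := EE_nonneg (χ := χ) q X
    gcongr
  refine step1.trans ?_
  have hsU : 0 < √(U:ℝ) := Real.sqrt_pos.mpr (by linarith)
  set P := (X:ℝ) ^ (1 - δ / 4) with hP
  have hPmono : ∀ t : ℝ, t ≤ 1 - δ / 4 → (X:ℝ) ^ t ≤ P := fun t ht => Real.rpow_le_rpow_of_exponent_le hX1 ht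
  -- four terms
  have t1 : R ^ 2 * (U:ℝ) ^ 2 ≤ 9 * P := by
    calc R ^ 2 * (U:ℝ) ^ 2 ≤ ((X:ℝ) ^ (1 / 2 - δ)) ^ 2 * (3 * (X:ℝ) ^ (δ / 2)) ^ 2 := by gcongr
      _ = 9 * (X:ℝ) ^ (1 - δ) := by
          rw [mul_pow, ← Real.rpow_natCast ((X:ℝ) ^ (1 / 2 - δ)), ← Real.rpow_natCast ((X:ℝ) ^ (δ / 2)),
            ← Real.rpow_mul hX0.le, ← Real.rpow_mul hX0.le]
          have : (1 - δ) = ((1 / 2 - δ) * (2:ℕ)) + (δ / 2 * (2:ℕ)) := by push_cast; ring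
          rw [this, Real.rpow_add hX0]
          ring
      _ ≤ _ := by gcongr; exact hPmono _ (by linarith)
  have t2 : (X:ℝ) / R ≤ 2 * P := by
    have : (X:ℝ) / R ≤ 2 * (X:ℝ) ^ (1 - δ) := by
      rw [div_le_iff₀ (by linarith)]
      have e : (X:ℝ) = (X:ℝ) ^ (1 - δ) * (X:ℝ) ^ δ := by
        rw [← Real.rpow_add hX0]; simp
      calc (X:ℝ) = (X:ℝ) ^ (1 - δ) * (X:ℝ) ^ δ := e
        _ ≤ (X:ℝ) ^ (1 - δ) * (2 * R) := by gcongr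
        _ = _ := by ring
    exact this.trans (by gcongr; exact hPmono _ (by linarith))
  have t3 : (X:ℝ) / √U ≤ P := by
    rw [div_le_iff₀ hsU]
    have e : (X:ℝ) = P * (X:ℝ) ^ (δ / 4) := by
      rw [hP, ← Real.rpow_add hX0]; simp
    have e2 : (X:ℝ) ^ (δ / 4) ≤ √U := by
      apply Real.le_sqrt_of_sq_le
      refine le_trans (le_of_eq ?_) hUlo
      rw [← Real.rpow_natCast, ← Real.rpow_mul hX0.le]
      congr 1
      push_cast; ring
    calc (X:ℝ) = P * (X:ℝ) ^ (δ / 4) := e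
      _ ≤ _ := by gcongr
  have t4 : R * √X ≤ P := by
    calc R * √X ≤ (X:ℝ) ^ (1 / 2 - δ) * (X:ℝ) ^ (1 / 2 : ℝ) := by
          rw [Real.sqrt_eq_rpow]; gcongr
      _ = (X:ℝ) ^ (1 - δ) := by rw [← Real.rpow_add hX0]; congr 1; ring
      _ ≤ _ := hPmono _ (by linarith)
  have hP0 : 0 ≤ P := by positivity
  have hR0 : 0 < R := by linarith
  calc _ ≤ L / R * (112 * D * R ^ 3 * U ^ 2 * L + 6000 * L ^ 4 * (X + 2 * R * X / √U + R ^ 2 * √X)) := by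
        gcongr
        exact hb
    _ = 112 * D * (R ^ 2 * U ^ 2) * L ^ 2 + 6000 * L ^ 5 * (X / R + 2 * (X / √U) + R * √X) := by
        field_simp
    _ ≤ 112 * D * (9 * P) * L ^ 5 + 6000 * L ^ 5 * (2 * P + 2 * P + P) := by
        have hL25 : L ^ 2 ≤ L ^ 5 := pow_le_pow_right₀ hL (by norm_num)
        gcongr
    _ = _ := by ring

lemma log_num_le (X : ℕ) (hX : 3 ≤ X) : ((Nat.log 2 X + 1 : ℕ) : ℝ) ≤ 3 * Real.log X := by
  have hXr : (3:ℝ) ≤ X := by exact_mod_cast hX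
  have hL : 1 ≤ Real.log X := by
    rw [Real.le_log_iff_exp_le (by linarith)]
    have := Real.exp_one_lt_d9
    linarith
  have h1 : ((2 ^ (Nat.log 2 X) : ℕ) : ℝ) ≤ X := by
    exact_mod_cast Nat.pow_log_le_self 2 (by omega)
  have h2 := Real.log_le_log (by positivity) h1
  push_cast at h2
  rw [Real.log_pow] at h2
  have := Real.log_two_gt_d9
  push_cast
  have : (Nat.log 2 X : ℝ) ≤ 2 * Real.log X := by nlinarith [(Nat.log 2 X).cast_nonneg (α := ℝ)]
  linarith

theorem bv_sum (h : GoodChi D χ) {δ : ℝ} (hδ : 0 < δ) (hδ2 : δ < 1 / 4) {ε : ℝ} (hε : 0 < ε) :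
    ∀ᶠ X : ℕ in Filter.atTop,
      ∑ q ∈ QM D δ X, Real.log q / (q - 1) * EE χ q X ≤ ε * X := by
  have hlo : (fun x : ℝ => Real.log x ^ (6:ℝ)) =o[Filter.atTop] fun x => x ^ (δ / 4) :=
    isLittleO_log_rpow_rpow_atTop 6 (by positivity)
  set C : ℝ := 3 * (1008 * D + 30000) with hC
  have hC0 : 0 < C := by positivity
  have hev := (hlo.bound (c := ε / C) (by positivity)).filter_mono Filter.tendsto_id
  have hev2 := tendsto_natCast_atTop_atTop (R := ℝ) |>.eventually (hlo.bound (c := ε / C) (by positivity))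
  filter_upwards [hev2, Filter.eventually_ge_atTop 3] with X h1 hX
  have hXr : (3:ℝ) ≤ X := by exact_mod_cast hX
  have hX0 : (0:ℝ) < X := by linarith
  have hL : 0 ≤ Real.log X := Real.log_nonneg (by linarith)
  have hmap : ∀ q ∈ QM D δ X, Nat.log 2 (q - 1) ∈ range (Nat.log 2 X + 1) := by
    intro q hq
    simp only [QM, mem_filter, mem_Ioc] at hq
    rw [mem_range]
    have : Nat.log 2 (q - 1) ≤ Nat.log 2 X := Nat.log_mono_right (by omega)
    omega
  rw [← sum_fiberwise_of_maps_to hmap]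
  refine (sum_le_sum (fun j _ => dy_bound h hδ hδ2 X hX j)).trans ?_
  rw [sum_const, card_range, nsmul_eq_mul]
  have h2 := log_num_le X hX
  rw [Real.norm_of_nonneg (by positivity), Real.norm_of_nonneg (by positivity)] at h1
  have h6 : Real.log X ^ (6:ℝ) = Real.log X ^ 6 := by
    rw [← Real.rpow_natCast]; norm_num
  rw [h6] at h1
  have e : (X:ℝ) = (X:ℝ) ^ (δ / 4) * (X:ℝ) ^ (1 - δ / 4) := by
    rw [← Real.rpow_add hX0]; simp
  calc _ ≤ (3 * Real.log X) * ((1008 * D + 30000) * Real.log X ^ 5 * (X:ℝ) ^ (1 - δ / 4)) := by gcongr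
    _ = C * Real.log X ^ 6 * (X:ℝ) ^ (1 - δ / 4) := by rw [hC]; ring
    _ ≤ C * (ε / C * (X:ℝ) ^ (δ / 4)) * (X:ℝ) ^ (1 - δ / 4) := by gcongr
    _ = ε * ((X:ℝ) ^ (δ / 4) * (X:ℝ) ^ (1 - δ / 4)) := by field_simp
    _ = ε * X := by rw [← e]

end BVL

namespace FinL
open Finset BVL ArithmeticFunction

variable {D : ℕ} {χ : ℕ → ℤ}

/-- primes up to `X` not dividing `D` -/
def PP (D X : ℕ) : Finset ℕ := (Ioc 0 X).filter (fun p => p.Prime ∧ ¬ p ∣ D)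

/-- the shifted prime -/
def mm (χ : ℕ → ℤ) (p : ℕ) : ℕ := ((p:ℤ) - χ p).natAbs

/-- weighted count of primes with `n` dividing the shifted prime -/
noncomputable def WW (D : ℕ) (χ : ℕ → ℤ) (X n : ℕ) : ℝ :=
  ∑ p ∈ (PP D X).filter (fun p => n ∣ mm χ p), Real.log p

def PMOne (D : ℕ) (χ : ℕ → ℤ) : Prop := ∀ p : ℕ, p.Prime → ¬ p ∣ D → χ p = 1 ∨ χ p = -1

lemma mem_PP {X p : ℕ} : p ∈ PP D X ↔ p ≤ X ∧ p.Prime ∧ ¬ p ∣ D := by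
  simp only [PP, mem_filter, mem_Ioc]
  constructor
  · rintro ⟨⟨_, h⟩, h2⟩; exact ⟨h, h2⟩
  · rintro ⟨h, h2⟩; exact ⟨⟨h2.1.pos, h⟩, h2⟩

lemma mm_bounds (h1 : PMOne D χ) {X p : ℕ} (hp : p ∈ PP D X) :
    p - 1 ≤ mm χ p ∧ mm χ p ≤ p + 1 ∧ 1 ≤ mm χ p := by
  rw [mem_PP] at hp
  have := hp.2.1.two_le
  unfold mm
  rcases h1 p hp.2.1 hp.2.2 with h | h <;> rw [h] <;> omega

lemma WW_nonneg (X n : ℕ) : 0 ≤ WW D χ X n :=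
  sum_nonneg (fun p _ => Real.log_natCast_nonneg p)

lemma WW_le_theta (X n : ℕ) : WW D χ X n ≤ Chebyshev.theta X := by
  unfold WW
  rw [Chebyshev.theta_eq_sum_Icc, Nat.floor_natCast]
  apply sum_le_sum_of_subset_of_nonneg
  · intro p hp
    rw [mem_filter, mem_PP] at hp
    simp only [mem_filter, mem_Icc]
    exact ⟨⟨by omega, hp.1.1⟩, hp.1.2.1⟩
  · intro p _ _; exact Real.log_natCast_nonneg p

lemma WW_le_card (X n : ℕ) :
    WW D χ X n ≤ ((PP D X).filter (fun p => n ∣ mm χ p)).card * Real.log X := by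
  unfold WW
  rw [← nsmul_eq_mul, ← sum_const]
  apply sum_le_sum
  intro p hp
  rw [mem_filter, mem_PP] at hp
  exact log_mono_nat hp.1.1

/-- total weighted sum -/
lemma total_eq (h1 : PMOne D χ) (X : ℕ) :
    ∑ p ∈ PP D X, Real.log p * Real.log (mm χ p) =
      ∑ n ∈ Ioc 0 (X + 1), vonMangoldt n * WW D χ X n := by
  unfold WW
  simp_rw [sum_filter, mul_sum]
  rw [sum_comm]
  apply sum_congr rfl
  intro p hp
  have hb := mm_bounds h1 hp
  have hpX := (mem_PP.mp hp).1
  rw [← vonMangoldt_sum (n := mm χ p), mul_sum]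
  have : (mm χ p).divisors = (Ioc 0 (X+1)).filter (fun n => n ∣ mm χ p) := by
    ext n
    simp only [Nat.mem_divisors, mem_filter, mem_Ioc]
    constructor
    · rintro ⟨h, h0⟩
      have := Nat.le_of_dvd (by omega) h
      have := Nat.pos_of_dvd_of_pos h (by omega)
      exact ⟨⟨this, by omega⟩, h⟩
    · rintro ⟨_, h⟩; exact ⟨h, by omega⟩
  rw [this, sum_filter]
  apply sum_congr rfl
  intro n _
  split_ifs <;> ring

/-- crude count -/
lemma count_crude (h1 : PMOne D χ) (X n : ℕ) (hX : 1 ≤ X) (hn : 0 < n) (hnX : n ≤ X + 1) :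
    (((PP D X).filter (fun p => n ∣ mm χ p)).card : ℝ) ≤ 6 * X / n := by
  have hsub : (PP D X).filter (fun p => n ∣ mm χ p) ⊆
      (Ioc 0 X).filter (fun p => p ≡ 1 [MOD n]) ∪ (Ioc 0 X).filter (fun p => p ≡ (n - 1) [MOD n]) := by
    intro p hp
    rw [mem_filter, mem_PP] at hp
    obtain ⟨⟨hpX, hpp, hpD⟩, hd⟩ := hp
    have hp2 := hpp.two_le
    simp only [mem_union, mem_filter, mem_Ioc]
    unfold mm at hd
    rcases h1 p hpp hpD with h | h <;> rw [h] at hd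
    · left
      refine ⟨⟨by omega, hpX⟩, ?_⟩
      apply Nat.ModEq.symm
      rw [Nat.modEq_iff_dvd' (by omega)]
      have : ((p:ℤ) - 1).natAbs = p - 1 := by omega
      rwa [this] at hd
    · right
      refine ⟨⟨by omega, hpX⟩, ?_⟩
      have : ((p:ℤ) - -1).natAbs = p + 1 := by omega
      rw [this] at hd
      apply Nat.ModEq.add_right_cancel' 1
      rw [Nat.sub_add_cancel hn]
      rw [Nat.ModEq, Nat.mod_self]
      exact Nat.mod_eq_zero_of_dvd hd
  have hc := (card_le_card hsub).trans (card_union_le _ _)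
  have a1 := abs_le.mp (SelL.ap_count X n 1 hn)
  have a2 := abs_le.mp (SelL.ap_count X n (n-1) hn)
  have hc' : (((PP D X).filter (fun p => n ∣ mm χ p)).card : ℝ) ≤
    ((Ioc 0 X).filter (fun p => p ≡ 1 [MOD n])).card + ((Ioc 0 X).filter (fun p => p ≡ (n - 1) [MOD n])).card := by
    exact_mod_cast hc
  have hn' : (0:ℝ) < n := by exact_mod_cast hn
  have hX' : (1:ℝ) ≤ X := by exact_mod_cast hX
  have hnX' : (n:ℝ) ≤ X + 1 := by exact_mod_cast hnX
  have e : (1:ℝ) ≤ 2 * X / n := by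
    rw [le_div_iff₀ hn']; linarith
  have e2 : 6 * (X:ℝ) / n = 2 * (X / n) + 2 * (2 * X / n) := by ring
  rw [e2]
  linarith [a1.2, a2.2]

/-- Brun-Titchmarsh count -/
lemma count_bt (h : GoodChi D χ) (h1 : PMOne D χ) {ε : ℝ} (hε : 0 < ε) :
    ∃ Y0 : ℝ, 1 < Y0 ∧ ∀ X q : ℕ, q.Prime → ¬ q ∣ D → Y0 ≤ (X:ℝ) / (q * D) →
      (((PP D X).filter (fun p => q ∣ mm χ p)).card : ℝ) ≤
        (2 + ε) * X / ((q - 1) * Real.log (X / (q * D))) := by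
  obtain ⟨Y0, hY0, hbt⟩ := SelL.brun_titchmarsh hε
  refine ⟨Y0, hY0, ?_⟩
  intro X q hq hqD hX
  have hD := h.pos
  have hcop : Nat.Coprime q D := (Nat.Prime.coprime_iff_not_dvd hq).mpr hqD
  let a : ℕ → ℕ := fun b => if χ b = 1 then 1 else q - 1
  let c : ℕ → ℕ := fun b => (Nat.chineseRemainder hcop (a b) b : ℕ)
  have hsub : (PP D X).filter (fun p => q ∣ mm χ p) ⊆
      ((range D).filter (fun b => D.Coprime b)).biUnion
        (fun b => (Ioc 0 X).filter (fun p => p.Prime ∧ p ≡ c b [MOD q * D])) := by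
    intro p hp
    rw [mem_filter, mem_PP] at hp
    obtain ⟨⟨hpX, hpp, hpD⟩, hd⟩ := hp
    have hp2 := hpp.two_le
    have hchi : χ p = χ (p % D) := by
      have := per_mul h (p % D) (p / D)
      rw [← this]
      congr 1
      rw [mul_comm]; exact (Nat.mod_add_div p D).symm
    rw [mem_biUnion]
    refine ⟨p % D, ?_, ?_⟩
    · rw [mem_filter, mem_range]
      refine ⟨Nat.mod_lt _ hD, ?_⟩
      have : Nat.Coprime p D := (Nat.Prime.coprime_iff_not_dvd hpp).mpr hpD
      rw [Nat.coprime_comm]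
      unfold Nat.Coprime at this ⊢
      rw [← Nat.gcd_rec D p, Nat.gcd_comm] 
      exact this
    · simp only [mem_filter, mem_Ioc]
      refine ⟨⟨by omega, hpX⟩, hpp, ?_⟩
      apply Nat.chineseRemainder_modEq_unique
      · unfold mm at hd
        simp only [a]
        rcases h1 p hpp hpD with h2 | h2
        · rw [← hchi, if_pos h2]
          rw [h2] at hd
          apply Nat.ModEq.symm
          rw [Nat.modEq_iff_dvd' (by omega)]
          have : ((p:ℤ) - 1).natAbs = p - 1 := by omega
          rwa [this] at hd
        · rw [← hchi, if_neg (by rw [h2]; norm_num)]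
          rw [h2] at hd
          have : ((p:ℤ) - -1).natAbs = p + 1 := by omega
          rw [this] at hd
          apply Nat.ModEq.add_right_cancel' 1
          rw [Nat.sub_add_cancel hq.pos]
          rw [Nat.ModEq, Nat.mod_self]
          exact Nat.mod_eq_zero_of_dvd hd
      · exact (Nat.mod_modEq p D).symm
  have hcard := (card_le_card hsub).trans card_biUnion_le
  have hcard' : (((PP D X).filter (fun p => q ∣ mm χ p)).card : ℝ) ≤
      ∑ b ∈ (range D).filter (fun b => D.Coprime b),
        (((Ioc 0 X).filter (fun p => p.Prime ∧ p ≡ c b [MOD q * D])).card : ℝ) := by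
    exact_mod_cast hcard
  refine hcard'.trans ?_
  have hX2 : Y0 ≤ (X:ℝ) / ((q * D : ℕ) : ℝ) := by push_cast; exact hX
  refine (sum_le_sum (fun b _ => hbt X (q * D) (c b) (Nat.mul_pos hq.pos hD) hX2)).trans ?_
  rw [sum_const, nsmul_eq_mul, ← Nat.totient_eq_card_coprime, Nat.totient_mul hcop, Nat.totient_prime hq]
  have ht : (0:ℝ) < D.totient := by exact_mod_cast Nat.totient_pos.mpr hD
  rw [Nat.cast_mul, Nat.cast_sub hq.one_le]
  push_cast
  have hq1 : (0:ℝ) < q - 1 := by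
    have : (2:ℝ) ≤ q := by exact_mod_cast hq.two_le
    linarith
  have hlog : 0 < Real.log (X / (q * D)) := Real.log_pos (by linarith)
  apply le_of_eq
  field_simp

lemma WW_detect (h1 : PMOne D χ) (X q : ℕ) (hq : q.Prime) :
    WW D χ X q ≤ (Chebyshev.psi X + EE χ q X) / (q - 1) := by
  refine le_trans ?_ (detect q hq X)
  unfold WW
  have : ∀ p ∈ (PP D X).filter (fun p => q ∣ mm χ p), Real.log p = vonMangoldt p := by
    intro p hp
    rw [mem_filter, mem_PP] at hp
    rw [vonMangoldt_apply_prime hp.1.2.1]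
  rw [sum_congr rfl this]
  apply sum_le_sum_of_subset_of_nonneg
  · intro p hp
    rw [mem_filter, mem_PP] at hp
    obtain ⟨⟨hpX, hpp, hpD⟩, hd⟩ := hp
    simp only [mem_filter, mem_Ioc]
    refine ⟨⟨hpp.pos, hpX⟩, ?_⟩
    unfold mm at hd
    rw [← Int.natCast_dvd] at hd
    have hd2 : (((p:ℤ) * χ p : ℤ) : ZMod q) = ((1:ℤ) : ZMod q) := by
      rw [eq_comm, ZMod.intCast_eq_intCast_iff_dvd_sub]
      rcases h1 p hpp hpD with h2 | h2 <;> rw [h2] at hd ⊢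
      · simpa using hd
      · have e : (p:ℤ) * (-1) - 1 = -((p:ℤ) - -1) := by ring
        rw [e]
        exact (dvd_neg (α := ℤ)).mpr hd
    simpa using hd2
  · intro n _ _; exact vonMangoldt_nonneg

end FinL

namespace FinL
open Finset BVL ArithmeticFunction

variable {D : ℕ} {χ : ℕ → ℤ}

lemma evlog (K : ℝ) : ∀ᶠ X : ℕ in Filter.atTop, K ≤ Real.log X :=
  (Real.tendsto_log_atTop.comp tendsto_natCast_atTop_atTop).eventually_ge_atTop K

lemma evpow {δ : ℝ} (hδ : 0 < δ) (K : ℝ) : ∀ᶠ X : ℕ in Filter.atTop, K ≤ (X:ℝ) ^ δ :=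
  ((tendsto_rpow_atTop hδ).comp tendsto_natCast_atTop_atTop).eventually_ge_atTop K

lemma psum {y z κ : ℝ} (hy : 1 ≤ y) (hyz : y ≤ z) (hκ : 0 < κ) (S : Finset ℕ)
    (hS : ∀ q ∈ S, q.Prime ∧ y < q ∧ (q:ℝ) ≤ z ∧ 1 + κ ≤ κ * q) :
    ∑ q ∈ S, Real.log q / (q - 1) ≤ (1 + κ) * (Real.log z - Real.log y + 8) := by
  have h1 : ∀ q ∈ S, Real.log q / (q - 1) ≤ (1 + κ) * (vonMangoldt q / q) := by
    intro q hq
    obtain ⟨a, b, c, d⟩ := hS q hq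
    rw [vonMangoldt_apply_prime a]
    have hq2 : (2:ℝ) ≤ q := by exact_mod_cast a.two_le
    have hl : 0 ≤ Real.log q := Real.log_natCast_nonneg q
    rw [div_le_iff₀ (by linarith), ← mul_div_assoc, div_mul_eq_mul_div, le_div_iff₀ (by linarith)]
    have : (q:ℝ) ≤ (1 + κ) * (q - 1) := by linarith
    nlinarith
  refine (sum_le_sum h1).trans ?_
  rw [← mul_sum]
  gcongr
  refine le_trans ?_ (MertL.mertens_Ioc hy hyz)
  apply sum_le_sum_of_subset_of_nonneg
  · intro q hq
    obtain ⟨a, b, c, d⟩ := hS q hq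
    rw [mem_Ioc]
    exact ⟨(Nat.floor_lt (by linarith)).mpr b, Nat.le_floor c⟩
  · intro n _ _
    have : 0 ≤ vonMangoldt n := vonMangoldt_nonneg
    positivity

lemma p1 (T : ℕ) {ε : ℝ} (hε : 0 < ε) : ∀ᶠ X : ℕ in Filter.atTop,
    ∑ n ∈ Ioc 0 T, vonMangoldt n * WW D χ X n ≤ ε * X * Real.log X := by
  filter_upwards [evlog (∑ n ∈ Ioc 0 T, vonMangoldt n * (Real.log 4) / ε)] with X hX
  have hX0 : (0:ℝ) ≤ X := Nat.cast_nonneg X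
  have : ∀ n ∈ Ioc 0 T, vonMangoldt n * WW D χ X n ≤ (vonMangoldt n * (Real.log 4) / ε) * (ε * X) := by
    intro n _
    have h1 := WW_le_theta (D := D) (χ := χ) X n
    have h2 := Chebyshev.theta_le_log4_mul_x hX0
    have hv : 0 ≤ vonMangoldt n := vonMangoldt_nonneg
    calc _ ≤ vonMangoldt n * (Real.log 4 * X) := by gcongr; linarith
      _ = _ := by field_simp
  refine (sum_le_sum this).trans ?_
  rw [← sum_mul]
  calc _ ≤ Real.log X * (ε * X) := by gcongr
    _ = _ := by ring

lemma p2 (h1 : PMOne D χ) {ε : ℝ} (hε : 0 < ε) : ∃ T0 : ℕ, ∀ T ≥ T0, ∀ X ≥ 1,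
    ∑ n ∈ (Ioc 0 (X + 1)).filter (fun n => T < n ∧ ¬ n.Prime), vonMangoldt n * WW D χ X n ≤
      ε * X * Real.log X := by
  have hs := vonMangoldt.summable_residueClass_non_primes_div (0 : ZMod 1)
  obtain ⟨s, hs2⟩ := summable_iff_vanishing_norm.mp hs (ε / 6) (by positivity)
  refine ⟨s.sup id, ?_⟩
  intro T hT X hX
  set t := (Ioc 0 (X + 1)).filter (fun n => T < n ∧ ¬ n.Prime) with ht
  have hdis : Disjoint t s := by
    rw [Finset.disjoint_left]
    intro n hn hns
    rw [ht, mem_filter] at hn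
    have : n ≤ s.sup id := le_sup (f := id) hns
    omega
  have h3 := (le_abs_self _).trans (hs2 t hdis).le
  have hL : 0 ≤ Real.log X := Real.log_natCast_nonneg X
  have h4 : ∀ n ∈ t, vonMangoldt n * WW D χ X n ≤
      ((if n.Prime then 0 else vonMangoldt.residueClass (0 : ZMod 1) n) / n) * (6 * X * Real.log X) := by
    intro n hn
    rw [ht, mem_filter, mem_Ioc] at hn
    obtain ⟨⟨h5, h6⟩, h7, h8⟩ := hn
    rw [if_neg h8]
    have e : vonMangoldt.residueClass (0 : ZMod 1) n = vonMangoldt n := by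
      unfold vonMangoldt.residueClass
      rw [Set.indicator_of_mem]
      exact Subsingleton.elim _ _
    rw [e]
    have h9 := WW_le_card (D := D) (χ := χ) X n
    have h10 := count_crude h1 X n hX h5 h6
    have hv : 0 ≤ vonMangoldt n := vonMangoldt_nonneg
    calc _ ≤ vonMangoldt n * (6 * X / n * Real.log X) := by
          gcongr
          exact h9.trans (by gcongr)
      _ = _ := by ring
  refine (sum_le_sum h4).trans ?_
  rw [← sum_mul]
  calc _ ≤ ε / 6 * (6 * X * Real.log X) := by gcongr
    _ = _ := by ring

lemma bt_term (h : GoodChi D χ) (h1 : PMOne D χ) {ε β : ℝ} (hε : 0 < ε) (hβ : 0 < β) :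
    ∀ᶠ X : ℕ in Filter.atTop, ∀ q : ℕ, q.Prime → ¬ q ∣ D → (X:ℝ) ^ β ≤ (X:ℝ) / (q * D) →
      vonMangoldt q * WW D χ X q ≤ (2 + ε) / β * X * (Real.log q / (q - 1)) := by
  obtain ⟨Y0, hY0, hc⟩ := count_bt h h1 hε
  filter_upwards [evpow hβ Y0, evlog 1, Filter.eventually_ge_atTop 1] with X hX hL hX1
  intro q hq hqD hb
  have hX0 : (0:ℝ) < X := by exact_mod_cast hX1
  have h2 := hc X q hq hqD (hX.trans hb)
  have h3 := WW_le_card (D := D) (χ := χ) X q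
  have hlog : β * Real.log X ≤ Real.log (X / (q * D)) := by
    rw [← Real.log_rpow hX0]
    exact Real.log_le_log (by positivity) hb
  have hq1 : (0:ℝ) < q - 1 := by
    have : (2:ℝ) ≤ q := by exact_mod_cast hq.two_le
    linarith
  have hlq : 0 ≤ Real.log q := Real.log_natCast_nonneg q
  rw [vonMangoldt_apply_prime hq]
  have hL0 : 0 < Real.log X := by linarith
  calc Real.log q * WW D χ X q ≤ Real.log q * (((2 + ε) * X / ((q - 1) * (β * Real.log X))) * Real.log X) := by
        gcongr
        refine h3.trans ?_
        gcongr
        refine h2.trans ?_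
        gcongr
    _ = _ := by field_simp

lemma p3 (h : GoodChi D χ) (h1 : PMOne D χ) {δ : ℝ} (hδ : 0 < δ) (hδ1 : δ ≤ 1 / 4) :
    ∀ᶠ X : ℕ in Filter.atTop,
    ∑ q ∈ (Ioc 0 (X + 1)).filter (fun q => q.Prime ∧ ¬ q ∣ D ∧ (q:ℝ) ≤ (X:ℝ) ^ δ), vonMangoldt q * WW D χ X q ≤
      13 * δ * X * Real.log X := by
  filter_upwards [bt_term h h1 (ε := 1) (β := 1 / 2) (by norm_num) (by norm_num),
    evpow (δ := 1 / 4) (by norm_num) D, evlog (96 / δ), Filter.eventually_ge_atTop 1] with X hbt hXD hL hX1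
  have hX0 : (0:ℝ) < X := by exact_mod_cast hX1
  have hX1' : (1:ℝ) ≤ X := by exact_mod_cast hX1
  have hD : (0:ℝ) < D := by exact_mod_cast h.pos
  set S := (Ioc 0 (X + 1)).filter (fun q => q.Prime ∧ ¬ q ∣ D ∧ (q:ℝ) ≤ (X:ℝ) ^ δ) with hS
  have h2 : ∀ q ∈ S, vonMangoldt q * WW D χ X q ≤ (2 + 1) / (1 / 2) * X * (Real.log q / (q - 1)) := by
    intro q hq
    rw [hS, mem_filter] at hq
    obtain ⟨_, hqp, hqD, hqX⟩ := hq
    apply hbt q hqp hqD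
    have hq0 : (0:ℝ) < q := by exact_mod_cast hqp.pos
    rw [le_div_iff₀ (by positivity)]
    calc (X:ℝ) ^ (1 / 2 : ℝ) * (q * D) ≤ (X:ℝ) ^ (1 / 2 : ℝ) * ((X:ℝ) ^ (1 / 4 : ℝ) * (X:ℝ) ^ (1 / 4 : ℝ)) := by
          gcongr
          exact hqX.trans (Real.rpow_le_rpow_of_exponent_le hX1' hδ1)
      _ = X := by
          rw [← Real.rpow_add hX0, ← Real.rpow_add hX0]
          norm_num
  refine (sum_le_sum h2).trans ?_
  rw [← mul_sum]
  have h3 := psum (y := 1) (z := (X:ℝ) ^ δ) (κ := 1) le_rfl (Real.one_le_rpow hX1' hδ.le) one_pos S (by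
    intro q hq
    rw [hS, mem_filter] at hq
    obtain ⟨_, hqp, hqD, hqX⟩ := hq
    have : (2:ℝ) ≤ q := by exact_mod_cast hqp.two_le
    exact ⟨hqp, by linarith, hqX, by linarith⟩)
  rw [Real.log_one, Real.log_rpow hX0] at h3
  rw [div_le_iff₀ hδ] at hL
  calc _ ≤ (2 + 1) / (1 / 2) * (X:ℝ) * ((1 + 1) * (δ * Real.log X - 0 + 8)) := by gcongr
    _ ≤ _ := by nlinarith

lemma p4 (h : GoodChi D χ) (h1 : PMOne D χ) {δ : ℝ} (hδ : 0 < δ) (hδ1 : δ < 1 / 4) {ε : ℝ} (hε : 0 < ε) :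
    ∀ᶠ X : ℕ in Filter.atTop,
    ∑ q ∈ QM D δ X, vonMangoldt q * WW D χ X q ≤ Chebyshev.psi X * (Real.log X / 2) + ε * X := by
  filter_upwards [bv_sum h hδ hδ1 hε, evpow hδ ((1 + 2 * δ) / (2 * δ)), evlog (16 / δ),
    Filter.eventually_ge_atTop 1] with X hbv hXd hL hX1
  have hX0 : (0:ℝ) < X := by exact_mod_cast hX1
  have hX1' : (1:ℝ) ≤ X := by exact_mod_cast hX1
  have hmem : ∀ q ∈ QM D δ X, q.Prime ∧ (X:ℝ) ^ δ < q ∧ (q:ℝ) ≤ (X:ℝ) ^ (1 / 2 - δ) := by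
    intro q hq
    simp only [QM, mem_filter] at hq
    exact ⟨hq.2.1, hq.2.2.2.1, hq.2.2.2.2⟩
  have h2 : ∀ q ∈ QM D δ X, vonMangoldt q * WW D χ X q ≤
      Chebyshev.psi X * (Real.log q / (q - 1)) + Real.log q / (q - 1) * EE χ q X := by
    intro q hq
    have hqp := (hmem q hq).1
    rw [vonMangoldt_apply_prime hqp]
    have hlq : 0 ≤ Real.log q := Real.log_natCast_nonneg q
    calc _ ≤ Real.log q * ((Chebyshev.psi X + EE χ q X) / (q - 1)) := by
          gcongr; exact WW_detect h1 X q hqp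
      _ = _ := by ring
  refine (sum_le_sum h2).trans ?_
  rw [sum_add_distrib, ← mul_sum]
  refine add_le_add ?_ hbv
  have hpsi : 0 ≤ Chebyshev.psi X := Chebyshev.psi_nonneg _
  gcongr
  rcases le_or_gt ((X:ℝ) ^ δ) ((X:ℝ) ^ (1 / 2 - δ)) with hle | hgt
  · have h3 := psum (y := (X:ℝ) ^ δ) (z := (X:ℝ) ^ (1 / 2 - δ)) (κ := 2 * δ)
      (Real.one_le_rpow hX1' hδ.le) hle (by positivity) (QM D δ X) (by
        intro q hq
        obtain ⟨a, b, c⟩ := hmem q hq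
        refine ⟨a, b, c, ?_⟩
        have := hXd.trans b.le
        rw [div_le_iff₀ (by positivity)] at this
        linarith)
    refine h3.trans ?_
    rw [Real.log_rpow hX0, Real.log_rpow hX0]
    rw [div_le_iff₀ hδ] at hL
    have hL0 : 0 ≤ Real.log X := Real.log_natCast_nonneg X
    have e : (1 + 2 * δ) * ((1 / 2 - δ) * Real.log X - δ * Real.log X + 8) =
      Real.log X / 2 - δ * Real.log X - 4 * δ * (δ * Real.log X) + 8 + 16 * δ := by ring
    rw [e]
    nlinarith [mul_nonneg hδ.le hL0]
  · have : QM D δ X = ∅ := by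
      apply eq_empty_of_forall_notMem
      intro q hq
      obtain ⟨a, b, c⟩ := hmem q hq
      linarith
    rw [this, sum_empty]
    have hL0 : 0 ≤ Real.log X := Real.log_natCast_nonneg X
    positivity

lemma p5 (h : GoodChi D χ) (h1 : PMOne D χ) {δ η : ℝ} (hδ : 0 < δ) (hδ1 : δ < 1 / 4) (hη : 1 / 2 < η)
    (hηδ : 0 < 1 - η - δ) :
    ∀ᶠ X : ℕ in Filter.atTop, ∀ Z : ℝ, Z ≤ 2 * (X:ℝ) ^ η →
    ∑ q ∈ (Ioc 0 (X + 1)).filter (fun q => q.Prime ∧ ¬ q ∣ D ∧ (X:ℝ) ^ (1 / 2 - δ) < q ∧ (q:ℝ) ≤ Z),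
      vonMangoldt q * WW D χ X q ≤
      (2 + δ) / (1 - η - δ) * (1 + δ) * (η - 1 / 2 + 2 * δ) * X * Real.log X := by
  filter_upwards [bt_term h h1 (ε := δ) (β := 1 - η - δ) hδ hηδ,
    evpow hδ (2 * D), evpow (δ := 1 / 2 - δ) (by linarith) ((1 + δ) / δ),
    evlog (9 / δ), Filter.eventually_ge_atTop 1] with X hbt hXD hXd hL hX1
  intro Z hZ
  have hX0 : (0:ℝ) < X := by exact_mod_cast hX1
  have hX1' : (1:ℝ) ≤ X := by exact_mod_cast hX1
  have hD : (0:ℝ) < D := by exact_mod_cast h.pos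
  set S := (Ioc 0 (X + 1)).filter (fun q => q.Prime ∧ ¬ q ∣ D ∧ (X:ℝ) ^ (1 / 2 - δ) < q ∧ (q:ℝ) ≤ Z) with hS
  have h2 : ∀ q ∈ S, vonMangoldt q * WW D χ X q ≤ (2 + δ) / (1 - η - δ) * X * (Real.log q / (q - 1)) := by
    intro q hq
    rw [hS, mem_filter] at hq
    obtain ⟨_, hqp, hqD, hqX, hqZ⟩ := hq
    apply hbt q hqp hqD
    have hq0 : (0:ℝ) < q := by exact_mod_cast hqp.pos
    rw [le_div_iff₀ (by positivity)]
    calc (X:ℝ) ^ (1 - η - δ) * (q * D) ≤ (X:ℝ) ^ (1 - η - δ) * ((2 * (X:ℝ) ^ η) * D) := by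
          gcongr
          exact hqZ.trans hZ
      _ = (X:ℝ) ^ (1 - η - δ) * (X:ℝ) ^ η * (2 * D) := by ring
      _ ≤ (X:ℝ) ^ (1 - η - δ) * (X:ℝ) ^ η * (X:ℝ) ^ δ := by gcongr
      _ = X := by
          rw [← Real.rpow_add hX0, ← Real.rpow_add hX0]
          have : 1 - η - δ + η + δ = 1 := by ring
          rw [this, Real.rpow_one]
  refine (sum_le_sum h2).trans ?_
  rw [← mul_sum]
  have hyz : (X:ℝ) ^ (1 / 2 - δ) ≤ 2 * (X:ℝ) ^ η := by
    have := Real.rpow_le_rpow_of_exponent_le hX1' (show 1 / 2 - δ ≤ η by linarith)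
    have : 0 ≤ (X:ℝ) ^ η := by positivity
    linarith
  have h3 := psum (y := (X:ℝ) ^ (1 / 2 - δ)) (z := 2 * (X:ℝ) ^ η) (κ := δ)
    (Real.one_le_rpow hX1' (by linarith)) hyz hδ S (by
    intro q hq
    rw [hS, mem_filter] at hq
    obtain ⟨_, hqp, hqD, hqX, hqZ⟩ := hq
    refine ⟨hqp, hqX, hqZ.trans hZ, ?_⟩
    have := hXd.trans hqX.le
    rw [div_le_iff₀ hδ] at this
    linarith)
  rw [Real.log_mul (by norm_num) (by positivity), Real.log_rpow hX0, Real.log_rpow hX0] at h3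
  rw [div_le_iff₀ hδ] at hL
  have hl2 := Real.log_two_lt_d9
  calc _ ≤ (2 + δ) / (1 - η - δ) * (X:ℝ) * ((1 + δ) * ((η - 1 / 2 + 2 * δ) * Real.log X)) := by
        gcongr
        refine h3.trans ?_
        gcongr
        linarith
    _ = _ := by ring

open Classical in
/-- primes whose shift has a large prime factor -/
noncomputable def CC (D : ℕ) (χ : ℕ → ℤ) (X : ℕ) (Z : ℝ) : Finset ℕ :=
  (PP D X).filter (fun p => ∃ q : ℕ, q.Prime ∧ Z < q ∧ q ∣ mm χ p)

lemma p6 (h1 : PMOne D χ) (X : ℕ) (Z : ℝ) :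
    ∑ q ∈ (Ioc 0 (X + 1)).filter (fun q : ℕ => q.Prime ∧ Z < (q:ℝ)), vonMangoldt q * WW D χ X q ≤
      (CC D χ X Z).card *
        (Real.log X * Real.log (X + 1)) := by
  unfold WW CC
  have e0 : ∀ q : ℕ, vonMangoldt q * ∑ p ∈ (PP D X).filter (fun p => q ∣ mm χ p), Real.log p =
      ∑ p ∈ PP D X, vonMangoldt q * (if q ∣ mm χ p then Real.log p else 0) := by
    intro q
    rw [sum_filter, mul_sum]
  simp_rw [e0]
  rw [sum_comm, ← nsmul_eq_mul, ← sum_const, sum_filter]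
  apply sum_le_sum
  intro p hp
  have hb := mm_bounds h1 hp
  have hpX := (mem_PP.mp hp).1
  have hlp : 0 ≤ Real.log p := Real.log_natCast_nonneg p
  split_ifs with hex
  · have e1 : ∑ x ∈ (Ioc 0 (X + 1)).filter (fun q : ℕ => q.Prime ∧ Z < (q:ℝ)),
        vonMangoldt x * (if x ∣ mm χ p then Real.log p else 0) ≤
        ∑ x ∈ (mm χ p).divisors, vonMangoldt x * Real.log p := by
      simp_rw [mul_ite, mul_zero]
      rw [← sum_filter]
      apply sum_le_sum_of_subset_of_nonneg
      · intro x hx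
        rw [mem_filter] at hx
        rw [Nat.mem_divisors]
        exact ⟨hx.2, by omega⟩
      · intro n _ _
        exact mul_nonneg vonMangoldt_nonneg hlp
    refine e1.trans ?_
    rw [← sum_mul, vonMangoldt_sum, mul_comm]
    have a1 : Real.log p ≤ Real.log X := log_mono_nat hpX
    have a2 : Real.log (mm χ p) ≤ Real.log (X + 1) := by
      have := log_mono_nat (show mm χ p ≤ X + 1 by omega)
      exact_mod_cast this
    have a3 : 0 ≤ Real.log (mm χ p) := Real.log_natCast_nonneg _
    gcongr
  · apply le_of_eq
    apply sum_eq_zero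
    intro q hq
    rw [mem_filter] at hq
    rw [if_neg, mul_zero]
    intro hd
    exact hex ⟨q, hq.2.1, hq.2.2, hd⟩

end FinL

namespace FinL
open Finset BVL ArithmeticFunction

variable {D : ℕ} {χ : ℕ → ℤ}

lemma t_lower (hD : 0 < D) (h1 : PMOne D χ) {ε : ℝ} (hε : 0 < ε) : ∀ᶠ X : ℕ in Filter.atTop,
    Chebyshev.theta X * Real.log X - ε * X * Real.log X ≤
      ∑ p ∈ PP D X, Real.log p * Real.log (mm χ p) := by
  set δ := min (ε / 8) (1 / 2) with hδ
  have hδ0 : 0 < δ := by positivity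
  have hδε : δ ≤ ε / 8 := min_le_left _ _
  have hδ2 : δ ≤ 1 / 2 := min_le_right _ _
  set K := ∑ n ∈ D.divisors, Real.log n with hK
  filter_upwards [evpow hδ0 (16 / ε), evlog 1, evlog (6 / ε), evpow one_pos (4 * K / ε),
    Filter.eventually_ge_atTop 2] with X hXd hL1 hL6 hXK hX2
  rw [Real.rpow_one] at hXK
  have hX2' : (2:ℝ) ≤ X := by exact_mod_cast hX2
  have hX0 : (0:ℝ) < X := by linarith
  set L := Real.log X with hLdef
  have hl2 := Real.log_two_lt_d9
  have hl20 := Real.log_two_gt_d9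
  have hl4 : Real.log 4 ≤ 2 := by
    rw [show (4:ℝ) = 2 ^ 2 by norm_num, Real.log_pow]; push_cast; linarith
  have hth : Chebyshev.theta X ≤ 2 * X := (Chebyshev.theta_le_log4_mul_x hX0.le).trans (by gcongr)
  -- split theta
  set PA := (Icc 0 X).filter (fun p => p.Prime) with hPA
  have hthe : Chebyshev.theta X = ∑ p ∈ PA, Real.log p := by
    rw [Chebyshev.theta_eq_sum_Icc, Nat.floor_natCast]
  have hth2 : Chebyshev.theta X ≤ K + ∑ p ∈ PP D X, Real.log p := by
    rw [hthe, ← sum_filter_add_sum_filter_not PA (fun p => p ∣ D)]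
    refine add_le_add ?_ (le_of_eq ?_)
    · apply sum_le_sum_of_subset_of_nonneg
      · intro p hp
        rw [mem_filter] at hp
        rw [Nat.mem_divisors]; exact ⟨hp.2, by omega⟩
      · intro n _ _; exact Real.log_natCast_nonneg n
    · apply sum_congr _ (fun _ _ => rfl)
      ext p
      rw [mem_PP, mem_filter, hPA, mem_filter, mem_Icc]
      constructor
      · rintro ⟨⟨⟨_, a⟩, b⟩, c⟩; exact ⟨a, b, c⟩
      · rintro ⟨a, b, c⟩; exact ⟨⟨⟨by omega, a⟩, b⟩, c⟩
  set PS := (Icc 0 ⌊(X:ℝ) ^ (1 - δ)⌋₊).filter (fun p => p.Prime) with hPS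
  have hsm : ∑ p ∈ PS, Real.log p ≤ 2 * (X:ℝ) ^ (1 - δ) := by
    rw [hPS, ← Chebyshev.theta_eq_sum_Icc]
    exact (Chebyshev.theta_le_log4_mul_x (by positivity)).trans (by gcongr)
  have hpt : ∀ p ∈ PP D X, Real.log p * L ≤ Real.log p * Real.log (mm χ p) + Real.log p * (δ * L + Real.log 2) +
      (if p ∈ PS then Real.log p * (2 * L) else 0) := by
    intro p hp
    have hb := mm_bounds h1 hp
    obtain ⟨hpX, hpp, hpD⟩ := mem_PP.mp hp
    have hp2 : (2:ℝ) ≤ p := by exact_mod_cast hpp.two_le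
    have hlp : 0 ≤ Real.log p := Real.log_natCast_nonneg p
    have hm : Real.log p - Real.log 2 ≤ Real.log (mm χ p) := by
      rw [← Real.log_div (by positivity) (by norm_num)]
      apply Real.log_le_log (by positivity)
      have : ((p - 1 : ℕ) : ℝ) ≤ mm χ p := by exact_mod_cast hb.1
      rw [Nat.cast_sub hpp.one_le] at this
      push_cast at this
      linarith
    split_ifs with hps
    · have : 0 ≤ Real.log (mm χ p) := Real.log_natCast_nonneg _
      have a1 : 0 ≤ Real.log p * Real.log (mm χ p) := by positivity
      have a2 : 0 ≤ Real.log p * (δ * L + Real.log 2) := by positivity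
      have a3 : 0 ≤ Real.log p * L := by positivity
      linarith
    · have hgt : (X:ℝ) ^ (1 - δ) < p := by
        by_contra hcon
        push Not at hcon
        apply hps
        rw [hPS, mem_filter, mem_Icc]
        exact ⟨⟨by omega, Nat.le_floor hcon⟩, hpp⟩
      have : (1 - δ) * L ≤ Real.log p := by
        rw [hLdef, ← Real.log_rpow hX0]
        exact Real.log_le_log (by positivity) hgt.le
      rw [add_zero, ← mul_add]
      gcongr
      linarith
  have hsum := sum_le_sum hpt
  rw [sum_add_distrib, sum_add_distrib, ← sum_mul, ← sum_mul, ← sum_filter, ← sum_mul] at hsum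
  have hsub : ∑ p ∈ (PP D X).filter (fun p => p ∈ PS), Real.log p ≤ 2 * (X:ℝ) ^ (1 - δ) := by
    refine le_trans ?_ hsm
    apply sum_le_sum_of_subset_of_nonneg
    · intro p hp; exact (mem_filter.mp hp).2
    · intro n _ _; exact Real.log_natCast_nonneg n
  have hPPle : ∑ p ∈ PP D X, Real.log p ≤ 2 * X := by
    refine le_trans ?_ hth
    rw [hthe]
    apply sum_le_sum_of_subset_of_nonneg
    · intro p hp
      obtain ⟨hpX, hpp, hpD⟩ := mem_PP.mp hp
      rw [hPA, mem_filter, mem_Icc]; exact ⟨⟨by omega, hpX⟩, hpp⟩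
    · intro n _ _; exact Real.log_natCast_nonneg n
  have b1 : K * L ≤ ε / 4 * X * L := by
    rw [div_le_iff₀ hε] at hXK
    have : K ≤ ε / 4 * X := by linarith
    gcongr
  have b2 : (∑ p ∈ PP D X, Real.log p) * (δ * L + Real.log 2) ≤ ε / 4 * X * L + ε / 4 * X * L := by
    rw [div_le_iff₀ hε] at hL6
    calc _ ≤ 2 * (X:ℝ) * (ε / 8 * L + 3 / 4) := by
          gcongr
          linarith
      _ ≤ _ := by nlinarith
  have b3 : (∑ p ∈ (PP D X).filter (fun p => p ∈ PS), Real.log p) * (2 * L) ≤ ε / 4 * X * L := by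
    have e : (X:ℝ) = (X:ℝ) ^ δ * (X:ℝ) ^ (1 - δ) := by
      rw [← Real.rpow_add hX0]; simp
    have : 16 / ε * (X:ℝ) ^ (1 - δ) ≤ X := by
      calc _ ≤ (X:ℝ) ^ δ * (X:ℝ) ^ (1 - δ) := by gcongr
        _ = X := e.symm
    have h16 : 16 * (X:ℝ) ^ (1 - δ) ≤ ε * X := by
      have h2 := mul_le_mul_of_nonneg_left this hε.le
      calc _ = ε * (16 / ε * (X:ℝ) ^ (1 - δ)) := by field_simp
        _ ≤ _ := h2
    calc _ ≤ 2 * (X:ℝ) ^ (1 - δ) * (2 * L) := by gcongr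
      _ = (4 * (X:ℝ) ^ (1 - δ)) * L := by ring
      _ ≤ _ := mul_le_mul_of_nonneg_right (by linarith) (by linarith)
  have b4 : Chebyshev.theta X * L ≤ K * L + (∑ p ∈ PP D X, Real.log p) * L := by
    rw [← add_mul]; gcongr
  linarith

lemma mem_CC {X : ℕ} {Z : ℝ} {p : ℕ} :
    p ∈ CC D χ X Z ↔ p ∈ PP D X ∧ ∃ q : ℕ, q.Prime ∧ Z < q ∧ q ∣ mm χ p := by
  classical
  unfold CC
  rw [mem_filter]

lemma sum_cover {S S1 S2 : Finset ℕ} {F : ℕ → ℝ} (hF : ∀ n, 0 ≤ F n) (h : S ⊆ S1 ∪ S2) :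
    ∑ n ∈ S, F n ≤ ∑ n ∈ S1, F n + ∑ n ∈ S2, F n := by
  rw [← sum_union_inter]
  have h1 : ∑ n ∈ S, F n ≤ ∑ n ∈ S1 ∪ S2, F n := sum_le_sum_of_subset_of_nonneg h (fun n _ _ => hF n)
  have h2 : 0 ≤ ∑ n ∈ S1 ∩ S2, F n := sum_nonneg (fun n _ => hF n)
  linarith

lemma upper (h : GoodChi D χ) (h1 : PMOne D χ) {δ η ε : ℝ} (hδ : 0 < δ) (hδ1 : δ < 1 / 4) (hη : 1 / 2 < η)
    (hηδ : 0 < 1 - η - δ) (hε : 0 < ε) :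
    ∀ᶠ X : ℕ in Filter.atTop, ∀ Z : ℝ, Z ≤ 2 * (X:ℝ) ^ η →
      ∑ p ∈ PP D X, Real.log p * Real.log (mm χ p) ≤
        ε * X * Real.log X + ε * X * Real.log X + 13 * δ * X * Real.log X +
        (Chebyshev.psi X * (Real.log X / 2) + ε * X) +
        (2 + δ) / (1 - η - δ) * (1 + δ) * (η - 1 / 2 + 2 * δ) * X * Real.log X +
        (CC D χ X Z).card * (Real.log X * Real.log (X + 1)) := by
  obtain ⟨T0, hT0⟩ := p2 h1 hε
  set T := max T0 D with hT
  filter_upwards [p1 (D := D) (χ := χ) T hε, p3 h h1 hδ hδ1.le, p4 h h1 hδ hδ1 hε, p5 h h1 hδ hδ1 hη hηδ,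
    Filter.eventually_ge_atTop 1] with X a1 a3 a4 a5 hX1
  intro Z hZ
  have a5 := a5 Z hZ
  have a6 := p6 h1 X Z
  have a2 := hT0 T (le_max_left _ _) X hX1
  have hX1' : (1:ℝ) ≤ X := by exact_mod_cast hX1
  rw [total_eq h1]
  have hF : ∀ n, 0 ≤ vonMangoldt n * WW D χ X n := fun n =>
    mul_nonneg vonMangoldt_nonneg (WW_nonneg X n)
  set S1 := Ioc 0 T with hS1
  set S2 := (Ioc 0 (X + 1)).filter (fun n => T < n ∧ ¬ n.Prime) with hS2
  set S3 := (Ioc 0 (X + 1)).filter (fun q => q.Prime ∧ ¬ q ∣ D ∧ (q:ℝ) ≤ (X:ℝ) ^ δ) with hS3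
  set S4 := QM D δ X with hS4
  set S5 := (Ioc 0 (X + 1)).filter (fun q => q.Prime ∧ ¬ q ∣ D ∧ (X:ℝ) ^ (1 / 2 - δ) < q ∧ (q:ℝ) ≤ Z) with hS5
  set S6 := (Ioc 0 (X + 1)).filter (fun q : ℕ => q.Prime ∧ Z < (q:ℝ)) with hS6
  have hcov : Ioc 0 (X + 1) ⊆ S1 ∪ (S2 ∪ (S3 ∪ (S4 ∪ (S5 ∪ S6)))) := by
    intro n hn
    simp only [mem_union]
    by_cases hnT : n ≤ T
    · left; rw [hS1, mem_Ioc]; exact ⟨(mem_Ioc.mp hn).1, hnT⟩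
    right
    push Not at hnT
    by_cases hp : n.Prime
    swap
    · left; rw [hS2, mem_filter]; exact ⟨hn, hnT, hp⟩
    right
    have hnD : ¬ n ∣ D := by
      intro hd
      have := Nat.le_of_dvd h.pos hd
      have : D ≤ T := le_max_right _ _
      omega
    by_cases h3 : (n:ℝ) ≤ (X:ℝ) ^ δ
    · left; rw [hS3, mem_filter]; exact ⟨hn, hp, hnD, h3⟩
    right
    push Not at h3
    by_cases h4 : (n:ℝ) ≤ (X:ℝ) ^ (1 / 2 - δ)
    · left
      rw [hS4]
      simp only [QM, mem_filter, mem_Ioc]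
      refine ⟨⟨hp.pos, ?_⟩, hp, hnD, h3, h4⟩
      have : (X:ℝ) ^ (1 / 2 - δ) ≤ (X:ℝ) ^ (1:ℝ) := Real.rpow_le_rpow_of_exponent_le hX1' (by linarith)
      rw [Real.rpow_one] at this
      exact_mod_cast h4.trans this
    right
    push Not at h4
    by_cases h5 : (n:ℝ) ≤ Z
    · left; rw [hS5, mem_filter]; exact ⟨hn, hp, hnD, h4, h5⟩
    right
    push Not at h5
    rw [hS6, mem_filter]; exact ⟨hn, hp, h5⟩
  have c1 := sum_cover hF hcov
  have c2 := sum_cover hF (le_refl (S2 ∪ (S3 ∪ (S4 ∪ (S5 ∪ S6)))))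
  have c3 := sum_cover hF (le_refl (S3 ∪ (S4 ∪ (S5 ∪ S6))))
  have c4 := sum_cover hF (le_refl (S4 ∪ (S5 ∪ S6)))
  have c5 := sum_cover hF (le_refl (S5 ∪ S6))
  linarith

lemma choose_delta {η e : ℝ} (hη2 : η < 3 / 5) (he : 0 < e) :
    ∃ δ : ℝ, 0 < δ ∧ δ < 1 / 4 ∧ 13 * δ < e ∧ 0 < 1 - η - δ ∧
      (2 + δ) / (1 - η - δ) * (1 + δ) * (η - 1 / 2 + 2 * δ) < 2 * (η - 1 / 2) / (1 - η) + e := by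
  have hc : ContinuousAt (fun δ : ℝ => (2 + δ) / (1 - η - δ) * (1 + δ) * (η - 1 / 2 + 2 * δ)) 0 := by
    have : (1 - η - 0) ≠ 0 := by linarith
    fun_prop (disch := assumption)
  have h1 : ∀ᶠ δ : ℝ in nhds 0, (2 + δ) / (1 - η - δ) * (1 + δ) * (η - 1 / 2 + 2 * δ) < 2 * (η - 1 / 2) / (1 - η) + e := by
    apply hc.eventually_lt_const
    have : (2 + (0:ℝ)) / (1 - η - 0) * (1 + 0) * (η - 1 / 2 + 2 * 0) = 2 * (η - 1 / 2) / (1 - η) := by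
      simp only [add_zero, sub_zero, mul_zero, mul_one]; ring
    linarith
  have h2 : ∀ᶠ δ : ℝ in nhds 0, δ < min (min (1 / 4) (e / 13)) (1 - η) :=
    eventually_lt_nhds (by
      refine lt_min (lt_min (by norm_num) (by positivity)) (by linarith))
  have h3 : ∀ᶠ δ : ℝ in nhdsWithin 0 (Set.Ioi 0), 0 < δ := eventually_mem_nhdsWithin
  obtain ⟨δ, a, b, c⟩ := ((h1.filter_mono nhdsWithin_le_nhds).and
    ((h2.filter_mono nhdsWithin_le_nhds).and h3)).exists
  rw [lt_min_iff, lt_min_iff] at b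
  refine ⟨δ, c, b.1.1, by linarith [b.1.2], by linarith [b.2], a⟩

lemma ev_pi {e : ℝ} (he : 0 < e) : ∀ᶠ X : ℕ in Filter.atTop,
    (Nat.primeCounting X : ℝ) * Real.log X ≤ Chebyshev.theta X + e * X := by
  obtain ⟨C, hC⟩ := Chebyshev.primeCounting_sub_theta_div_log_isBigO.bound
  filter_upwards [tendsto_natCast_atTop_atTop.eventually hC, evlog (C / e), evlog 1] with X h1 h2 h3
  rw [Nat.floor_natCast] at h1
  have hX0 : (0:ℝ) ≤ X := Nat.cast_nonneg X
  have hL : 0 < Real.log X := by linarith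
  have h4 := (le_abs_self _).trans h1
  rw [Real.norm_of_nonneg (by positivity)] at h4
  rw [div_le_iff₀ he] at h2
  have h5 : (Nat.primeCounting X : ℝ) * Real.log X ≤ Chebyshev.theta X + C * X / Real.log X := by
    have := mul_le_mul_of_nonneg_right h4 hL.le
    have e1 : ((Nat.primeCounting X : ℝ) - Chebyshev.theta X / Real.log X) * Real.log X =
      Nat.primeCounting X * Real.log X - Chebyshev.theta X := by field_simp
    have e2 : C * (X / Real.log X ^ 2) * Real.log X = C * X / Real.log X := by field_simp
    linarith
  have h6 : C * X / Real.log X ≤ e * X := by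
    rw [div_le_iff₀ hL]; nlinarith
  linarith

lemma ev_psi {e : ℝ} (he : 0 < e) : ∀ᶠ X : ℕ in Filter.atTop,
    Chebyshev.psi X ≤ Chebyshev.theta X + e * X := by
  obtain ⟨C, hC⟩ := Chebyshev.psi_sub_theta_le_mul_sqrt
  filter_upwards [evpow (δ := 1 / 2) (by norm_num) (C / e)] with X h1
  have h2 := hC X
  rw [← Real.sqrt_eq_rpow, div_le_iff₀ he] at h1
  have h3 : √(X:ℝ) * √X = X := Real.mul_self_sqrt (Nat.cast_nonneg X)
  have h4 := Real.sqrt_nonneg (X:ℝ)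
  have h5 : C * √X ≤ e * X := by
    calc C * √X ≤ (√X * e) * √X := by gcongr
      _ = e * (√X * √X) := by ring
      _ = _ := by rw [h3]
  linarith

theorem final_nat (h : GoodChi D χ) (h1 : PMOne D χ) {η ε : ℝ} (hη : 1 / 2 < η) (hη2 : η < 3 / 5)
    (hε : 0 < ε) :
    ∀ᶠ X : ℕ in Filter.atTop, ∀ Z : ℝ, Z ≤ 2 * (X:ℝ) ^ η →
      ((3 - 5 * η) / (2 * (1 - η)) - ε) * (Nat.primeCounting X : ℝ) ≤ (CC D χ X Z).card := by
  set e := min (ε / 16) (1 / 10) with he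
  have he0 : 0 < e := by positivity
  have heε : e ≤ ε / 16 := min_le_left _ _
  have he1 : e ≤ 1 / 10 := min_le_right _ _
  obtain ⟨δ, hδ0, hδ1, hδ2, hδ3, hδ4⟩ := choose_delta hη2 he0
  set f := (2 + δ) / (1 - η - δ) * (1 + δ) * (η - 1 / 2 + 2 * δ) with hf
  set B := 2 * (η - 1 / 2) / (1 - η) with hB
  have hB0 : 0 ≤ B := by
    apply div_nonneg <;> linarith
  have hB1 : B ≤ 1 / 2 := by
    rw [hB, div_le_iff₀ (by linarith)]; linarith
  have hc : (3 - 5 * η) / (2 * (1 - η)) = 1 / 2 - B := by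
    have : (1 - η) ≠ 0 := by linarith
    rw [hB]; field_simp; ring
  rw [hc]
  filter_upwards [upper h h1 hδ0 hδ1 hη hδ3 he0, t_lower h.pos h1 he0, ev_pi he0, ev_psi he0,
    tendsto_natCast_atTop_atTop.eventually (PNTL.pnt_theta he0 (by linarith)), evlog 1, evlog (1 / e),
    Filter.eventually_ge_atTop 2] with X hup hlow hpi hpsi hpnt hL1 hLe hX2
  intro Z hZ
  have hup := hup Z hZ
  rw [← hf] at hup
  have hX2' : (2:ℝ) ≤ X := by exact_mod_cast hX2
  have hX0 : (0:ℝ) < X := by linarith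
  set L := Real.log X with hL
  set th := Chebyshev.theta X with hth
  set ps := Chebyshev.psi X with hps
  set pc : ℝ := (Nat.primeCounting X : ℝ) with hpc
  have hthpi : th ≤ pc * L := Chebyshev.theta_le_pi_mul_log X
  set N : ℝ := ((CC D χ X Z).card : ℝ) with hN
  have hN0 : 0 ≤ N := Nat.cast_nonneg _
  have hNpc : N ≤ pc := by
    rw [hN, hpc]
    have : (CC D χ X Z).card ≤ Nat.primeCounting X := by
      rw [← Nat.primesLE_card_eq_primeCounting]
      apply card_le_card
      intro p hp
      have hp2 := mem_PP.mp (mem_CC.mp hp).1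
      rw [Nat.mem_primesLE]
      exact ⟨hp2.1, hp2.2.1⟩
    exact_mod_cast this
  have hlog1 : Real.log (X + 1) ≤ (1 + e) * L := by
    have l1 : Real.log (X + 1) ≤ Real.log (2 * X) := Real.log_le_log (by positivity) (by linarith)
    rw [Real.log_mul (by norm_num) (by positivity)] at l1
    have := Real.log_two_lt_d9
    rw [div_le_iff₀ he0] at hLe
    nlinarith
  have hL0 : 0 < L := by linarith
  -- divide by L
  have k1 : th - 6 * e * X ≤ ps / 2 + B * X + N * ((1 + e) * L) := by
    have m1 : N * (L * Real.log (X + 1)) ≤ N * (L * ((1 + e) * L)) := by gcongr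
    have m2 : f * X * L ≤ (B + e) * X * L := by gcongr
    have m3 : 13 * δ * X * L ≤ e * X * L := by gcongr
    have m4 : e * X ≤ e * X * L := le_mul_of_one_le_right (by positivity) hL1
    have m5 : (th - 6 * e * X) * L ≤ (ps / 2 + B * X + N * ((1 + e) * L)) * L := by linarith
    exact le_of_mul_le_mul_right m5 hL0
  have k2 : B * X ≤ B * th + e * X / 2 := by
    have : B * X ≤ B * (th + e * X) := by gcongr; linarith
    have : B * (e * X) ≤ 1 / 2 * (e * X) := by gcongr
    linarith
  have k3 : (1 / 2 - B) * (pc * L) ≤ (1 / 2 - B) * th + e * X / 2 := by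
    have c1 : (1 / 2 - B) * (pc * L) ≤ (1 / 2 - B) * (th + e * X) := by
      apply mul_le_mul_of_nonneg_left hpi; linarith
    have c2 : 0 ≤ B * (e * X) := by positivity
    linarith
  have k4 : X ≤ 2 * (pc * L) := by nlinarith
  have k5 : e * X ≤ e * (2 * (pc * L)) := by gcongr
  have k6 : ((1 / 2 - B) * pc - 15 * e * pc) * L ≤ (N * (1 + e)) * L := by linarith
  have k7 := le_of_mul_le_mul_right k6 hL0
  have k8 : e * N ≤ e * pc := by gcongr
  have hpc0 : 0 ≤ pc := Nat.cast_nonneg _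
  have k9 : e * pc ≤ ε / 16 * pc := by gcongr
  linarith

end FinL

namespace FinL
open Finset BVL

/-- the quadratic character attached to `d` -/
def chiD (d : ℤ) (n : ℕ) : ℤ := if n % 2 = 0 then 0 else jacobiSym d n

lemma chiD_good (d : ℤ) (hd : d ≠ 0) : GoodChi (4 * d.natAbs) (chiD d) where
  pos := by have := Int.natAbs_pos.mpr hd; omega
  mul := by
    intro m n
    unfold chiD
    rcases Nat.mod_two_eq_zero_or_one m with hm | hm <;> rcases Nat.mod_two_eq_zero_or_one n with hn | hn
    · simp [Nat.mul_mod, hm, hn]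
    · simp [Nat.mul_mod, hm, hn]
    · simp [Nat.mul_mod, hm, hn]
    · have hmn : (m * n) % 2 = 1 := by simp [Nat.mul_mod, hm, hn]
      have : NeZero m := ⟨by rintro rfl; omega⟩
      have : NeZero n := ⟨by rintro rfl; omega⟩
      rw [if_neg (by omega), if_neg (by omega), if_neg (by omega), jacobiSym.mul_right]
  val := by
    intro n
    unfold chiD
    split_ifs
    · left; rfl
    · exact jacobiSym.trichotomy d n
  per := by
    intro n
    unfold chiD
    rcases Nat.mod_two_eq_zero_or_one n with hn | hn
    · rw [if_pos (by omega), if_pos hn]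
    · rw [if_neg (by omega), if_neg (by omega)]
      rw [jacobiSym.mod_right d (Nat.odd_iff.mpr (show (n + 4 * d.natAbs) % 2 = 1 by omega)),
        jacobiSym.mod_right d (Nat.odd_iff.mpr hn), Nat.add_mod_right]

lemma chiD_chi (A : Matrix (Fin 2) (Fin 2) ℤ) (p : ℕ) (hp : p.Prime)
    (hpD : ¬ p ∣ 4 * (A.trace ^ 2 - 4).natAbs) :
    chiD (A.trace ^ 2 - 4) p = chi A p ∧ (chi A p = 1 ∨ chi A p = -1) := by
  have : Fact p.Prime := ⟨hp⟩
  set d := A.trace ^ 2 - 4 with hd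
  have hp2 : p ≠ 2 := by
    rintro rfl
    exact hpD ((show 2 ∣ 4 by norm_num).mul_right _)
  have hodd : p % 2 = 1 := Nat.odd_iff.mp (hp.odd_of_ne_two hp2)
  have hpd : ((d : ℤ) : ZMod p) ≠ 0 := by
    intro h0
    rw [ZMod.intCast_zmod_eq_zero_iff_dvd, Int.natCast_dvd] at h0
    exact hpD (h0.mul_left _)
  unfold chiD chi
  rw [if_neg (by omega), ← jacobiSym.legendreSym.to_jacobiSym, ← hd]
  by_cases hs : IsSquare ((d : ℤ) : ZMod p)
  · rw [if_pos ⟨hpd, hs⟩]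
    exact ⟨(legendreSym.eq_one_iff p hpd).mpr hs, Or.inl rfl⟩
  · rw [if_neg (fun h => hs h.2)]
    exact ⟨(legendreSym.eq_neg_one_iff p).mpr hs, Or.inr rfl⟩

end FinL

/-- For `1/2 < η < 3/5` and `c(η) = (3-5η)/(2(1-η))`: for large `x`, the number
of primes `p ≤ x`, `p ∤ D_A`, such that `p - χ(p)` has a prime factor
`q > x^η`, is at least `(c(η) - ε) π(x)`. -/
theorem positive_proportion_with_large_prime_factor
    (A : Matrix (Fin 2) (Fin 2) ℤ) (hA : A.det = 1) (htr : 2 < |A.trace|)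
    (η : ℝ) (hη₁ : 1 / 2 < η) (hη₂ : η < 3 / 5) :
    ∀ ε : ℝ, 0 < ε → ∃ x₀ : ℝ, ∀ x : ℝ, x₀ ≤ x →
      ((3 - 5 * η) / (2 * (1 - η)) - ε) * (Nat.primeCounting ⌊x⌋₊ : ℝ) ≤
        ({p : ℕ | p.Prime ∧ (p : ℝ) ≤ x ∧ ¬ (p ∣ (4 * (A.trace ^ 2 - 4)).natAbs) ∧
            ∃ q : ℕ, q.Prime ∧ x ^ η < (q : ℝ) ∧ (q : ℤ) ∣ ((p : ℤ) - chi A p)}.ncard : ℝ) := by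
  intro ε hε
  have hd : A.trace ^ 2 - 4 ≠ 0 := by
    have : (2:ℤ) ^ 2 < |A.trace| ^ 2 := by gcongr
    rw [sq_abs] at this
    omega
  have hDe : (4 * (A.trace ^ 2 - 4)).natAbs = 4 * (A.trace ^ 2 - 4).natAbs := by
    rw [Int.natAbs_mul]; rfl
  have hpm : FinL.PMOne (4 * (A.trace ^ 2 - 4).natAbs) (FinL.chiD (A.trace ^ 2 - 4)) := by
    intro p hp hpD
    obtain ⟨h1, h2⟩ := FinL.chiD_chi A p hp hpD
    rw [h1]; exact h2
  have hfin := FinL.final_nat (FinL.chiD_good _ hd) hpm hη₁ hη₂ hε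
  obtain ⟨X0, hX0⟩ := Filter.eventually_atTop.mp hfin
  refine ⟨(X0 : ℝ) + 1, ?_⟩
  intro x hx
  have hX0' : (0:ℝ) ≤ X0 := Nat.cast_nonneg _
  have hx1 : 1 ≤ x := by linarith
  have hfl : 1 ≤ ⌊x⌋₊ := Nat.le_floor (by exact_mod_cast hx1)
  have hZ : x ^ η ≤ 2 * ((⌊x⌋₊ : ℕ) : ℝ) ^ η := by
    have h1 : x ≤ 2 * ((⌊x⌋₊ : ℕ) : ℝ) := by
      have := Nat.lt_floor_add_one x
      have : (1:ℝ) ≤ ((⌊x⌋₊ : ℕ) : ℝ) := by exact_mod_cast hfl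
      linarith
    calc x ^ η ≤ (2 * ((⌊x⌋₊ : ℕ) : ℝ)) ^ η := Real.rpow_le_rpow (by linarith) h1 (by linarith)
      _ = 2 ^ η * ((⌊x⌋₊ : ℕ) : ℝ) ^ η := Real.mul_rpow (by norm_num) (Nat.cast_nonneg _)
      _ ≤ 2 ^ (1:ℝ) * ((⌊x⌋₊ : ℕ) : ℝ) ^ η := by
          gcongr
          · norm_num
          · linarith
      _ = _ := by rw [Real.rpow_one]
  refine (hX0 ⌊x⌋₊ (Nat.le_floor (by linarith)) (x ^ η) hZ).trans ?_
  rw [← Set.ncard_coe_finset]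
  have hle : ((FinL.CC (4 * (A.trace ^ 2 - 4).natAbs) (FinL.chiD (A.trace ^ 2 - 4)) ⌊x⌋₊ (x ^ η) : Finset ℕ) : Set ℕ).ncard ≤
      {p : ℕ | p.Prime ∧ (p : ℝ) ≤ x ∧ ¬ (p ∣ (4 * (A.trace ^ 2 - 4)).natAbs) ∧
            ∃ q : ℕ, q.Prime ∧ x ^ η < (q : ℝ) ∧ (q : ℤ) ∣ ((p : ℤ) - chi A p)}.ncard := by
    apply Set.ncard_le_ncard
    · intro p hp
      rw [Finset.mem_coe, FinL.mem_CC, FinL.mem_PP] at hp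
      obtain ⟨⟨hpX, hpp, hpD⟩, q, hq, hqZ, hqd⟩ := hp
      refine ⟨hpp, (Nat.le_floor_iff (by linarith)).mp hpX, by rw [hDe]; exact hpD, q, hq, hqZ, ?_⟩
      unfold FinL.mm at hqd
      rw [(FinL.chiD_chi A p hpp hpD).1] at hqd
      rwa [Int.natCast_dvd]
    · apply (Set.finite_Iic ⌊x⌋₊).subset
      rintro p ⟨_, hp, _⟩
      exact Nat.le_floor hp
  exact_mod_cast hle
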